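/- Let δ̄ > 0 and ε > 0. Then there is a constant C = C(ε, δ̄) > 0, depending only on ε and δ̄, such that for every pair (u, v) ∈ S(δ̄) and every h with 0 < h ≤ 1, the eccentricity satisfies η_u(h) ≤ C · h^{−ε}. -/

import Mathlib

noncomputable section

open MeasureTheory Metric Set
open scoped RealInnerProductSpace

abbrev R2 : Type := EuclideanSpace ℝ (Fin 2)

/-- `p` is a subgradient of `f` at `x`. -/
def SubgradAt (f : R2 → ℝ) (x p : R2) : Prop :=
  ∀ y : R2, f x + ⟪p, y - x⟫ ≤ f y

/-- `ψ` is a (canonically extended) potential of the optimal transport between `U₁` and `U₂`: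
it is convex on `ℝ²`, all its subgradients lie in `closure U₂`, and its gradient map pushes
the Lebesgue measure restricted to `U₁` forward to the Lebesgue measure restricted to `U₂`. -/
def IsOTPotential (U₁ U₂ : Set R2) (ψ : R2 → ℝ) : Prop :=
  ConvexOn ℝ Set.univ ψ ∧
  (∀ x p : R2, SubgradAt ψ x p → p ∈ closure U₂) ∧
  MeasureTheory.Measure.map (fun x => gradient ψ x) (MeasureTheory.volume.restrict U₁) =
    MeasureTheory.volume.restrict U₂

/-- `S` is a centred section of `w` at `x₀` of height `h`:
`S = {w < w x₀ + p · (· - x₀) + h}` for a slope `p` chosen so that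
the centre of mass of `S` is `x₀`. -/
def IsCentredSection (w : R2 → ℝ) (x₀ : R2) (h : ℝ) (S : Set R2) : Prop :=
  ∃ p : R2, S = {x : R2 | w x < w x₀ + ⟪p, x - x₀⟫ + h} ∧
    (∫ x in S, (x - x₀) ∂(MeasureTheory.volume)) = 0

/-- Dilation of `S` about `x₀` by factor `t`. -/
def dilate (x₀ : R2) (t : ℝ) (S : Set R2) : Set R2 :=
  (fun x => x₀ + t • (x - x₀)) '' S

/-- The (closed) ellipse centred at `0` with half-axis `A` in unit direction `e` and
half-axis `B` in the orthogonal unit direction `f`. -/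
def ellipse (e f : R2) (A B : ℝ) : Set R2 :=
  {x : R2 | (⟪x, e⟫ / A) ^ 2 + (⟪x, f⟫ / B) ^ 2 ≤ 1}

/-- `w` is an Alexandrov solution of `det D² w = χ_Ω` in `ℝ²`: the Lebesgue measure of the
subdifferential image of any Borel set `E` equals the Lebesgue measure of `E ∩ Ω`. -/
def AlexandrovSol (w : R2 → ℝ) (Ω : Set R2) : Prop :=
  ∀ E : Set R2, MeasurableSet E →
    MeasureTheory.volume (⋃ x ∈ E, {p : R2 | SubgradAt w x p}) =
      MeasureTheory.volume (E ∩ Ω)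

/-- Membership of the pair `(u, v)` in the normalized family `S(δ̄)`, together with the
associated data: the domains `Ω₁, Ω₂`, and, for each height `h ∈ (0,1]`, the ellipse
`E_h = ellipse (e h) (f h) (L h) (l h)` centred at `0` (long half-axis `L h` in unit
direction `e h`, short half-axis `l h` in the orthogonal unit direction `f h`, area `hπ`,
so `L h * l h = h`), whose perpendicular ellipse is
`E_h^⊥ = ellipse (f h) (e h) (L h) (l h)`.  The eccentricity is `η_u(h) = L h / l h`. -/
def InSFamily (δb : ℝ) (u v : R2 → ℝ) (Ω₁ Ω₂ : Set R2)
    (L l : ℝ → ℝ) (e f : ℝ → R2) : Prop :=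
  ConvexOn ℝ Set.univ u ∧ ConvexOn ℝ Set.univ v ∧
  Convex ℝ Ω₁ ∧ Convex ℝ Ω₂ ∧
  (interior Ω₁).Nonempty ∧ (interior Ω₂).Nonempty ∧
  (0 : R2) ∈ frontier Ω₁ ∧ (0 : R2) ∈ frontier Ω₂ ∧
  (fun x => gradient u x) '' Ω₁ = Ω₂ ∧ (fun y => gradient v y) '' Ω₂ = Ω₁ ∧
  AlexandrovSol u Ω₁ ∧ u 0 = 0 ∧ SubgradAt u 0 0 ∧
  AlexandrovSol v Ω₂ ∧ v 0 = 0 ∧ SubgradAt v 0 0 ∧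
  (∀ y ∈ Ω₂, v y = ⨆ x : R2, (⟪x, y⟫ - u x)) ∧
  L 1 = 1 ∧ l 1 = 1 ∧
  (∀ h : ℝ, h ∈ Set.Ioc (0 : ℝ) 1 →
    ‖e h‖ = 1 ∧ ‖f h‖ = 1 ∧ ⟪e h, f h⟫ = 0 ∧
    0 < l h ∧ l h ≤ L h ∧ L h * l h = h ∧
    (∃ S : Set R2, IsCentredSection u 0 h S ∧
      (∃ xh : R2, (fun z => xh + δb • z) '' ellipse (e h) (f h) (L h) (l h) ⊆ Ω₁ ∩ S) ∧
      S ⊆ (fun z => δb⁻¹ • z) '' ellipse (e h) (f h) (L h) (l h)) ∧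
    (∃ S : Set R2, IsCentredSection v 0 h S ∧
      (∃ yh : R2, (fun z => yh + δb • z) '' ellipse (f h) (e h) (L h) (l h) ⊆ Ω₂ ∩ S) ∧
      S ⊆ (fun z => δb⁻¹ • z) '' ellipse (f h) (e h) (L h) (l h)))

/-- `z ↦ t • x` cone over `Ω` with vertex `0` (closed): the tangent cone of `Ω` at `0`. -/
def tangentConeZero (Ω : Set R2) : Set R2 :=
  closure {y : R2 | ∃ t : ℝ, 0 ≤ t ∧ ∃ x ∈ Ω, y = t • x}

/-- The planar cross product (determinant) of two vectors. -/
def det2 (a b : R2) : ℝ := a 0 * b 1 - a 1 * b 0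

/-- `r` is the unit direction of the right tangent ray of `∂Ω` at `0`:
it lies in the tangent cone of `Ω` at `0` and the whole tangent cone lies
(weakly) counterclockwise from it. -/
def IsRightTangent (Ω : Set R2) (r : R2) : Prop :=
  ‖r‖ = 1 ∧ r ∈ tangentConeZero Ω ∧ ∀ x ∈ tangentConeZero Ω, 0 ≤ det2 r x

/-- `l` is the unit direction of the left tangent ray of `∂Ω` at `0`:
it lies in the tangent cone of `Ω` at `0` and the whole tangent cone lies
(weakly) clockwise from it. -/
def IsLeftTangent (Ω : Set R2) (l : R2) : Prop :=
  ‖l‖ = 1 ∧ l ∈ tangentConeZero Ω ∧ ∀ x ∈ tangentConeZero Ω, det2 l x ≤ 0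

/-- The open cone of direction `e` and opening angle `θ`. -/
def cone2 (e : R2) (θ : ℝ) : Set R2 :=
  {y : R2 | ∃ lam : ℝ, 0 < lam ∧ ∃ w : R2, ‖w‖ = 1 ∧
    InnerProductGeometry.angle w e < θ ∧ y = lam • w}

section ConvexBasics

variable {E : Type*} [NormedAddCommGroup E] [InnerProductSpace ℝ E]

/-- `p` is a subgradient of `f` at `x`. -/
def IsSub (f : E → ℝ) (x p : E) : Prop :=
  ∀ y : E, f x + ⟪p, y - x⟫ ≤ f y

theorem IsSub.monotone {f : E → ℝ} {x p x' p' : E} (h : IsSub f x p) (h' : IsSub f x' p') :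
    0 ≤ ⟪p' - p, x' - x⟫ := by
  have h1 := h x'
  have h2 := h' x
  have h3 : ⟪p', x - x'⟫ = -⟪p', x' - x⟫ := by rw [← inner_neg_right, neg_sub]
  rw [inner_sub_left]
  linarith

theorem IsSub.of_value_le {f : E → ℝ} {x p x' : E} (h : IsSub f x p)
    (hx : f x' ≤ f x + ⟪p, x' - x⟫) : IsSub f x' p := by
  intro y
  have h1 := h y
  have h3 : ⟪p, y - x⟫ = ⟪p, y - x'⟫ + ⟪p, x' - x⟫ := by
    rw [← inner_add_right]; congr 1; abel
  linarith

theorem IsSub.swap {f : E → ℝ} {x p x' p' : E} (h : IsSub f x p) (h' : IsSub f x' p')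
    (h0 : ⟪p' - p, x' - x⟫ = 0) : IsSub f x' p := by
  apply h.of_value_le
  have h2 := h' x
  have h3 : ⟪p', x - x'⟫ = -⟪p', x' - x⟫ := by rw [← inner_neg_right, neg_sub]
  rw [inner_sub_left] at h0
  linarith

theorem IsSub.combo {f : E → ℝ} {x p p' : E} (h : IsSub f x p) (h' : IsSub f x p') {t : ℝ}
    (ht0 : 0 ≤ t) (ht1 : t ≤ 1) : IsSub f x (p + t • (p' - p)) := by
  intro y
  have h1 := h y
  have h2 := h' y
  rw [inner_add_left, real_inner_smul_left, inner_sub_left]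
  nlinarith

theorem IsSub.combo_left {f : E → ℝ} (hf : ConvexOn ℝ univ f) {x x' p : E} (h : IsSub f x p)
    (h' : IsSub f x' p) {t : ℝ} (ht0 : 0 ≤ t) (ht1 : t ≤ 1) : IsSub f (x + t • (x' - x)) p := by
  apply h.of_value_le
  have h1 := h x'
  have h2 := h' x
  have h4 : ⟪p, x - x'⟫ = -⟪p, x' - x⟫ := by rw [← inner_neg_right, neg_sub]
  have h3 := hf.2 (mem_univ x) (mem_univ x') (sub_nonneg.2 ht1) ht0 (by ring)
  have h5 : (1 - t) • x + t • x' = x + t • (x' - x) := by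
    rw [sub_smul, one_smul, smul_sub]; abel
  rw [h5] at h3
  have h6 : x + t • (x' - x) - x = t • (x' - x) := by abel
  rw [h6, real_inner_smul_right]
  simp only [smul_eq_mul] at h3
  nlinarith

theorem IsSub.segment {f : E → ℝ} (hf : ConvexOn ℝ univ f) {x p x' p' : E} (h : IsSub f x p)
    (h' : IsSub f x' p') (h0 : ⟪p' - p, x' - x⟫ = 0) {t : ℝ} (ht0 : 0 ≤ t) (ht1 : t ≤ 1) :
    IsSub f (x + t • (x' - x)) (p + t • (p' - p)) := by
  have h1 : IsSub f x' p := h.swap h' h0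
  have h2 : IsSub f x p' := by
    refine h'.swap h ?_
    rw [← neg_sub p' p, ← neg_sub x' x, inner_neg_neg, h0]
  exact (h.combo_left hf h1 ht0 ht1).combo (h2.combo_left hf h' ht0 ht1) ht0 ht1

theorem isSub_prox_unique {f : E → ℝ} {m m' X : E} (h : IsSub f m (X - m))
    (h' : IsSub f m' (X - m')) : m = m' := by
  have h1 := h.monotone h'
  have h2 : X - m' - (X - m) = -(m' - m) := by abel
  rw [h2, inner_neg_left, real_inner_self_eq_norm_sq] at h1
  have : ‖m' - m‖ = 0 := by nlinarith [norm_nonneg (m' - m)]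
  exact (sub_eq_zero.1 (norm_eq_zero.1 this)).symm

theorem IsSub.norm_le_of_bound {f : E → ℝ} {x p : E} (h : IsSub f x p)
    (h0 : 0 ≤ f x) {r C : ℝ} (hr : 0 < r) (hC : ∀ y, ‖y - x‖ ≤ r → f y ≤ C) : ‖p‖ ≤ C / r := by
  rw [le_div_iff₀ hr]
  by_cases hp : p = 0
  · have := hC x (by simp [hr.le])
    simp [hp]; linarith
  have hp' : 0 < ‖p‖ := norm_pos_iff.2 hp
  have h1 := h (x + (r / ‖p‖) • p)
  have h2 := hC (x + (r / ‖p‖) • p) (by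
    rw [add_sub_cancel_left, norm_smul, Real.norm_eq_abs, abs_of_pos (by positivity)]
    field_simp; exact le_refl _)
  rw [add_sub_cancel_left, real_inner_smul_right, real_inner_self_eq_norm_sq] at h1
  have : r / ‖p‖ * ‖p‖ ^ 2 = ‖p‖ * r := by field_simp
  linarith

variable [FiniteDimensional ℝ E]

theorem ConvexOn.continuous_of_univ {f : E → ℝ} (hf : ConvexOn ℝ univ f) : Continuous f :=
  continuousOn_univ.1 (hf.continuousOn isOpen_univ)

theorem exists_isSub {f : E → ℝ} (hf : ConvexOn ℝ univ f) (x : E) : ∃ p, IsSub f x p := by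
  have hc := ConvexOn.continuous_of_univ hf
  have hopen : IsOpen {q : E × ℝ | f q.1 < q.2} :=
    isOpen_lt (hc.comp continuous_fst) continuous_snd
  have hconv : Convex ℝ {q : E × ℝ | f q.1 < q.2} := by
    have := hf.convex_strict_epigraph
    simpa using this
  obtain ⟨φ, hφ⟩ := geometric_hahn_banach_open_point hconv hopen
    (x := (x, f x)) (by simp)
  have hsplit : ∀ (y : E) (r : ℝ), φ (y, r) = φ (y, 0) + r * φ (0, 1) := by
    intro y r
    have : (y, r) = (y, (0 : ℝ)) + r • ((0 : E), (1 : ℝ)) := by simp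
    rw [this, map_add, map_smul, smul_eq_mul]
  set c := φ (0, 1) with hcdef
  have hcneg : c < 0 := by
    have := hφ (x, f x + 1) (by simp)
    rw [hsplit x (f x + 1), hsplit x (f x)] at this
    linarith
  have hc0 : c ≠ 0 := hcneg.ne
  have hle : ∀ y, φ (y, 0) + f y * c ≤ φ (x, 0) + f x * c := by
    intro y
    by_contra hcon
    push Not at hcon
    set d := φ (y, 0) + f y * c - (φ (x, 0) + f x * c)
    have hd : 0 < d := by simp only [d]; linarith
    have := hφ (y, f y + d / (2 * -c)) (by
      have : 0 < d / (2 * -c) := by apply div_pos hd; linarith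
      simpa using this)
    rw [hsplit y, hsplit x (f x)] at this
    have h2 : d / (2 * -c) * c = -(d / 2) := by field_simp
    have : φ (y, 0) + f y * c - d / 2 < φ (x, 0) + f x * c := by
      rw [add_mul, h2] at this; linarith
    simp only [d] at this hd
    linarith
  let ψ : E →L[ℝ] ℝ := φ.comp (ContinuousLinearMap.inl ℝ E ℝ)
  refine ⟨(-c)⁻¹ • (InnerProductSpace.toDual ℝ E).symm ψ, fun y => ?_⟩
  rw [real_inner_smul_left, InnerProductSpace.toDual_symm_apply]
  have h1 : ψ (y - x) = φ (y, 0) - φ (x, 0) := by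
    rw [map_sub]; simp [ψ]
  rw [h1]
  have h2 := hle y
  have h3 : 0 < -c := by linarith
  rw [← sub_nonneg]
  have : f y - (f x + (-c)⁻¹ * (φ (y, 0) - φ (x, 0))) =
      (-c)⁻¹ * ((φ (x, 0) + f x * c) - (φ (y, 0) + f y * c)) := by
    field_simp; ring
  rw [this]
  apply mul_nonneg (by positivity); linarith

theorem exists_prox {f : E → ℝ} (hf : ConvexOn ℝ univ f) (h0 : ∀ x, 0 ≤ f x) (X : E) :
    ∃ m, IsSub f m (X - m) := by
  have hc := ConvexOn.continuous_of_univ hf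
  have hcont : Continuous (fun m => f m + ‖m - X‖ ^ 2 / 2) := by fun_prop
  obtain ⟨m, hm⟩ := hcont.exists_forall_le (by
    apply Filter.tendsto_atTop_mono (f := fun m => ‖m - X‖ ^ 2 / 2)
    · intro m; have := h0 m; linarith
    · have h1 : Filter.Tendsto (fun m : E => ‖m - X‖) (Filter.cocompact E) Filter.atTop := by
        have := tendsto_norm_cocompact_atTop (E := E)
        apply Filter.tendsto_atTop_mono (f := fun m => ‖m‖ - ‖X‖)
        · intro m; exact norm_sub_norm_le m X
        · exact Filter.tendsto_atTop_add_const_right _ _ this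
      have h2 := (Filter.tendsto_pow_atTop (α := ℝ) (n := 2) (by norm_num)).comp h1
      exact h2.atTop_div_const (by norm_num))
  refine ⟨m, fun y => ?_⟩
  have key : ∀ t : ℝ, 0 < t → t ≤ 1 → f m + ⟪X - m, y - m⟫ ≤ f y + t * (‖y - m‖ ^ 2 / 2) := by
    intro t ht ht1
    have h1 := hm (m + t • (y - m))
    have h3 := hf.2 (mem_univ m) (mem_univ y) (sub_nonneg.2 ht1) ht.le (by ring)
    have h5 : (1 - t) • m + t • y = m + t • (y - m) := by
      rw [sub_smul, one_smul, smul_sub]; abel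
    rw [h5] at h3
    simp only [smul_eq_mul] at h3
    have h6 : m + t • (y - m) - X = t • (y - m) - (X - m) := by abel
    have h7 : ‖m + t • (y - m) - X‖ ^ 2 = t ^ 2 * ‖y - m‖ ^ 2 - 2 * t * ⟪X - m, y - m⟫
        + ‖m - X‖ ^ 2 := by
      rw [h6, norm_sub_sq_real, norm_smul, real_inner_smul_left, norm_sub_rev m X,
        real_inner_comm, Real.norm_eq_abs, mul_pow, sq_abs]
      ring
    simp only [h7] at h1
    have : t * (f m + ⟪X - m, y - m⟫) ≤ t * (f y + t * (‖y - m‖ ^ 2 / 2)) := by nlinarith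
    exact le_of_mul_le_mul_left this ht
  by_contra hcon
  push Not at hcon
  set d := f m + ⟪X - m, y - m⟫ - f y
  have hd : 0 < d := by simp only [d]; linarith
  have hN : 0 ≤ ‖y - m‖ ^ 2 := by positivity
  have hk := key (min 1 (d / (‖y - m‖ ^ 2 + 1))) (by positivity) (min_le_left _ _)
  have h2 : min 1 (d / (‖y - m‖ ^ 2 + 1)) * (‖y - m‖ ^ 2 / 2) ≤ d / 2 := by
    calc _ ≤ (d / (‖y - m‖ ^ 2 + 1)) * ((‖y - m‖ ^ 2 + 1) / 2) := by
          gcongr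
          · exact min_le_right _ _
          · linarith
      _ = d / 2 := by field_simp
  simp only [d] at h2 hd
  linarith

end ConvexBasics

/-- A Lipschitz function which is complex differentiable almost everywhere on an open set is
holomorphic there. -/
theorem LipschitzWith.differentiableOn_complex_of_ae {g : ℂ → ℂ} {K : NNReal}
    (hL : LipschitzWith K g) {V : Set ℂ} (hV : IsOpen V)
    (h : ∀ᵐ X : ℂ, X ∈ V → DifferentiableAt ℂ g X) : DifferentiableOn ℂ g V := by
  intro X0 hX0
  obtain ⟨r, hr, hball⟩ := Metric.isOpen_iff.1 hV X0 hX0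
  have hr2 : 0 < r / 2 := by positivity
  let ε : ℕ → ℝ := fun n => (r / 2) / (n + 1)
  have hε : ∀ n, 0 < ε n := fun n => by positivity
  have hεr : ∀ n, ε n ≤ r / 2 := fun n => by
    apply div_le_self hr2.le; norm_cast; omega
  let μ : ℕ → Measure ℂ := fun n => ProbabilityTheory.cond volume (ball (0 : ℂ) (ε n))
  have hvol : ∀ n, (volume : Measure ℂ) (ball (0 : ℂ) (ε n)) ≠ 0 := fun n =>
    (measure_ball_pos volume _ (hε n)).ne'
  have hprob : ∀ n, IsProbabilityMeasure (μ n) := fun n =>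
    ProbabilityTheory.cond_isProbabilityMeasure_of_finite (hvol n) measure_ball_lt_top.ne
  have hac : ∀ n, μ n ≪ volume := fun n => ProbabilityTheory.cond_absolutelyContinuous
  have hmem : ∀ n, ∀ᵐ w ∂(μ n), w ∈ ball (0 : ℂ) (ε n) := fun n =>
    ProbabilityTheory.ae_cond_mem measurableSet_ball
  have hshift : ∀ (n : ℕ) (X : ℂ), Integrable (fun w => g (X + w)) (μ n) := by
    intro n X
    refine Integrable.mono' (g := fun _ => ‖g X‖ + K * ε n) (integrable_const _) ?_ ?_
    · exact (hL.continuous.comp (by fun_prop : Continuous fun w : ℂ => X + w)).aestronglyMeasurable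
    · filter_upwards [hmem n] with w hw
      have h1 := hL.dist_le_mul (X + w) X
      rw [dist_eq_norm, dist_eq_norm, add_sub_cancel_left] at h1
      have h2 : ‖w‖ ≤ ε n := (mem_ball_zero_iff.1 hw).le
      have h3 : ‖g (X + w)‖ ≤ ‖g X‖ + ‖g (X + w) - g X‖ := by
        have := norm_add_le (g X) (g (X + w) - g X)
        simpa using this
      have h4 : (K : ℝ) * ‖w‖ ≤ K * ε n := by gcongr
      linarith
  let G : ℕ → ℂ → ℂ := fun n X => ∫ w, g (X + w) ∂(μ n)
  have hGdiff : ∀ n, DifferentiableOn ℂ (G n) (ball X0 (r / 2)) := by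
    intro n X hX
    have hpt : ∀ᵐ w ∂(μ n), HasFDerivAt (fun Y => g (Y + w)) (fderiv ℂ g (X + w)) X := by
      have h1 : ∀ᵐ w : ℂ, (X + w) ∈ V → DifferentiableAt ℂ g (X + w) :=
        (measurePreserving_add_left volume X).quasiMeasurePreserving.ae h
      filter_upwards [hmem n, (hac n).ae_le h1] with w hw hw'
      have hV' : X + w ∈ V := by
        apply hball
        rw [mem_ball, dist_eq_norm] at hX ⊢
        have h2 : ‖w‖ < ε n := by simpa using hw
        calc ‖X + w - X0‖ = ‖(X - X0) + w‖ := by congr 1; ring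
          _ ≤ ‖X - X0‖ + ‖w‖ := norm_add_le _ _
          _ < r := by have := hεr n; linarith
      exact (hasFDerivAt_comp_add_right w).2 (hw' hV').hasFDerivAt
    have := hasFDerivAt_integral_of_dominated_loc_of_lip (𝕜 := ℂ) (μ := μ n)
      (F := fun X w => g (X + w)) (x₀ := X) (bound := fun _ => (K : ℝ)) (s := univ)
      (F' := fun w => fderiv ℂ g (X + w)) Filter.univ_mem
      (Filter.Eventually.of_forall fun Y => (hshift n Y).aestronglyMeasurable) (hshift n X)
      (((measurable_fderiv ℂ g).comp (measurable_const_add X)).aestronglyMeasurable)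
      (Filter.Eventually.of_forall fun w => by
        refine LipschitzWith.lipschitzOnWith ?_
        intro a b
        have := hL (a + w) (b + w)
        simpa using this)
      (integrable_const _) hpt
    exact this.2.differentiableAt.differentiableWithinAt
  have hconv : TendstoUniformlyOn G g Filter.atTop (ball X0 (r / 2)) := by
    rw [Metric.tendstoUniformlyOn_iff]
    intro η hη
    have hlim : Filter.Tendsto (fun n => (K : ℝ) * ε n) Filter.atTop (nhds 0) := by
      have : Filter.Tendsto ε Filter.atTop (nhds 0) := by
        have := (tendsto_one_div_add_atTop_nhds_zero_nat (𝕜 := ℝ)).const_mul (r / 2)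
        simpa [ε, div_eq_mul_inv] using this
      simpa using this.const_mul (K : ℝ)
    filter_upwards [hlim.eventually (gt_mem_nhds hη)] with n hn X _
    refine lt_of_le_of_lt ?_ hn
    have h1 : g X = ∫ _w, g X ∂(μ n) := by simp
    rw [dist_comm, dist_eq_norm]
    have h2 : G n X - g X = ∫ w, (g (X + w) - g X) ∂(μ n) := by
      rw [integral_sub (hshift n X) (integrable_const _), ← h1]
    rw [h2]
    have h3 := norm_integral_le_of_norm_le_const (μ := μ n) (f := fun w => g (X + w) - g X)
      (C := K * ε n) (by
        filter_upwards [hmem n] with w hw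
        have h1 := hL.dist_le_mul (X + w) X
        rw [dist_eq_norm, dist_eq_norm, add_sub_cancel_left] at h1
        have h2 : ‖w‖ ≤ ε n := (mem_ball_zero_iff.1 hw).le
        have h4 : (K : ℝ) * ‖w‖ ≤ K * ε n := by gcongr
        linarith)
    simpa using h3
  have := hconv.tendstoLocallyUniformlyOn.differentiableOn
    (Filter.Eventually.of_forall hGdiff) isOpen_ball
  exact ((this X0 (mem_ball_self hr2)).differentiableAt
    (isOpen_ball.mem_nhds (mem_ball_self hr2))).differentiableWithinAt

/-- `w` solves `det D² w = χ_Ω` in the sense of Alexandrov. -/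
def Alex {E : Type*} [NormedAddCommGroup E] [InnerProductSpace ℝ E] [MeasureSpace E]
    (w : E → ℝ) (Ω : Set E) : Prop :=
  ∀ S : Set E, MeasurableSet S → volume (⋃ x ∈ S, {p : E | IsSub w x p}) = volume (S ∩ Ω)

theorem cinner (w z : ℂ) : ⟪w, z⟫ = w.re * z.re + w.im * z.im := by
  rw [Complex.inner]; simp; ring

/-- `x` is the proximal map of `U`, the resolvent of the subdifferential. -/
def IsProx (U : ℂ → ℝ) (x : ℂ → ℂ) : Prop := ∀ X, IsSub U (x X) (X - x X)

theorem exists_isProx {U : ℂ → ℝ} (hU : ConvexOn ℝ univ U) (h0 : ∀ x, 0 ≤ U x) :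
    ∃ x, IsProx U x := by
  choose x hx using fun X => exists_prox hU h0 X
  exact ⟨x, hx⟩

theorem Complex.det_real_clm (T : ℂ →L[ℝ] ℂ) :
    T.det = (T 1).re * (T Complex.I).im - (T Complex.I).re * (T 1).im := by
  rw [ContinuousLinearMap.det, ← LinearMap.det_toMatrix Complex.basisOneI, Matrix.det_fin_two]
  simp [LinearMap.toMatrix_apply]

theorem Complex.clm_apply (T : ℂ →L[ℝ] ℂ) (v : ℂ) : T v = v.re • T 1 + v.im • T Complex.I := by
  rw [← map_smul, ← map_smul, ← map_add]
  congr 1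
  apply Complex.ext <;> simp

theorem Complex.clm_apply_eq_zero_imp {T : ℂ →L[ℝ] ℂ} (hT : T.det ≠ 0) {v : ℂ} (h : T v = 0) :
    v = 0 := by
  rw [Complex.det_real_clm] at hT
  rw [Complex.clm_apply] at h
  have h1 := congrArg Complex.re h
  have h2 := congrArg Complex.im h
  simp only [Complex.add_re, Complex.add_im, Complex.smul_re, Complex.smul_im, smul_eq_mul,
    Complex.zero_re, Complex.zero_im] at h1 h2
  apply Complex.ext
  · have : v.re * ((T 1).re * (T Complex.I).im - (T Complex.I).re * (T 1).im) = 0 := by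
      linear_combination (T Complex.I).im * h1 - (T Complex.I).re * h2
    simpa [hT] using this
  · have : v.im * ((T 1).re * (T Complex.I).im - (T Complex.I).re * (T 1).im) = 0 := by
      linear_combination -(T 1).im * h1 + (T 1).re * h2
    simpa [hT] using this

/-- If a function is affine along the segment from `X` to `X'` then its derivative at `X` is
the slope. -/
theorem HasFDerivAt.apply_sub_of_affine {g : ℂ → ℂ} {T : ℂ →L[ℝ] ℂ} {X X' d : ℂ}
    (hg : HasFDerivAt g T X)
    (h : ∀ t : ℝ, 0 ≤ t → t ≤ 1 → g (X + t • (X' - X)) = g X + t • d) : T (X' - X) = d := by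
  have h1 : HasDerivAt (fun t : ℝ => X + t • (X' - X)) (X' - X) 0 := by
    simpa using ((hasDerivAt_id (0 : ℝ)).smul_const (X' - X)).const_add X
  have h2 : HasDerivAt (fun t : ℝ => g (X + t • (X' - X))) (T (X' - X)) 0 := by
    have hg' : HasFDerivAt g T (X + (0 : ℝ) • (X' - X)) := by simpa using hg
    exact hg'.comp_hasDerivAt (0 : ℝ) h1
  have h3 : HasDerivAt (fun t : ℝ => g X + t • d) d 0 := by
    simpa using ((hasDerivAt_id (0 : ℝ)).smul_const d).const_add (g X)
  have h4 := h2.hasDerivWithinAt (s := Icc 0 1)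
  have h5 : HasDerivWithinAt (fun t : ℝ => g (X + t • (X' - X))) d (Icc 0 1) 0 :=
    h3.hasDerivWithinAt.congr (fun t ht => h t ht.1 ht.2) (h 0 le_rfl zero_le_one)
  have hu : UniqueDiffWithinAt ℝ (Icc (0 : ℝ) 1) 0 :=
    uniqueDiffOn_Icc zero_lt_one 0 (by simp)
  exact hu.eq_deriv _ h4 h5

namespace IsProx

variable {U : ℂ → ℝ} {x : ℂ → ℂ}

theorem eq_of_isSub (hx : IsProx U x) {a p : ℂ} (h : IsSub U a p) : x (a + p) = a :=
  isSub_prox_unique (hx (a + p)) (by simpa using h)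

theorem mono (hx : IsProx U x) (X X' : ℂ) :
    0 ≤ (x X' - x X).re * ((X' - X).re - (x X' - x X).re) +
      (x X' - x X).im * ((X' - X).im - (x X' - x X).im) := by
  have := (hx X).monotone (hx X')
  rw [cinner] at this
  simp only [Complex.sub_re, Complex.sub_im] at this ⊢
  linarith

theorem norm_sub_le_of_mono {a D b : ℂ} (h : 0 ≤ a.re * (D.re - a.re) + a.im * (D.im - a.im))
    (hb : b.re ^ 2 + b.im ^ 2 ≤ D.re ^ 2 + D.im ^ 2 - 2 *
      (a.re * (D.re - a.re) + a.im * (D.im - a.im))) : ‖b‖ ≤ ‖D‖ := by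
  apply le_of_sq_le_sq _ (norm_nonneg _)
  rw [Complex.sq_norm, Complex.sq_norm, Complex.normSq_apply, Complex.normSq_apply]
  nlinarith

theorem lipschitz (hx : IsProx U x) : LipschitzWith 1 x := by
  refine LipschitzWith.of_dist_le_mul fun X' X => ?_
  rw [dist_eq_norm, dist_eq_norm, NNReal.coe_one, one_mul]
  exact norm_sub_le_of_mono (hx.mono X X') (by
    nlinarith [sq_nonneg ((X' - X).re - (x X' - x X).re), sq_nonneg ((X' - X).im - (x X' - x X).im)])

theorem lipschitz_conj (hx : IsProx U x) :
    LipschitzWith 1 (fun X => (starRingEnd ℂ) (2 * x X - X)) := by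
  refine LipschitzWith.of_dist_le_mul fun X' X => ?_
  rw [dist_eq_norm, dist_eq_norm, NNReal.coe_one, one_mul]
  refine norm_sub_le_of_mono (hx.mono X X') ?_
  have := hx.mono X X'
  simp only [Complex.sub_re, Complex.sub_im, Complex.conj_re, Complex.conj_im, Complex.mul_re,
    Complex.mul_im, Complex.re_ofNat, Complex.im_ofNat] at this ⊢
  nlinarith

theorem affine (hU : ConvexOn ℝ univ U) (hx : IsProx U x) {X X' : ℂ}
    (h : (x X' - x X).re * ((X' - X).re - (x X' - x X).re) +
      (x X' - x X).im * ((X' - X).im - (x X' - x X).im) = 0) {t : ℝ} (ht0 : 0 ≤ t) (ht1 : t ≤ 1) :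
    x (X + t • (X' - X)) = x X + t • (x X' - x X) := by
  have h1 := (hx X).segment hU (hx X') (by
    rw [cinner]
    simp only [Complex.sub_re, Complex.sub_im] at h ⊢
    linarith) ht0 ht1
  rw [← hx.eq_of_isSub h1]
  congr 1
  simp only [smul_sub]
  ring

/-- Where the derivative of the proximal map is injective, the proximal map takes its value only
once. -/
theorem eq_of_det_ne (hU : ConvexOn ℝ univ U) (hx : IsProx U x) {X X' : ℂ} {T : ℂ →L[ℝ] ℂ}
    (hT : HasFDerivAt x T X) (hdet : T.det ≠ 0) (h : x X' = x X) : X' = X := by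
  have h1 := hT.apply_sub_of_affine (X' := X') (d := 0) (fun t h0 h1 => by
    rw [hx.affine hU (by rw [h]; simp) h0 h1, h]; simp)
  exact sub_eq_zero.1 (Complex.clm_apply_eq_zero_imp hdet h1)

theorem eq_of_det_ne' (hU : ConvexOn ℝ univ U) (hx : IsProx U x) {X X' : ℂ} {T : ℂ →L[ℝ] ℂ}
    (hT : HasFDerivAt (fun X => X - x X) T X) (hdet : T.det ≠ 0) (h : X' - x X' = X - x X) :
    X' = X := by
  have h2 : x X' - x X = X' - X := by linear_combination -h
  have h1 := hT.apply_sub_of_affine (X' := X') (d := 0) (fun t h0 h1 => by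
    rw [hx.affine hU (by rw [h2]; simp) h0 h1, h2]; simp)
  exact sub_eq_zero.1 (Complex.clm_apply_eq_zero_imp hdet h1)

theorem hasFDerivAt_envelope (hx : IsProx U x) (X : ℂ) :
    HasFDerivAt (fun X => U (x X) + ‖X - x X‖ ^ 2 / 2) (innerSL ℝ (X - x X)) X := by
  have hup : ∀ X X' : ℂ, U (x X') + ‖X' - x X'‖ ^ 2 / 2 ≤
      U (x X) + ‖X - x X‖ ^ 2 / 2 + ⟪X - x X, X' - X⟫ + ‖X' - X‖ ^ 2 / 2 := by
    intro X X'
    have h := hx X' (x X)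
    rw [cinner] at h ⊢
    simp only [Complex.sq_norm, Complex.normSq_apply, Complex.sub_re, Complex.sub_im] at h ⊢
    nlinarith [sq_nonneg ((x X).re - (x X').re), sq_nonneg ((x X).im - (x X').im)]
  rw [hasFDerivAt_iff_isLittleO]
  refine Asymptotics.IsBigO.trans_isLittleO
    (g := fun X' => ‖X' - X‖ ^ 2) ?_ ?_
  · refine Asymptotics.IsBigO.of_bound 1 (Filter.Eventually.of_forall fun X' => ?_)
    rw [Real.norm_eq_abs, one_mul, norm_pow, norm_norm, abs_le, innerSL_apply_apply]
    have h1 := hup X X'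
    have h2 := hup X' X
    have h3 := hx.mono X X'
    have h4 : 0 ≤ ‖X' - X‖ ^ 2 := by positivity
    have h5 : ⟪X - x X, X' - X⟫ + ⟪X' - x X', X - X'⟫ ≤ 0 := by
      rw [cinner, cinner]
      simp only [Complex.sub_re, Complex.sub_im] at h3 ⊢
      nlinarith [sq_nonneg (X'.re - X.re - ((x X').re - (x X).re)),
        sq_nonneg (X'.im - X.im - ((x X').im - (x X).im))]
    rw [norm_sub_rev X X'] at h2
    constructor <;> linarith
  · exact Asymptotics.isLittleO_pow_sub_sub X (m := 2) (by norm_num)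

theorem fderiv_symm (hx : IsProx U x) {X : ℂ} {T : ℂ →L[ℝ] ℂ}
    (hT : HasFDerivAt (fun X => X - x X) T X) (v w : ℂ) : ⟪T v, w⟫ = ⟪T w, v⟫ := by
  have h1 : HasFDerivAt (fun X => innerSL ℝ (X - x X)) ((innerSL ℝ).comp T) X :=
    (innerSL ℝ).hasFDerivAt.comp X hT
  have := second_derivative_symmetric_of_eventually_of_real
    (Filter.Eventually.of_forall hx.hasFDerivAt_envelope) h1 v w
  simpa using this

theorem fderiv_mono (hx : IsProx U x) {X : ℂ} {T : ℂ →L[ℝ] ℂ}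
    (hT : HasFDerivAt (fun X => X - x X) T X) (v : ℂ) : ‖T v‖ ^ 2 ≤ ⟪T v, v⟫ := by
  have h1 : HasDerivAt (fun t : ℝ => X + t • v) v 0 := by
    simpa using ((hasDerivAt_id (0 : ℝ)).smul_const v).const_add X
  have h2 : HasDerivAt (fun t : ℝ => (X + t • v) - x (X + t • v)) (T v) 0 := by
    have hg' : HasFDerivAt (fun X => X - x X) T (X + (0 : ℝ) • v) := by simpa using hT
    exact hg'.comp_hasDerivAt (0 : ℝ) h1
  have h3 := h2.tendsto_slope
  have h4 : Filter.Tendsto (fun t => ⟪slope (fun t : ℝ => (X + t • v) - x (X + t • v)) 0 t, v⟫ -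
      ‖slope (fun t : ℝ => (X + t • v) - x (X + t • v)) 0 t‖ ^ 2) (nhdsWithin 0 {0}ᶜ)
      (nhds (⟪T v, v⟫ - ‖T v‖ ^ 2)) :=
    (h3.inner tendsto_const_nhds).sub (h3.norm.pow 2)
  have h5 := ge_of_tendsto h4 (b := 0) (by
    filter_upwards [self_mem_nhdsWithin] with t ht
    have ht : t ≠ 0 := ht
    rw [slope_def_module]
    have hm := hx.mono X (X + t • v)
    simp only [sub_zero, zero_smul, add_zero]
    set d := X + t • v - x (X + t • v) - (X - x X) with hd
    have hd' : x (X + t • v) - x X = t • v - d := by rw [hd]; ring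
    rw [hd', add_sub_cancel_left] at hm
    rw [real_inner_smul_left, norm_smul, mul_pow, Real.norm_eq_abs, sq_abs, cinner, Complex.sq_norm,
      Complex.normSq_apply]
    have : t⁻¹ * (d.re * v.re + d.im * v.im) - t⁻¹ ^ 2 * (d.re * d.re + d.im * d.im) =
      t⁻¹ ^ 2 * (d.re * (t * v.re - d.re) + d.im * (t * v.im - d.im)) := by field_simp; ring
    rw [this]
    apply mul_nonneg (by positivity)
    simp only [Complex.sub_re, Complex.sub_im, Complex.smul_re, Complex.smul_im,
      smul_eq_mul] at hm
    linarith)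
  linarith

end IsProx

namespace IsProx

variable {U : ℂ → ℝ} {x : ℂ → ℂ} {A : Set ℂ}

theorem iUnion_isSub_eq (hx : IsProx U x) {s : Set ℂ} (hs : ∀ X ∈ s, ∀ X', x X' = x X → X' = X) :
    (⋃ a ∈ x '' s, {p | IsSub U a p}) = (fun X => X - x X) '' s := by
  ext p
  simp only [mem_iUnion, mem_ofPred_eq, mem_image, exists_prop]
  constructor
  · rintro ⟨a, ⟨X, hX, rfl⟩, hp⟩
    have h1 := hx.eq_of_isSub hp
    have h2 := hs X hX _ h1
    exact ⟨X, hX, by rw [← h2, h1]; ring⟩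
  · rintro ⟨X, hX, rfl⟩
    exact ⟨x X, ⟨X, hX, rfl⟩, hx X⟩

theorem setLIntegral_det_sub (hU : ConvexOn ℝ univ U) (hx : IsProx U x) {s : Set ℂ}
    (hs : MeasurableSet s) (hd : ∀ X ∈ s, DifferentiableAt ℝ (fun X => X - x X) X) :
    ∫⁻ X in s, ENNReal.ofReal |(fderiv ℝ (fun X => X - x X) X).det| =
      volume ((fun X => X - x X) '' s) := by
  set y : ℂ → ℂ := fun X => X - x X with hy
  have hmd : Measurable fun X => (fderiv ℝ y X).det :=
    ContinuousLinearMap.continuous_det.measurable.comp (measurable_fderiv ℝ y)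
  set Q : Set ℂ := {X | (fderiv ℝ y X).det ≠ 0}
  have hQ : MeasurableSet Q := hmd (measurableSet_singleton 0).compl
  have h1 : ∫⁻ X in s ∩ Q, ENNReal.ofReal |(fderiv ℝ y X).det| = volume (y '' (s ∩ Q)) := by
    apply lintegral_abs_det_fderiv_eq_addHaar_image volume (hs.inter hQ)
    · intro X hX
      exact (hd X hX.1).hasFDerivAt.hasFDerivWithinAt
    · intro X hX X' _ h
      exact (hx.eq_of_det_ne' hU (hd X hX.1).hasFDerivAt hX.2 h.symm).symm
  have h2 : volume (y '' (s \ Q)) = 0 := by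
    apply addHaar_image_eq_zero_of_det_fderivWithin_eq_zero volume (f' := fderiv ℝ y)
    · intro X hX
      exact (hd X hX.1).hasFDerivAt.hasFDerivWithinAt
    · intro X hX
      simpa [Q] using hX.2
  have h3 : ∫⁻ X in s \ Q, ENNReal.ofReal |(fderiv ℝ y X).det| = 0 := by
    rw [setLIntegral_congr_fun (g := fun _ => 0) (hs.diff hQ)]
    · simp
    · intro X hX
      have : (fderiv ℝ y X).det = 0 := by simpa [Q] using hX.2
      simp [this]
  rw [← lintegral_inter_add_sdiff _ s hQ, h1, h3, add_zero]
  apply le_antisymm (measure_mono (image_mono inter_subset_left))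
  conv_lhs => rw [← inter_union_sdiff s Q, image_union]
  exact (measure_union_le _ _).trans (by rw [h2, add_zero])

theorem ae_abs_det_eq (hU : ConvexOn ℝ univ U) (hx : IsProx U x) (hA : IsOpen A) (hAl : Alex U A) :
    ∀ᵐ X : ℂ, x X ∈ A → |(fderiv ℝ x X).det| = |(fderiv ℝ (fun X => X - x X) X).det| := by
  set y : ℂ → ℂ := fun X => X - x X with hy
  have hmdx : Measurable fun X => (fderiv ℝ x X).det :=
    ContinuousLinearMap.continuous_det.measurable.comp (measurable_fderiv ℝ x)
  have hmdy : Measurable fun X => (fderiv ℝ y X).det :=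
    ContinuousLinearMap.continuous_det.measurable.comp (measurable_fderiv ℝ y)
  set V : Set ℂ := x ⁻¹' A
  have hV : MeasurableSet V := (hA.preimage hx.lipschitz.continuous).measurableSet
  set D : Set ℂ := {X | DifferentiableAt ℝ x X}
  have hD : MeasurableSet D := measurableSet_of_differentiableAt ℝ x
  have hDae : ∀ᵐ X : ℂ, X ∈ D := hx.lipschitz.ae_differentiableAt
  have hDy : ∀ X ∈ D, DifferentiableAt ℝ y X := fun X hX => differentiableAt_id.sub hX
  set P : Set ℂ := {X | (fderiv ℝ x X).det ≠ 0}
  have hP : MeasurableSet P := hmdx (measurableSet_singleton 0).compl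
  set Q : Set ℂ := {X | (fderiv ℝ y X).det ≠ 0}
  have hQ : MeasurableSet Q := hmdy (measurableSet_singleton 0).compl
  have hinj : ∀ s ⊆ D ∩ P, ∀ X ∈ s, ∀ X', x X' = x X → X' = X := fun s hs X hX X' h =>
    hx.eq_of_det_ne hU (hs hX).1.hasFDerivAt (hs hX).2 h
  have key1 : ∀ s, MeasurableSet s → s ⊆ V ∩ (D ∩ P) →
      ∫⁻ X in s, ENNReal.ofReal |(fderiv ℝ x X).det| =
        ∫⁻ X in s, ENNReal.ofReal |(fderiv ℝ y X).det| := by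
    intro s hs hsub
    have hsub' : s ⊆ D ∩ P := fun X hX => (hsub hX).2
    have hder : ∀ X ∈ s, HasFDerivWithinAt x (fderiv ℝ x X) s X := fun X hX =>
      (hsub' hX).1.hasFDerivAt.hasFDerivWithinAt
    have hinjs : InjOn x s := fun X hX X' hX' h => (hinj s hsub' X hX X' h.symm).symm
    rw [lintegral_abs_det_fderiv_eq_addHaar_image volume hs hder hinjs,
      hx.setLIntegral_det_sub hU hs (fun X hX => hDy X (hsub' hX).1),
      ← hx.iUnion_isSub_eq (hinj s hsub'),
      hAl _ (measurable_image_of_fderivWithin hs hder hinjs)]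
    congr 1
    symm
    apply inter_eq_left.2
    rintro _ ⟨X, hX, rfl⟩
    exact (hsub hX).1
  have key2 : volume ((V ∩ D ∩ Q) \ P) = 0 := by
    set s := (V ∩ D ∩ Q) \ P with hsdef
    have hs : MeasurableSet s := ((hV.inter hD).inter hQ).diff hP
    have h1 : volume (x '' s) = 0 := by
      apply addHaar_image_eq_zero_of_det_fderivWithin_eq_zero volume (f' := fderiv ℝ x)
      · intro X hX
        exact (show DifferentiableAt ℝ x X from hX.1.1.2).hasFDerivAt.hasFDerivWithinAt
      · intro X hX
        simpa [P] using hX.2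
    have h2 : volume (y '' s) = 0 := by
      have h3 := hAl (toMeasurable volume (x '' s)) (measurableSet_toMeasurable _ _)
      have h4 : volume (toMeasurable volume (x '' s) ∩ A) = 0 :=
        measure_mono_null inter_subset_left (by rw [measure_toMeasurable, h1])
      rw [h4] at h3
      refine measure_mono_null ?_ h3
      rintro _ ⟨X, hX, rfl⟩
      simp only [mem_iUnion]
      exact ⟨x X, subset_toMeasurable _ _ ⟨X, hX, rfl⟩, hx X⟩
    rw [← hx.setLIntegral_det_sub hU hs (fun X hX => hDy X hX.1.1.2),
      lintegral_eq_zero_iff (by fun_prop)] at h2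
    have h3 : ∀ᵐ X ∂(volume.restrict s), False := by
      filter_upwards [h2, ae_restrict_mem hs] with X h4 h5
      have h6 : (fderiv ℝ y X).det = 0 := by simpa using h4
      exact h5.1.2 h6
    have h4 : volume.restrict s = 0 := by
      simpa using h3
    simpa using h4
  have hW : MeasurableSet (V ∩ (D ∩ P)) := hV.inter (hD.inter hP)
  have key3 : ∀ᵐ X ∂(volume.restrict (V ∩ (D ∩ P))),
      ENNReal.ofReal |(fderiv ℝ x X).det| = ENNReal.ofReal |(fderiv ℝ y X).det| := by
    apply ae_eq_of_forall_setLIntegral_eq_of_sigmaFinite (by fun_prop) (by fun_prop)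
    intro s hs _
    rw [Measure.restrict_restrict hs]
    exact key1 _ (hs.inter hW) inter_subset_right
  rw [ae_restrict_iff' hW] at key3
  have key4 : ∀ᵐ X : ℂ, X ∉ (V ∩ D ∩ Q) \ P := measure_eq_zero_iff_ae_notMem.1 key2
  filter_upwards [hDae, key3, key4] with X h1 h2 h3 hXA
  by_cases hXP : X ∈ P
  · exact (ENNReal.ofReal_eq_ofReal_iff (abs_nonneg _) (abs_nonneg _)).1 (h2 ⟨hXA, h1, hXP⟩)
  · have h4 : (fderiv ℝ x X).det = 0 := by simpa [P] using hXP
    have h5 : (fderiv ℝ y X).det = 0 := by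
      by_contra h5
      exact h3 ⟨⟨⟨hXA, h1⟩, h5⟩, hXP⟩
    rw [h4, h5]

theorem differentiableOn_conj (hU : ConvexOn ℝ univ U) (hx : IsProx U x) (hA : IsOpen A)
    (hAl : Alex U A) :
    DifferentiableOn ℂ (fun X => (starRingEnd ℂ) (2 * x X - X)) (x ⁻¹' A) := by
  apply hx.lipschitz_conj.differentiableOn_complex_of_ae (hA.preimage hx.lipschitz.continuous)
  filter_upwards [hx.ae_abs_det_eq hU hA hAl, hx.lipschitz.ae_differentiableAt] with X h1 h2 hX
  have hdet := h1 hX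
  set T := fderiv ℝ x X
  have hT : HasFDerivAt x T X := h2.hasFDerivAt
  have hS : HasFDerivAt (fun X => X - x X) (ContinuousLinearMap.id ℝ ℂ - T) X :=
    (hasFDerivAt_id X).sub hT
  rw [hS.fderiv] at hdet
  set S := ContinuousLinearMap.id ℝ ℂ - T with hSdef
  have hsym := hx.fderiv_symm hS 1 Complex.I
  have hm1 := hx.fderiv_mono hS
  have hS1 : S 1 = 1 - T 1 := by simp [hSdef]
  have hSI : S Complex.I = Complex.I - T Complex.I := by simp [hSdef]
  have hsym' : (S 1).im = (S Complex.I).re := by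
    rw [cinner, cinner] at hsym; simpa using hsym
  obtain ⟨a, ha⟩ : ∃ a, (S 1).re = a := ⟨_, rfl⟩
  obtain ⟨b, hb⟩ : ∃ b, (S 1).im = b := ⟨_, rfl⟩
  obtain ⟨d, hd⟩ : ∃ d, (S Complex.I).im = d := ⟨_, rfl⟩
  have hb' : (S Complex.I).re = b := by rw [← hsym', hb]
  have e1 : T 1 = ⟨1 - a, -b⟩ := by
    have : T 1 = 1 - S 1 := by rw [hS1]; ring
    rw [this]; apply Complex.ext <;> simp [ha, hb]
  have e2 : T Complex.I = ⟨-b, 1 - d⟩ := by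
    have : T Complex.I = Complex.I - S Complex.I := by rw [hSI]; ring
    rw [this]; apply Complex.ext <;> simp [hb', hd]
  have hq : ∀ r t : ℝ, (r * a + t * b) ^ 2 + (r * b + t * d) ^ 2 ≤
      (r * a + t * b) * r + (r * b + t * d) * t := by
    intro r t
    have := hm1 ⟨r, t⟩
    rw [Complex.clm_apply, cinner, Complex.sq_norm, Complex.normSq_apply] at this
    simp only [Complex.add_re, Complex.add_im, Complex.smul_re, Complex.smul_im, smul_eq_mul,
      ha, hb, hb', hd] at this
    nlinarith
  have hdetS : S.det = a * d - b ^ 2 := by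
    rw [Complex.det_real_clm, ha, hb, hb', hd]; ring
  have hdetT : T.det = (1 - a) * (1 - d) - b ^ 2 := by
    rw [Complex.det_real_clm, e1, e2]; ring
  have hq10 := hq 1 0
  have hq01 := hq 0 1
  have ha0 : 0 ≤ a := by nlinarith [sq_nonneg a, sq_nonneg b]
  have hd0 : 0 ≤ d := by nlinarith [sq_nonneg d, sq_nonneg b]
  have ha1 : a ≤ 1 := by nlinarith [sq_nonneg a, sq_nonneg b]
  have hd1 : d ≤ 1 := by nlinarith [sq_nonneg d, sq_nonneg b]
  have hSnn : 0 ≤ a * d - b ^ 2 := by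
    rcases eq_or_lt_of_le ha0 with h | h
    · have : b = 0 := by subst h; nlinarith [sq_nonneg b]
      rw [← h, this]; simp
    · have h3 := hq b (-a)
      have h4 : 0 ≤ a * (a * d - b ^ 2) := by nlinarith [sq_nonneg (b * a + -a * b), sq_nonneg (b * b + -a * d)]
      exact nonneg_of_mul_nonneg_right h4 h
  have hTnn : 0 ≤ (1 - a) * (1 - d) - b ^ 2 := by
    rcases eq_or_lt_of_le (sub_nonneg.2 ha1) with h | h
    · have h1 : a = 1 := by linarith
      have : b = 0 := by subst h1; nlinarith [sq_nonneg b]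
      rw [← h, this]; simp
    · have h4 : 0 ≤ (1 - a) * ((1 - a) * (1 - d) - b ^ 2) := by
        nlinarith [hq b (1 - a), sq_nonneg (b * a + (1 - a) * b - b), sq_nonneg (b * b + (1 - a) * d - (1 - a))]
      exact nonneg_of_mul_nonneg_right h4 h
  rw [hdetS, hdetT, abs_of_nonneg hSnn, abs_of_nonneg hTnn] at hdet
  rw [differentiableAt_complex_iff_differentiableAt_real]
  have hψ : HasFDerivAt (fun X => (starRingEnd ℂ) (2 * x X - X))
      (Complex.conjCLE.toContinuousLinearMap.comp
        ((2 : ℝ) • T - ContinuousLinearMap.id ℝ ℂ)) X := by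
    have h3 : HasFDerivAt (fun X => 2 * x X - X) ((2 : ℝ) • T - ContinuousLinearMap.id ℝ ℂ) X := by
      refine HasFDerivAt.congr_fderiv (f' := _) ?_ rfl
      have := (hT.const_smul (2 : ℝ)).sub (hasFDerivAt_id X)
      refine this.congr_of_eventuallyEq (Filter.Eventually.of_forall fun Y => ?_)
      simp
    exact Complex.conjCLE.toContinuousLinearMap.hasFDerivAt.comp X h3
  refine ⟨hψ.differentiableAt, ?_⟩
  rw [hψ.fderiv]
  simp only [ContinuousLinearMap.comp_apply, sub_apply,
    smul_apply, ContinuousLinearMap.id_apply, e1, e2]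
  apply Complex.ext
  · simp
  · simp; linarith

theorem differentiableOn_z (hU : ConvexOn ℝ univ U) (hx : IsProx U x) (hA : IsOpen A)
    (hAl : Alex U A) :
    DifferentiableOn ℂ (fun X => (⟨X.re - (x X).re, (x X).im⟩ : ℂ)) (x ⁻¹' A) := by
  have h := ((differentiableOn_id (𝕜 := ℂ)).sub (hx.differentiableOn_conj hU hA hAl)).div_const 2
  refine h.congr fun X _ => ?_
  apply Complex.ext
  · simp; ring
  · simp

theorem differentiableOn_F (hU : ConvexOn ℝ univ U) (hx : IsProx U x) (hA : IsOpen A)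
    (hAl : Alex U A) :
    DifferentiableOn ℂ (fun X => (⟨(x X).re, X.im - (x X).im⟩ : ℂ)) (x ⁻¹' A) := by
  have h := ((differentiableOn_id (𝕜 := ℂ)).add (hx.differentiableOn_conj hU hA hAl)).div_const 2
  refine h.congr fun X _ => ?_
  apply Complex.ext
  · simp
  · simp; ring

end IsProx

theorem isSub_comp_isometry {E F : Type*} [NormedAddCommGroup E] [InnerProductSpace ℝ E]
    [NormedAddCommGroup F] [InnerProductSpace ℝ F] (J : E ≃ₗᵢ[ℝ] F) {w : F → ℝ} {x p : E} :
    IsSub (fun a => w (J a)) x p ↔ IsSub w (J x) (J p) := by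
  constructor
  · intro h y
    have := h (J.symm y)
    rw [← J.inner_map_map, map_sub] at this
    simpa using this
  · intro h y
    have := h (J y)
    rwa [← map_sub, J.inner_map_map] at this

theorem Alex.comp_isometry {E F : Type*} [NormedAddCommGroup E] [InnerProductSpace ℝ E]
    [FiniteDimensional ℝ E] [MeasurableSpace E] [BorelSpace E]
    [NormedAddCommGroup F] [InnerProductSpace ℝ F] [FiniteDimensional ℝ F] [MeasurableSpace F]
    [BorelSpace F] (J : E ≃ₗᵢ[ℝ] F) {w : F → ℝ} {Ω : Set F} (h : Alex w Ω) :
    Alex (fun a => w (J a)) (J ⁻¹' Ω) := by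
  intro S hS
  have hJ : ∀ T : Set F, volume (J ⁻¹' T) = volume T := fun T =>
    J.measurePreserving.measure_preimage_emb J.toHomeomorph.measurableEmbedding T
  have h1 := h (J.symm ⁻¹' S) (J.symm.continuous.measurable hS)
  have h2 : J ⁻¹' (⋃ x ∈ J.symm ⁻¹' S, {p | IsSub w x p}) =
      ⋃ x ∈ S, {p | IsSub (fun a => w (J a)) x p} := by
    ext p
    simp only [mem_preimage, mem_iUnion, mem_ofPred_eq, exists_prop]
    constructor
    · rintro ⟨x, hx, hp⟩
      exact ⟨J.symm x, hx, (isSub_comp_isometry J).2 (by simpa using hp)⟩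
    · rintro ⟨x, hx, hp⟩
      exact ⟨J x, by simpa using hx, (isSub_comp_isometry J).1 hp⟩
  have h3 : J ⁻¹' (J.symm ⁻¹' S ∩ Ω) = S ∩ J ⁻¹' Ω := by
    ext p; simp
  rw [← h2, hJ, h1, ← h3, hJ]

theorem ConvexOn.comp_isometry {E F : Type*} [NormedAddCommGroup E] [InnerProductSpace ℝ E]
    [NormedAddCommGroup F] [InnerProductSpace ℝ F] (J : E ≃ₗᵢ[ℝ] F) {w : F → ℝ}
    (h : ConvexOn ℝ univ w) : ConvexOn ℝ univ (fun a => w (J a)) :=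
  h.comp_linearMap J.toLinearEquiv.toLinearMap

theorem Complex.volume_box (s t : Set ℝ) :
    volume {z : ℂ | z.re ∈ s ∧ z.im ∈ t} = volume s * volume t := by
  have h := Complex.volume_preserving_equiv_real_prod.measure_preimage_equiv (s ×ˢ t)
  rw [← Measure.prod_prod, ← Measure.volume_eq_prod, ← h]
  congr 1

namespace IsProx

variable {U : ℂ → ℝ} {x : ℂ → ℂ} {A : Set ℂ}

/-- The first of the two conjugate holomorphic coordinates, `p + i t`. -/
def zc (x : ℂ → ℂ) (X : ℂ) : ℂ := ⟨X.re - (x X).re, (x X).im⟩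

/-- The second of the two conjugate holomorphic coordinates, `s + i q`. -/
def Fc (x : ℂ → ℂ) (X : ℂ) : ℂ := ⟨(x X).re, X.im - (x X).im⟩

theorem lintegral_normSq_le {W : Set ℂ} (hW : MeasurableSet W) {g : ℂ → ℂ} {g' : ℂ → ℂ}
    (hg' : Measurable g')
    (hg : ∀ X ∈ W, HasDerivAt g (g' X) X)
    (hinj : ∀ X ∈ W, ∀ X', g' X ≠ 0 → g X' = g X → X' = X) :
    ∫⁻ X in W, ENNReal.ofReal (‖g' X‖ ^ 2) ≤ volume (g '' W) := by
  set Q : Set ℂ := {X | g' X ≠ 0}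
  have hQ : MeasurableSet Q := hg' (measurableSet_singleton 0).compl
  have h3 : ∫⁻ X in W \ Q, ENNReal.ofReal (‖g' X‖ ^ 2) = 0 := by
    rw [setLIntegral_congr_fun (g := fun _ => 0) (hW.diff hQ)]
    · simp
    · intro X hX
      have : g' X = 0 := by simpa [Q] using hX.2
      simp [this]
  rw [← lintegral_inter_add_sdiff _ W hQ, h3, add_zero]
  have h1 := lintegral_abs_det_fderiv_eq_addHaar_image volume (hW.inter hQ) (f := g)
    (f' := fun X => (ContinuousLinearMap.toSpanSingleton ℂ (g' X)).restrictScalars ℝ)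
    (fun X hX => ((hg X hX.1).hasFDerivAt.restrictScalars ℝ).hasFDerivWithinAt)
    (fun X hX X' _ h => (hinj X hX.1 X' hX.2 h.symm).symm)
  have h2 : ∀ X, |((ContinuousLinearMap.toSpanSingleton ℂ (g' X)).restrictScalars ℝ).det| =
      ‖g' X‖ ^ 2 := by
    intro X
    rw [Complex.det_real_clm, Complex.sq_norm, Complex.normSq_apply]
    simp only [ContinuousLinearMap.coe_restrictScalars',
      ContinuousLinearMap.toSpanSingleton_apply, smul_eq_mul, one_mul, Complex.mul_re,
      Complex.mul_im, Complex.I_re, Complex.I_im]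
    rw [abs_of_nonneg] <;> nlinarith [sq_nonneg (g' X).re, sq_nonneg (g' X).im]
  simp only [h2] at h1
  rw [h1]
  exact measure_mono (image_mono inter_subset_left)

theorem zc_inj (hU : ConvexOn ℝ univ U) (hx : IsProx U x) {X X' d : ℂ}
    (hd : HasDerivAt (zc x) d X) (hd0 : d ≠ 0) (h : zc x X' = zc x X) : X' = X := by
  have h1 : X'.re - (x X').re = X.re - (x X).re := congrArg Complex.re h
  have h2 : (x X').im = (x X).im := by simpa [zc] using congrArg Complex.im h
  have h3 : (X' - X) * d = 0 := by
    have := (hd.hasFDerivAt.restrictScalars ℝ).apply_sub_of_affine (X' := X') (d := 0)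
      (fun t h0 h1' => by
        unfold zc
        rw [hx.affine hU (by
          simp only [Complex.sub_re, Complex.sub_im, h2]
          linear_combination ((x X').re - (x X).re) * h1) h0 h1']
        apply Complex.ext
        · simp; linear_combination t * h1
        · simp [h2])
    simpa using this
  rcases mul_eq_zero.1 h3 with h4 | h4
  · exact sub_eq_zero.1 h4
  · exact absurd h4 hd0

theorem Fc_inj (hU : ConvexOn ℝ univ U) (hx : IsProx U x) {X X' d : ℂ}
    (hd : HasDerivAt (Fc x) d X) (hd0 : d ≠ 0) (h : Fc x X' = Fc x X) : X' = X := by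
  have h1 : X'.im - (x X').im = X.im - (x X).im := congrArg Complex.im h
  have h2 : (x X').re = (x X).re := by simpa [Fc] using congrArg Complex.re h
  have h3 : (X' - X) * d = 0 := by
    have := (hd.hasFDerivAt.restrictScalars ℝ).apply_sub_of_affine (X' := X') (d := 0)
      (fun t h0 h1' => by
        unfold Fc
        rw [hx.affine hU (by
          simp only [Complex.sub_re, Complex.sub_im, h2]
          linear_combination ((x X').im - (x X).im) * h1) h0 h1']
        apply Complex.ext
        · simp [h2]
        · simp; linear_combination t * h1)
    simpa using this
  rcases mul_eq_zero.1 h3 with h4 | h4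
  · exact sub_eq_zero.1 h4
  · exact absurd h4 hd0

/-- The area of a subset `T` of the domain is controlled by the areas swept by the two holomorphic
coordinates. -/
theorem volume_le_area (hU : ConvexOn ℝ univ U) (hx : IsProx U x) (hA : IsOpen A) (hAl : Alex U A)
    {T : Set ℂ} (hT : MeasurableSet T) (hTA : T ⊆ A) {c : ℝ} (hc : 0 < c) :
    volume T ≤ ENNReal.ofReal (c / 2) * volume (zc x '' (x ⁻¹' T)) +
      ENNReal.ofReal (1 / (2 * c)) *
        ∫⁻ X in x ⁻¹' T, ENNReal.ofReal (‖deriv (Fc x) X‖ ^ 2) := by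
  have hV : IsOpen (x ⁻¹' A) := hA.preimage hx.lipschitz.continuous
  have hW : MeasurableSet (x ⁻¹' T) := hx.lipschitz.continuous.measurable hT
  have hWV : x ⁻¹' T ⊆ x ⁻¹' A := preimage_mono hTA
  have hz : ∀ X ∈ x ⁻¹' A, HasDerivAt (zc x) (deriv (zc x) X) X := fun X hX =>
    ((hx.differentiableOn_z hU hA hAl).differentiableAt (hV.mem_nhds hX)).hasDerivAt
  have hF : ∀ X ∈ x ⁻¹' A, HasDerivAt (Fc x) (deriv (Fc x) X) X := fun X hX =>
    ((hx.differentiableOn_F hU hA hAl).differentiableAt (hV.mem_nhds hX)).hasDerivAt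
  let T' : ℂ → ℂ →L[ℝ] ℂ := fun X =>
    Complex.ofRealCLM.comp (Complex.reCLM.comp
      ((ContinuousLinearMap.toSpanSingleton ℂ (deriv (Fc x) X)).restrictScalars ℝ)) +
    (Complex.I : ℂ) • Complex.ofRealCLM.comp (Complex.imCLM.comp
      ((ContinuousLinearMap.toSpanSingleton ℂ (deriv (zc x) X)).restrictScalars ℝ))
  have hx' : ∀ X ∈ x ⁻¹' A, HasFDerivAt x (T' X) X := by
    intro X hX
    have h1 := (Complex.ofRealCLM.comp Complex.reCLM).hasFDerivAt.comp X
      ((hF X hX).hasFDerivAt.restrictScalars ℝ)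
    have h2 := ((Complex.ofRealCLM.comp Complex.imCLM).hasFDerivAt.comp X
      ((hz X hX).hasFDerivAt.restrictScalars ℝ)).const_smul (Complex.I : ℂ)
    refine (h1.add h2).congr_of_eventuallyEq (Filter.Eventually.of_forall fun Y => ?_)
    apply Complex.ext <;> simp [zc, Fc]
  have hdet : ∀ X ∈ x ⁻¹' T, ENNReal.ofReal |(T' X).det| ≤
      ENNReal.ofReal (c / 2) * ENNReal.ofReal (‖deriv (zc x) X‖ ^ 2) +
      ENNReal.ofReal (1 / (2 * c)) * ENNReal.ofReal (‖deriv (Fc x) X‖ ^ 2) := by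
    intro X _
    rw [← ENNReal.ofReal_mul (by positivity), ← ENNReal.ofReal_mul (by positivity),
      ← ENNReal.ofReal_add (by positivity) (by positivity)]
    apply ENNReal.ofReal_le_ofReal
    have h1 : (T' X).det = (deriv (Fc x) X).re * (deriv (zc x) X).re +
        (deriv (Fc x) X).im * (deriv (zc x) X).im := by
      rw [Complex.det_real_clm]
      simp [T']
    have h2 : |(T' X).det| ≤ ‖deriv (Fc x) X‖ * ‖deriv (zc x) X‖ := by
      rw [h1, ← cinner]; exact abs_real_inner_le_norm _ _
    refine h2.trans ?_
    have h3 := sq_nonneg (c * ‖deriv (zc x) X‖ - ‖deriv (Fc x) X‖)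
    have h4 : c / 2 * ‖deriv (zc x) X‖ ^ 2 + 1 / (2 * c) * ‖deriv (Fc x) X‖ ^ 2 =
      ‖deriv (Fc x) X‖ * ‖deriv (zc x) X‖ +
        (c * ‖deriv (zc x) X‖ - ‖deriv (Fc x) X‖) ^ 2 / (2 * c) := by
      field_simp; ring
    rw [h4]
    have : 0 ≤ (c * ‖deriv (zc x) X‖ - ‖deriv (Fc x) X‖) ^ 2 / (2 * c) := by positivity
    linarith
  have himg : x '' (x ⁻¹' T) = T := by
    apply image_preimage_eq
    intro a
    obtain ⟨p, hp⟩ := exists_isSub hU a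
    exact ⟨a + p, hx.eq_of_isSub hp⟩
  calc volume T = volume (x '' (x ⁻¹' T)) := by rw [himg]
    _ ≤ ∫⁻ X in x ⁻¹' T, ENNReal.ofReal |(T' X).det| :=
        addHaar_image_le_lintegral_abs_det_fderiv volume hW
          (fun X hX => (hx' X (hWV hX)).hasFDerivWithinAt)
    _ ≤ ∫⁻ X in x ⁻¹' T, (ENNReal.ofReal (c / 2) * ENNReal.ofReal (‖deriv (zc x) X‖ ^ 2) +
      ENNReal.ofReal (1 / (2 * c)) * ENNReal.ofReal (‖deriv (Fc x) X‖ ^ 2)) :=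
        setLIntegral_mono' hW hdet
    _ = ENNReal.ofReal (c / 2) * (∫⁻ X in x ⁻¹' T, ENNReal.ofReal (‖deriv (zc x) X‖ ^ 2)) +
      ENNReal.ofReal (1 / (2 * c)) *
        ∫⁻ X in x ⁻¹' T, ENNReal.ofReal (‖deriv (Fc x) X‖ ^ 2) := by
        have m1 : Measurable fun X => ENNReal.ofReal (‖deriv (zc x) X‖ ^ 2) :=
          ((measurable_deriv (zc x)).norm.pow_const 2).ennreal_ofReal
        have m2 : Measurable fun X => ENNReal.ofReal (‖deriv (Fc x) X‖ ^ 2) :=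
          ((measurable_deriv (Fc x)).norm.pow_const 2).ennreal_ofReal
        rw [lintegral_add_left (m1.const_mul _), lintegral_const_mul _ m1,
          lintegral_const_mul _ m2]
    _ ≤ _ := by
        gcongr
        exact lintegral_normSq_le hW (measurable_deriv _) (fun X hX => hz X (hWV hX))
          (fun X hX X' h0 h => zc_inj hU hx (hz X (hWV hX)) h0 h)

theorem lintegral_Fc_le (hU : ConvexOn ℝ univ U) (hx : IsProx U x) (hA : IsOpen A)
    (hAl : Alex U A) {T : Set ℂ} (hT : MeasurableSet T) (hTA : T ⊆ A) :
    ∫⁻ X in x ⁻¹' T, ENNReal.ofReal (‖deriv (Fc x) X‖ ^ 2) ≤ volume (Fc x '' (x ⁻¹' T)) := by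
  have hV : IsOpen (x ⁻¹' A) := hA.preimage hx.lipschitz.continuous
  have hW : MeasurableSet (x ⁻¹' T) := hx.lipschitz.continuous.measurable hT
  have hF : ∀ X ∈ x ⁻¹' T, HasDerivAt (Fc x) (deriv (Fc x) X) X := fun X hX =>
    ((hx.differentiableOn_F hU hA hAl).differentiableAt (hV.mem_nhds (hTA hX))).hasDerivAt
  exact lintegral_normSq_le hW (measurable_deriv _) hF
    (fun X hX X' h0 h => Fc_inj hU hx (hF X hX) h0 h)

end IsProx

namespace IsProx

variable {U : ℂ → ℝ} {x : ℂ → ℂ} {A : Set ℂ} {ρ K τ : ℝ}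

theorem subgradient_bounds (h0 : ∀ w, 0 ≤ U w) (hU0 : U 0 = 0)
    (hK : ∀ w, ‖w‖ ≤ 1 → U w ≤ K) (hK1 : 1 ≤ K) (hρ : 0 < ρ) (hρ1 : ρ ≤ 1 / 2)
    (hτρ : τ ≤ ρ / 12) (hε : U ρ ≤ τ) {w p : ℂ} (hw : w.re ∈ Ioo (ρ / 3) (2 * ρ / 3))
    (hw' : w.im ∈ Ioo (τ / 2) τ) (hp : IsSub U w p) :
    |p.re| ≤ 9 * K * τ / ρ ∧ |p.im| ≤ 2 * K := by
  obtain ⟨hs1, hs2⟩ := hw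
  obtain ⟨ht1, ht2⟩ := hw'
  have hτ : 0 < τ := by linarith
  have hwn : ‖w‖ ≤ 1 / 2 := by
    refine (Complex.norm_le_abs_re_add_abs_im w).trans ?_
    rw [abs_of_pos (by linarith), abs_of_pos (by linarith)]
    linarith
  have hpn : ‖p‖ ≤ K / (1 / 2) := hp.norm_le_of_bound (h0 w) (by norm_num) (fun y hy => by
    apply hK
    calc ‖y‖ = ‖(y - w) + w‖ := by congr 1; ring
      _ ≤ ‖y - w‖ + ‖w‖ := norm_add_le _ _
      _ ≤ 1 := by linarith)
  have hpim : |p.im| ≤ 2 * K := by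
    have := (Complex.abs_im_le_norm p).trans hpn
    linarith
  refine ⟨?_, hpim⟩
  have hq := abs_le.1 hpim
  have h1 := hp ρ
  have h2 := hp 0
  rw [cinner] at h1 h2
  simp only [Complex.sub_re, Complex.sub_im, Complex.ofReal_re, Complex.ofReal_im,
    Complex.zero_re, Complex.zero_im, hU0] at h1 h2
  have h3 := h0 w
  have hqt : |p.im * w.im| ≤ 2 * K * τ := by
    rw [abs_mul, abs_of_pos (show 0 < w.im by linarith)]
    exact mul_le_mul hpim ht2.le (by linarith) (by linarith)
  have hqt' := abs_le.1 hqt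
  have hKτ : τ ≤ K * τ := by nlinarith
  have hab : |p.re| * ρ = |p.re * ρ| := by rw [abs_mul, abs_of_pos hρ]
  rw [le_div_iff₀ hρ, hab, abs_le]
  constructor
  · rcases le_or_gt 0 p.re with h | h
    · nlinarith [mul_pos (show 0 < K by linarith) hτ, mul_nonneg h hρ.le]
    · nlinarith
  · rcases le_or_gt 0 p.re with h | h
    · nlinarith
    · nlinarith [mul_pos (show 0 < K by linarith) hτ, mul_pos (neg_pos.2 h) hρ]

theorem box_energy (hU : ConvexOn ℝ univ U) (hx : IsProx U x) (hA : IsOpen A) (hAl : Alex U A)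
    (h0 : ∀ w, 0 ≤ U w) (hU0 : U 0 = 0)
    (hK : ∀ w, ‖w‖ ≤ 1 → U w ≤ K) (hK1 : 1 ≤ K) (hρ : 0 < ρ) (hρ1 : ρ ≤ 1 / 2) (hτ : 0 < τ)
    (hτρ : τ ≤ ρ / 12) (hε : U ρ ≤ τ)
    (hT : {w : ℂ | w.re ∈ Ioo (ρ / 3) (2 * ρ / 3) ∧ w.im ∈ Ioo (τ / 2) τ} ⊆ A) :
    ENNReal.ofReal (ρ ^ 3 / (324 * K)) ≤
      ∫⁻ X in x ⁻¹' {w : ℂ | w.re ∈ Ioo (ρ / 3) (2 * ρ / 3) ∧ w.im ∈ Ioo (τ / 2) τ},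
        ENNReal.ofReal (‖deriv (Fc x) X‖ ^ 2) := by
  set T : Set ℂ := {w : ℂ | w.re ∈ Ioo (ρ / 3) (2 * ρ / 3) ∧ w.im ∈ Ioo (τ / 2) τ} with hTdef
  have hTm : MeasurableSet T :=
    (Complex.measurable_re measurableSet_Ioo).inter (Complex.measurable_im measurableSet_Ioo)
  set I := ∫⁻ X in x ⁻¹' T, ENNReal.ofReal (‖deriv (Fc x) X‖ ^ 2)
  have hK0 : 0 < K := by linarith
  have h1 := hx.volume_le_area hU hA hAl hTm hT (c := ρ ^ 2 / (54 * K * τ)) (by positivity)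
  have h2 : volume T = ENNReal.ofReal (ρ * τ / 6) := by
    rw [hTdef, Complex.volume_box, Real.volume_Ioo, Real.volume_Ioo,
      ← ENNReal.ofReal_mul (by linarith)]
    congr 1; ring
  have h3 : volume (zc x '' (x ⁻¹' T)) ≤ ENNReal.ofReal (9 * K * τ ^ 2 / ρ) := by
    have : zc x '' (x ⁻¹' T) ⊆ {w : ℂ | w.re ∈ Icc (-(9 * K * τ / ρ)) (9 * K * τ / ρ) ∧
        w.im ∈ Ioo (τ / 2) τ} := by
      rintro _ ⟨X, hX, rfl⟩
      have hb := subgradient_bounds h0 hU0 hK hK1 hρ hρ1 hτρ hε hX.1 hX.2 (hx X)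
      exact ⟨abs_le.1 hb.1, hX.2⟩
    refine (measure_mono this).trans ?_
    rw [Complex.volume_box, Real.volume_Ioo, Real.volume_Icc,
      ← ENNReal.ofReal_mul (by rw [sub_neg_eq_add]; positivity)]
    apply ENNReal.ofReal_le_ofReal
    apply le_of_eq; field_simp; ring
  by_cases hI : I = ⊤
  · rw [hI]; exact le_top
  rw [← ENNReal.ofReal_toReal hI]
  apply ENNReal.ofReal_le_ofReal
  have h4 : ENNReal.ofReal (ρ * τ / 6) ≤ ENNReal.ofReal
      (ρ ^ 2 / (54 * K * τ) / 2 * (9 * K * τ ^ 2 / ρ) +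
        1 / (2 * (ρ ^ 2 / (54 * K * τ))) * I.toReal) := by
    rw [← h2, ENNReal.ofReal_add (by positivity) (by positivity), ENNReal.ofReal_mul (by positivity),
      ENNReal.ofReal_mul (by positivity), ENNReal.ofReal_toReal hI]
    refine h1.trans ?_
    gcongr
  rw [ENNReal.ofReal_le_ofReal_iff (by positivity)] at h4
  have h5 : ρ ^ 2 / (54 * K * τ) / 2 * (9 * K * τ ^ 2 / ρ) = ρ * τ / 12 := by
    field_simp; ring
  have h6 : 1 / (2 * (ρ ^ 2 / (54 * K * τ))) * I.toReal = 27 * K * τ * I.toReal / ρ ^ 2 := by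
    field_simp; ring
  rw [h5, h6] at h4
  have h7 : ρ * τ / 12 ≤ 27 * K * τ * I.toReal / ρ ^ 2 := by linarith
  rw [le_div_iff₀ (by positivity)] at h7
  rw [div_le_iff₀ (by positivity)]
  have h8 : τ * ρ ^ 3 ≤ τ * (I.toReal * (324 * K)) := by nlinarith
  exact le_of_mul_le_mul_left h8 hτ

end IsProx

theorem box_subset_of_convex {A : Set ℂ} (hA : IsOpen A) (hAc : Convex ℝ A) (h0 : (0 : ℂ) ∈ closure A)
    {ρ κ τ : ℝ} (hρ : 0 < ρ) (hρA : (ρ : ℂ) ∈ closure A) (hρ1 : ρ ≤ 1 / 2) (hκ : 0 < κ)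
    {a : ℂ} (ha : a ∈ A) (haim : κ ≤ a.im) (hare : |a.re| ≤ 1) (hτ : τ ≤ κ * ρ / 12) :
    {w : ℂ | w.re ∈ Ioo (ρ / 3) (2 * ρ / 3) ∧ w.im ∈ Ioo (τ / 2) τ} ⊆ A := by
  rintro w ⟨⟨hs1, hs2⟩, ht1, ht2⟩
  have hai : 0 < a.im := by linarith
  have ht0 : 0 < w.im := by linarith
  set l := w.im / a.im with hl
  have hl0 : 0 < l := by positivity
  have hl1 : l ≤ ρ / 12 := by
    rw [hl, div_le_iff₀ hai]
    nlinarith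
  have hla : |l * a.re| ≤ ρ / 12 := by
    rw [abs_mul, abs_of_pos hl0]
    nlinarith [abs_nonneg a.re]
  obtain ⟨hla1, hla2⟩ := abs_le.1 hla
  set m := (w.re - l * a.re) / ρ with hm
  have hm0 : 0 ≤ m := by
    rw [hm]; apply div_nonneg _ hρ.le; linarith
  have hm1 : m ≤ 3 / 4 := by
    rw [hm, div_le_iff₀ hρ]; linarith
  have hl2 : 0 < 1 - l := by linarith
  have hb : ((m / (1 - l) * ρ : ℝ) : ℂ) ∈ closure A := by
    have h1 := hAc.closure h0 hρA (a := 1 - m / (1 - l)) (b := m / (1 - l))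
      (by rw [sub_nonneg, div_le_one hl2]; linarith) (by positivity) (by ring)
    simpa using h1
  have h2 := hAc.combo_interior_closure_mem_interior (x := a) (by rwa [hA.interior_eq]) hb hl0 hl2.le (by ring)
  rw [hA.interior_eq] at h2
  convert h2 using 1
  apply Complex.ext
  · rw [Complex.add_re, Complex.smul_re, Complex.smul_re, Complex.ofReal_re, smul_eq_mul,
      smul_eq_mul, hm]
    field_simp; ring
  · rw [Complex.add_im, Complex.smul_im, Complex.smul_im, Complex.ofReal_im, smul_eq_mul,
      smul_eq_mul, hl]
    field_simp; ring

theorem strict_convexity_core {U : ℂ → ℝ} {A : Set ℂ} {ρ K κ : ℝ} {a : ℂ}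
    (hU : ConvexOn ℝ univ U) (hA : IsOpen A) (hAc : Convex ℝ A) (hAl : Alex U A)
    (h0 : ∀ w, 0 ≤ U w) (hU0 : U 0 = 0)
    (hK : ∀ w, ‖w‖ ≤ 1 → U w ≤ K) (hK1 : 1 ≤ K) (hρ : 0 < ρ) (hρ1 : ρ ≤ 1 / 2)
    (hκ : 0 < κ) (hκ1 : κ ≤ 1) (h0A : (0 : ℂ) ∈ closure A) (hρA : (ρ : ℂ) ∈ closure A)
    (ha : a ∈ A) (haim : κ ≤ a.im) (hare : |a.re| ≤ 1) {N : ℕ} (hN : 432 * K ^ 2 / ρ ^ 2 < N) :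
    κ * ρ / 12 * (1 / 2) ^ N ≤ U ρ := by
  by_contra hcon
  push Not at hcon
  obtain ⟨x, hx⟩ := exists_isProx hU h0
  set τ : ℕ → ℝ := fun k => κ * ρ / 12 * (1 / 2) ^ k with hτdef
  have hτ0 : ∀ k, 0 < τ k := fun k => by positivity
  have hτanti : ∀ {j k}, j ≤ k → τ k ≤ τ j := fun {j k} hjk => by
    simp only [hτdef]
    gcongr ?_ * ?_
    exact pow_le_pow_of_le_one (by norm_num) (by norm_num) hjk
  have hτ1 : ∀ k, τ k ≤ κ * ρ / 12 := fun k => by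
    have := hτanti (Nat.zero_le k)
    simpa [hτdef] using this
  have hτ2 : ∀ k, τ k ≤ ρ / 12 := fun k => (hτ1 k).trans (by nlinarith)
  let T : ℕ → Set ℂ := fun k => {w : ℂ | w.re ∈ Ioo (ρ / 3) (2 * ρ / 3) ∧
    w.im ∈ Ioo (τ k / 2) (τ k)}
  have hTA : ∀ k, T k ⊆ A := fun k =>
    box_subset_of_convex hA hAc h0A hρ hρA hρ1 hκ ha haim hare (hτ1 k)
  have hTm : ∀ k, MeasurableSet (T k) := fun k =>
    (Complex.measurable_re measurableSet_Ioo).inter (Complex.measurable_im measurableSet_Ioo)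
  have hdisj : Pairwise (Function.onFun Disjoint fun k => x ⁻¹' T k) := by
    have key : ∀ j k, j < k → Disjoint (x ⁻¹' T j) (x ⁻¹' T k) := by
      intro j k hjk
      rw [Set.disjoint_left]
      rintro X ⟨_, h1, _⟩ ⟨_, _, h2⟩
      have h3 := hτanti (Nat.succ_le_of_lt hjk)
      have h4 : τ (j + 1) = τ j / 2 := by simp only [hτdef, pow_succ]; ring
      simp only [Nat.succ_eq_add_one, h4] at h3
      linarith
    intro j k hjk
    rcases lt_or_gt_of_ne hjk with h | h
    · exact key j k h
    · exact (key k j h).symm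
  have hsum : ∑ k ∈ Finset.range N, ∫⁻ X in x ⁻¹' T k,
      ENNReal.ofReal (‖deriv (IsProx.Fc x) X‖ ^ 2) =
      ∫⁻ X in x ⁻¹' (⋃ k ∈ Finset.range N, T k), ENNReal.ofReal (‖deriv (IsProx.Fc x) X‖ ^ 2) := by
    rw [preimage_iUnion₂, lintegral_biUnion_finset]
    · exact fun j _ k _ hjk => hdisj hjk
    · exact fun k _ => hx.lipschitz.continuous.measurable (hTm k)
  have hup : ∫⁻ X in x ⁻¹' (⋃ k ∈ Finset.range N, T k),
      ENNReal.ofReal (‖deriv (IsProx.Fc x) X‖ ^ 2) ≤ ENNReal.ofReal (4 * K * ρ / 3) := by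
    refine (hx.lintegral_Fc_le hU hA hAl (Finset.measurableSet_biUnion _ fun k _ => hTm k)
      (iUnion₂_subset fun k _ => hTA k)).trans ?_
    have : IsProx.Fc x '' (x ⁻¹' (⋃ k ∈ Finset.range N, T k)) ⊆
        {w : ℂ | w.re ∈ Ioo (ρ / 3) (2 * ρ / 3) ∧ w.im ∈ Icc (-(2 * K)) (2 * K)} := by
      rintro _ ⟨X, hX, rfl⟩
      simp only [mem_preimage, mem_iUnion] at hX
      obtain ⟨k, hk, hX⟩ := hX
      have hb := IsProx.subgradient_bounds h0 hU0 hK hK1 hρ hρ1 (hτ2 k)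
        (hcon.le.trans (hτanti (Finset.mem_range.1 hk).le)) hX.1 hX.2 (hx X)
      exact ⟨hX.1, abs_le.1 hb.2⟩
    refine (measure_mono this).trans ?_
    rw [Complex.volume_box, Real.volume_Ioo, Real.volume_Icc, ← ENNReal.ofReal_mul (by linarith)]
    apply ENNReal.ofReal_le_ofReal
    linarith
  have hlow : ∑ _k ∈ Finset.range N, ENNReal.ofReal (ρ ^ 3 / (324 * K)) ≤
      ∑ k ∈ Finset.range N, ∫⁻ X in x ⁻¹' T k,
      ENNReal.ofReal (‖deriv (IsProx.Fc x) X‖ ^ 2) := by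
    apply Finset.sum_le_sum
    intro k hk
    exact hx.box_energy hU hA hAl h0 hU0 hK hK1 hρ hρ1 (hτ0 k) (hτ2 k)
      (hcon.le.trans (hτanti (Finset.mem_range.1 hk).le)) (hTA k)
  have hfin := (hlow.trans (le_of_eq hsum)).trans hup
  have hK0 : 0 < K := by linarith
  rw [Finset.sum_const, Finset.card_range, nsmul_eq_mul, ← ENNReal.ofReal_natCast,
    ← ENNReal.ofReal_mul (by positivity), ENNReal.ofReal_le_ofReal_iff (by positivity)] at hfin
  rw [div_lt_iff₀ (by positivity)] at hN
  rw [← mul_div_assoc, div_le_iff₀ (by positivity)] at hfin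
  nlinarith

theorem exists_isometry_of_frame {F : Type*} [NormedAddCommGroup F] [InnerProductSpace ℝ F]
    [FiniteDimensional ℝ F] (hF : Module.finrank ℝ F = 2) {e f : F} (he : ‖e‖ = 1) (hf : ‖f‖ = 1)
    (hef : ⟪e, f⟫ = 0) :
    ∃ J : ℂ ≃ₗᵢ[ℝ] F, ∀ a b : ℝ, J ⟨a, b⟩ = a • e + b • f := by
  have ho : Orthonormal ℝ ![e, f] := by
    constructor
    · intro i; fin_cases i <;> simp [he, hf]
    · intro i j hij
      fin_cases i <;> fin_cases j <;> simp_all [real_inner_comm]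
  have hcard : Fintype.card (Fin 2) = Module.finrank ℝ F := by simp [hF]
  let b : OrthonormalBasis (Fin 2) ℝ F :=
    (basisOfOrthonormalOfCardEqFinrank ho hcard).toOrthonormalBasis (by simpa using ho)
  have hb : ∀ i, b i = ![e, f] i := by intro i; simp [b]
  refine ⟨Complex.orthonormalBasisOneI.equiv b (Equiv.refl _), fun s t => ?_⟩
  have h1 := Complex.orthonormalBasisOneI.equiv_apply_basis b (Equiv.refl _) 0
  have h2 := Complex.orthonormalBasisOneI.equiv_apply_basis b (Equiv.refl _) 1
  have h3 : (⟨s, t⟩ : ℂ) = s • Complex.orthonormalBasisOneI 0 + t • Complex.orthonormalBasisOneI 1 := by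
    apply Complex.ext <;> simp
  rw [h3, map_add, map_smul, map_smul, h1, h2]
  simp [hb]

/-- A potential normalized so that its section of height about one at the origin is comparable
to the unit disk. -/
structure Normalized (κ : ℝ) (U : ℂ → ℝ) (A : Set ℂ) : Prop where
  convexOn : ConvexOn ℝ univ U
  isOpen : IsOpen A
  convex : Convex ℝ A
  alex : Alex U A
  nonneg : ∀ w, 0 ≤ U w
  zero : U 0 = 0
  bound : ∀ w, ‖w‖ ≤ 1 → U w ≤ 1 / κ
  zero_mem : (0 : ℂ) ∈ closure A
  ball : ∃ a, ‖a‖ ≤ 1 / 2 ∧ ball a κ ⊆ A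

theorem Normalized.comp_isometry {κ : ℝ} {U : ℂ → ℝ} {A : Set ℂ} (h : Normalized κ U A)
    (J : ℂ ≃ₗᵢ[ℝ] ℂ) : Normalized κ (fun w => U (J w)) (J ⁻¹' A) where
  convexOn := h.convexOn.comp_isometry J
  isOpen := h.isOpen.preimage J.continuous
  convex := h.convex.linear_preimage J.toLinearEquiv.toLinearMap
  alex := h.alex.comp_isometry J
  nonneg w := h.nonneg _
  zero := by simp [h.zero]
  bound w hw := h.bound _ (by simpa using hw)
  zero_mem := by
    have := J.toHomeomorph.preimage_closure A
    have h1 : (0 : ℂ) ∈ J ⁻¹' closure A := by simpa using h.zero_mem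
    exact this ▸ h1
  ball := by
    obtain ⟨a, ha, hb⟩ := h.ball
    refine ⟨J.symm a, by simpa using ha, fun w hw => hb ?_⟩
    rw [mem_ball, dist_eq_norm] at hw ⊢
    rwa [← J.symm.norm_map, map_sub, J.symm_apply_apply]

/-- Quantitative strict convexity of normalized potentials. -/
theorem strict_convexity {κ ρ : ℝ} (hκ : 0 < κ) (hκ1 : κ ≤ 1) (hρ : 0 < ρ) :
    ∃ φ : ℝ, 0 < φ ∧ ∀ (U : ℂ → ℝ) (A : Set ℂ), Normalized κ U A →
      ∀ x ∈ closure A, ρ ≤ ‖x‖ → φ ≤ U x := by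
  set r := min ρ (1 / 2) with hr
  have hr0 : 0 < r := by positivity
  obtain ⟨N, hN⟩ := exists_nat_gt (432 * (1 / κ) ^ 2 / r ^ 2)
  refine ⟨κ / 2 * r / 12 * (1 / 2) ^ N, by positivity, fun U A h x hx hxρ => ?_⟩
  have hx0 : 0 < ‖x‖ := hρ.trans_le hxρ
  have hrx : r ≤ ‖x‖ := (min_le_left _ _).trans hxρ
  set c : ℂ := (‖x‖⁻¹ : ℝ) • x with hc
  have hcn : ‖c‖ = 1 := by rw [hc, norm_smul]; simp [hx0.ne']
  obtain ⟨a, ha, hball⟩ := h.ball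
  obtain ⟨J, hJ1, hJa⟩ : ∃ J : ℂ ≃ₗᵢ[ℝ] ℂ, J 1 = c ∧ 0 ≤ (J.symm a).im := by
    have key : ∀ f : ℂ, ‖f‖ = 1 → ⟪c, f⟫ = 0 → 0 ≤ ⟪f, a⟫ →
        ∃ J : ℂ ≃ₗᵢ[ℝ] ℂ, J 1 = c ∧ 0 ≤ (J.symm a).im := by
      intro f hf1 hf2 hf3
      obtain ⟨J, hJ⟩ := exists_isometry_of_frame (by simp) hcn hf1 hf2
      have hJI : J Complex.I = f := by
        have := hJ 0 1; simpa [show (⟨0, 1⟩ : ℂ) = Complex.I from rfl] using this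
      refine ⟨J, ?_, ?_⟩
      · have := hJ 1 0; simpa [show (⟨1, 0⟩ : ℂ) = 1 from rfl] using this
      · have h1 : ⟪J Complex.I, J (J.symm a)⟫ = (J.symm a).im := by
          rw [J.inner_map_map, cinner]; simp
        rw [← h1, hJI]; simpa using hf3
    have hI : ‖Complex.I * c‖ = 1 := by simp [hcn]
    have horth : ⟪c, Complex.I * c⟫ = 0 := by rw [cinner]; simp; ring
    rcases le_total 0 ⟪Complex.I * c, a⟫ with h1 | h1
    · exact key _ hI horth h1
    · exact key (-(Complex.I * c)) (by simpa using hI) (by simp [horth])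
        (by rw [inner_neg_left]; linarith)
  have h' := h.comp_isometry J
  have hrA : (r : ℂ) ∈ closure (J ⁻¹' A) := by
    have h1 : J (r : ℂ) ∈ closure A := by
      have h2 : J (r : ℂ) = (r / ‖x‖) • x := by
        have : (r : ℂ) = r • (1 : ℂ) := by simp
        rw [this, map_smul, hJ1, hc, smul_smul]; rfl
      rw [h2]
      have h3 := h.convex.closure h.zero_mem hx (a := 1 - r / ‖x‖) (b := r / ‖x‖)
        (by rw [sub_nonneg, div_le_one hx0]; exact hrx) (by positivity) (by ring)
      simpa using h3
    have := J.toHomeomorph.preimage_closure A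
    exact this ▸ (show (r : ℂ) ∈ J ⁻¹' closure A from h1)
  have hbound := strict_convexity_core (a := J.symm a + (κ / 2 : ℝ) * Complex.I) (κ := κ / 2)
    (K := 1 / κ) h'.convexOn h'.isOpen
    h'.convex h'.alex h'.nonneg h'.zero h'.bound (by rw [le_div_iff₀ hκ]; linarith) hr0
    (min_le_right _ _) (by positivity) (by linarith) h'.zero_mem hrA (by
      apply hball
      rw [mem_ball, dist_eq_norm, map_add, J.apply_symm_apply, add_sub_cancel_left, J.norm_map,
        norm_mul, Complex.norm_I, Complex.norm_real, mul_one, Real.norm_eq_abs,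
        abs_of_pos (by positivity)]
      linarith) (by simpa using hJa) (by
      have h1 := Complex.abs_re_le_norm (J.symm a)
      rw [J.symm.norm_map] at h1
      simp
      linarith) hN
  have h2 : J (r : ℂ) = (r / ‖x‖) • x := by
    have : (r : ℂ) = r • (1 : ℂ) := by simp
    rw [this, map_smul, hJ1, hc, smul_smul]; rfl
  rw [h2] at hbound
  have h3 := h.convexOn.2 (mem_univ 0) (mem_univ x)
    (show (0 : ℝ) ≤ 1 - r / ‖x‖ by rw [sub_nonneg, div_le_one hx0]; exact hrx)
    (show (0 : ℝ) ≤ r / ‖x‖ by positivity) (by ring)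
  have h4 : r / ‖x‖ ≤ 1 := by rw [div_le_one hx0]; exact hrx
  simp only [smul_zero, zero_add, h.zero, smul_eq_mul] at h3
  have h5 := h.nonneg x
  nlinarith

section Scaling

variable {F : Type*} [NormedAddCommGroup F] [InnerProductSpace ℝ F]

/-- The point with coordinates `(L a.re, l a.im)` in the orthonormal frame given by `J`. -/
def sc (L l : ℝ) (J : ℂ ≃ₗᵢ[ℝ] F) (a : ℂ) : F := J ⟨L * a.re, l * a.im⟩

/-- Rescaled coordinates of a point in the orthonormal frame given by `J`. -/
def usc (L l : ℝ) (J : ℂ ≃ₗᵢ[ℝ] F) (w : F) : ℂ := ⟨(J.symm w).re / L, (J.symm w).im / l⟩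

variable {L l L' l' : ℝ} {J J' : ℂ ≃ₗᵢ[ℝ] F}

theorem usc_sc (hL : 0 < L) (hl : 0 < l) (a : ℂ) : usc L l J (sc L l J a) = a := by
  apply Complex.ext <;> simp [usc, sc, hL.ne', hl.ne']

theorem sc_usc (hL : 0 < L) (hl : 0 < l) (w : F) : sc L l J (usc L l J w) = w := by
  have h : (⟨L * ((J.symm w).re / L), l * ((J.symm w).im / l)⟩ : ℂ) = J.symm w := by
    apply Complex.ext <;> simp <;> field_simp
  simp only [sc, usc, h, J.apply_symm_apply]

theorem sc_add (a b : ℂ) : sc L l J (a + b) = sc L l J a + sc L l J b := by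
  rw [sc, sc, sc, ← map_add]; congr 1; apply Complex.ext <;> simp <;> ring

theorem sc_smul (r : ℝ) (a : ℂ) : sc L l J (r • a) = r • sc L l J a := by
  rw [sc, sc, ← map_smul]; congr 1; apply Complex.ext <;> simp <;> ring

theorem sc_sub (a b : ℂ) : sc L l J (a - b) = sc L l J a - sc L l J b := by
  rw [sc, sc, sc, ← map_sub]; congr 1; apply Complex.ext <;> simp <;> ring

theorem sc_zero : sc L l J 0 = 0 := by
  have : (⟨0, 0⟩ : ℂ) = 0 := rfl
  simp [sc, this]

theorem usc_add (a b : F) : usc L l J (a + b) = usc L l J a + usc L l J b := by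
  apply Complex.ext <;> simp [usc] <;> ring

theorem usc_sub (a b : F) : usc L l J (a - b) = usc L l J a - usc L l J b := by
  apply Complex.ext <;> simp [usc] <;> ring

theorem usc_smul (r : ℝ) (a : F) : usc L l J (r • a) = r • usc L l J a := by
  apply Complex.ext <;> simp [usc] <;> ring

theorem usc_zero : usc L l J (0 : F) = 0 := by
  apply Complex.ext <;> simp [usc]

/-- `sc` as a linear map. -/
def scLin (L l : ℝ) (J : ℂ ≃ₗᵢ[ℝ] F) : ℂ →ₗ[ℝ] F where
  toFun := sc L l J
  map_add' := sc_add
  map_smul' := sc_smul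

theorem continuous_sc : Continuous (sc L l J) := by
  have h : sc L l J = fun a : ℂ => J (((L * a.re : ℝ) : ℂ) + ((l * a.im : ℝ) : ℂ) * Complex.I) := by
    funext a; rw [sc]; congr 1; apply Complex.ext <;> simp
  rw [h]; fun_prop

theorem continuous_usc : Continuous (usc L l J) := by
  have h : usc L l J = fun w : F => ((((J.symm w).re / L : ℝ) : ℂ) +
      (((J.symm w).im / l : ℝ) : ℂ) * Complex.I) := by
    funext a; rw [usc]; apply Complex.ext <;> simp
  rw [h]; fun_prop

/-- `sc` as a homeomorphism. -/
def scHomeo (hL : 0 < L) (hl : 0 < l) (J : ℂ ≃ₗᵢ[ℝ] F) : ℂ ≃ₜ F where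
  toFun := sc L l J
  invFun := usc L l J
  left_inv := usc_sc hL hl
  right_inv := sc_usc hL hl
  continuous_toFun := continuous_sc
  continuous_invFun := continuous_usc

theorem preimage_closure_sc (hL : 0 < L) (hl : 0 < l) (A : Set F) :
    sc L l J ⁻¹' closure A = closure (sc L l J ⁻¹' A) :=
  (scHomeo hL hl J).preimage_closure A

theorem inner_sc_sc (a b : ℂ) :
    ⟪sc L l J a, sc l L J b⟫ = L * l * (a.re * b.re + a.im * b.im) := by
  rw [sc, sc, J.inner_map_map, cinner]; ring

theorem inner_eq_usc (hL : 0 < L) (hl : 0 < l) (J : ℂ ≃ₗᵢ[ℝ] F) (x y : F) :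
    ⟪x, y⟫ = L * l * ⟪usc L l J x, usc l L J y⟫ := by
  rw [cinner, ← inner_sc_sc (J := J), sc_usc hL hl, sc_usc hl hL]

theorem inner_le_usc (hL : 0 < L) (hl : 0 < l) (J : ℂ ≃ₗᵢ[ℝ] F) (x y : F) :
    ⟪x, y⟫ ≤ L * l * (‖usc L l J x‖ * ‖usc l L J y‖) := by
  rw [inner_eq_usc hL hl J]
  gcongr
  exact real_inner_le_norm _ _

theorem isSub_sc (hL : 0 < L) (hl : 0 < l) {u : F → ℝ} {a p : ℂ} :
    IsSub (fun a => u (sc L l J a) / (L * l)) a p ↔ IsSub u (sc L l J a) (sc l L J p) := by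
  have hLl : 0 < L * l := by positivity
  have key : ∀ b : ℂ, (u (sc L l J a) / (L * l) + ⟪p, b - a⟫ ≤ u (sc L l J b) / (L * l) ↔
      u (sc L l J a) + ⟪sc l L J p, sc L l J b - sc L l J a⟫ ≤ u (sc L l J b)) := by
    intro b
    rw [← sc_sub, inner_sc_sc, cinner, le_div_iff₀ hLl, add_mul, div_mul_cancel₀ _ hLl.ne',
      mul_comm l L, mul_comm (L * l)]
  constructor
  · intro h y
    have := (key (usc L l J y)).1 (h _)
    rwa [sc_usc hL hl] at this
  · intro h b
    exact (key b).2 (h _)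

theorem convexOn_sc {u : F → ℝ} (hu : ConvexOn ℝ univ u) (hL : 0 < L) (hl : 0 < l) :
    ConvexOn ℝ univ (fun a => u (sc L l J a) / (L * l)) := by
  have h1 : ConvexOn ℝ univ (fun a => u (sc L l J a)) := hu.comp_linearMap (scLin L l J)
  have h2 := h1.smul (c := (L * l)⁻¹) (by positivity)
  simpa only [div_eq_inv_mul, smul_eq_mul] using h2

theorem volume_preimage_diag (hL : 0 < L) (hl : 0 < l) (T : Set ℂ) :
    volume ((fun a : ℂ => (⟨L * a.re, l * a.im⟩ : ℂ)) ⁻¹' T) =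
      ENNReal.ofReal ((L * l)⁻¹) * volume T := by
  have hd : LinearMap.det (scLin L l (LinearIsometryEquiv.refl ℝ ℂ)) = L * l := by
    rw [← LinearMap.det_toMatrix Complex.basisOneI, Matrix.det_fin_two]
    simp [LinearMap.toMatrix_apply, scLin, sc]
  have h := Measure.addHaar_preimage_linearMap (volume : Measure ℂ)
    (f := scLin L l (LinearIsometryEquiv.refl ℝ ℂ)) (by rw [hd]; positivity) T
  rw [hd, abs_of_pos (by positivity)] at h
  exact h

theorem Alex.comp_sc [FiniteDimensional ℝ F] [MeasurableSpace F] [BorelSpace F] {u : F → ℝ}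
    {A : Set F} (h : Alex u A) (hL : 0 < L) (hl : 0 < l) (J : ℂ ≃ₗᵢ[ℝ] F) :
    Alex (fun a => u (sc L l J a) / (L * l)) (sc L l J ⁻¹' A) := by
  have h0 := h.comp_isometry J
  set d : ℂ → ℂ := fun a => (⟨L * a.re, l * a.im⟩ : ℂ) with hd
  set d' : ℂ → ℂ := fun a => (⟨l * a.re, L * a.im⟩ : ℂ) with hd'
  intro S hS
  set S' : Set ℂ := usc L l (LinearIsometryEquiv.refl ℝ ℂ) ⁻¹' S with hS'
  have h1 := h0 S' (continuous_usc.measurable hS)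
  have e1 : (⋃ x ∈ S, {p | IsSub (fun a => u (sc L l J a) / (L * l)) x p}) =
      d' ⁻¹' (⋃ x ∈ S', {p | IsSub (fun a => u (J a)) x p}) := by
    ext p
    simp only [mem_preimage, mem_iUnion, mem_ofPred_eq, exists_prop, isSub_comp_isometry J,
      isSub_sc hL hl]
    constructor
    · rintro ⟨x, hx, hp⟩
      exact ⟨d x, (show usc L l (LinearIsometryEquiv.refl ℝ ℂ)
        (sc L l (LinearIsometryEquiv.refl ℝ ℂ) x) ∈ S from by rwa [usc_sc hL hl]), hp⟩
    · rintro ⟨x, hx, hp⟩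
      refine ⟨_, hx, ?_⟩
      have : sc L l J (usc L l (LinearIsometryEquiv.refl ℝ ℂ) x) = J x := by
        conv_rhs => rw [← sc_usc (J := LinearIsometryEquiv.refl ℝ ℂ) hL hl x]
        rfl
      rw [this]; exact hp
  have e2 : S ∩ sc L l J ⁻¹' A = d ⁻¹' (S' ∩ J ⁻¹' A) := by
    ext a
    have : usc L l (LinearIsometryEquiv.refl ℝ ℂ) (d a) = a :=
      usc_sc (J := LinearIsometryEquiv.refl ℝ ℂ) hL hl a
    simp only [mem_inter_iff, mem_preimage, hS', this]
    rfl
  rw [e1, e2, hd, hd', volume_preimage_diag hL hl, volume_preimage_diag hl hL, h1, mul_comm L l]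

end Scaling

section Potentials

variable {E : Type*} [NormedAddCommGroup E] [InnerProductSpace ℝ E] [FiniteDimensional ℝ E]

theorem IsSub.eq_gradient {f : E → ℝ} {x p : E} (h : IsSub f x p) (hd : DifferentiableAt ℝ f x) :
    p = gradient f x := by
  have h1 : HasFDerivAt (fun y => f y - ⟪p, y⟫) (fderiv ℝ f x - innerSL ℝ p) x :=
    hd.hasFDerivAt.sub (innerSL ℝ p).hasFDerivAt
  have h2 : IsLocalMin (fun y => f y - ⟪p, y⟫) x := by
    refine Filter.Eventually.of_forall fun y => ?_
    have := h y
    rw [inner_sub_right] at this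
    simp only
    linarith
  have h3 := h2.hasFDerivAt_eq_zero h1
  apply ext_inner_right ℝ
  intro w
  have h4 := congrArg (fun T : E →L[ℝ] ℝ => T w) (sub_eq_zero.1 h3)
  simp only [innerSL_apply_apply] at h4
  rw [gradient, InnerProductSpace.toDual_symm_apply, h4]

theorem isSub_gradient {f : E → ℝ} (hf : ConvexOn ℝ univ f) {x : E}
    (hd : DifferentiableAt ℝ f x) : IsSub f x (gradient f x) := by
  obtain ⟨p, hp⟩ := exists_isSub hf x
  rwa [← hp.eq_gradient hd]

/-- A convex function that dominates all the affine functions with slope in a ball has a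
subgradient of every slope on a segment joining a subgradient to the half ball. -/
theorem exists_isSub_of_segment {w w' : E → ℝ} (hw : ConvexOn ℝ univ w)
    (hw' : ConvexOn ℝ univ w') {x0 p y0 y : E} {r l : ℝ} (hp : IsSub w x0 p) (hr : 0 < r)
    (hY : ∀ y ∈ ball y0 r, ∀ x, ⟪x, y⟫ ≤ w x + w' y) (hy : y ∈ ball y0 (r / 2)) (hl : 0 < l)
    (hl1 : l ≤ 1) : ∃ x, IsSub w x (p + l • (y - p)) := by
  obtain ⟨C, hC⟩ := (isCompact_closedBall y0 (3 * r / 4)).exists_bound_of_continuousOn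
    hw'.continuous_of_univ.continuousOn
  have hcoer : ∀ x, r / 4 * ‖x‖ - C ≤ w x - ⟪x, y⟫ := by
    intro x
    by_cases hx : x = 0
    · have h1 := hY y (ball_subset_ball (by linarith) hy) 0
      have h2 := hC y (mem_closedBall.2 (by have := mem_ball.1 hy; linarith))
      rw [Real.norm_eq_abs] at h2
      have := le_abs_self (w' y)
      subst hx; simp at h1 ⊢; linarith
    · have hx' : 0 < ‖x‖ := norm_pos_iff.2 hx
      set y' := y + (r / 4 / ‖x‖) • x with hy'
      have hd : dist y' y0 < 3 * r / 4 := by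
        have h1 : dist y' y ≤ r / 4 := by
          rw [hy', dist_eq_norm, add_sub_cancel_left, norm_smul, Real.norm_eq_abs,
            abs_of_pos (by positivity), div_mul_cancel₀ _ hx'.ne']
        have h2 := mem_ball.1 hy
        have := dist_triangle y' y y0
        linarith
      have h1 := hY y' (mem_ball.2 (by linarith)) x
      have h2 := hC y' (mem_closedBall.2 hd.le)
      rw [Real.norm_eq_abs] at h2
      have h3 := le_abs_self (w' y')
      have h4 : ⟪x, y'⟫ = ⟪x, y⟫ + r / 4 * ‖x‖ := by
        rw [hy', inner_add_right, inner_smul_right, real_inner_self_eq_norm_sq]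
        field_simp
      linarith
  set q := p + l • (y - p) with hq
  have hlow : ∀ x, l * (r / 4 * ‖x‖) + ((1 - l) * (w x0 - ⟪p, x0⟫) - l * C) ≤ w x - ⟪q, x⟫ := by
    intro x
    have h1 := hp x
    have h2 := hcoer x
    have h3 : ⟪q, x⟫ = (1 - l) * ⟪p, x⟫ + l * ⟪x, y⟫ := by
      rw [hq, inner_add_left, inner_smul_left, inner_sub_left, real_inner_comm x y]; simp; ring
    rw [h3]
    rw [inner_sub_right] at h1
    nlinarith
  have hcont : Continuous fun x => w x - ⟪q, x⟫ := hw.continuous_of_univ.sub (by fun_prop)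
  obtain ⟨x, hx⟩ := hcont.exists_forall_le (by
    refine Filter.tendsto_atTop_mono hlow (Filter.tendsto_atTop_add_const_right _ _ ?_)
    exact ((tendsto_norm_cocompact_atTop (E := E)).const_mul_atTop (by positivity)).const_mul_atTop
      hl)
  refine ⟨x, fun x' => ?_⟩
  have := hx x'
  rw [inner_sub_right]
  linarith

variable [MeasurableSpace E] [BorelSpace E]

theorem ConvexOn.volume_not_differentiableAt {f : E → ℝ} (hf : ConvexOn ℝ univ f) :
    volume {x | ¬DifferentiableAt ℝ f x} = 0 := by
  refine measure_null_of_locally_null _ fun x _ => ?_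
  obtain ⟨K, t, ht, hK⟩ := hf.locallyLipschitzOn isOpen_univ (mem_univ x)
  rw [nhdsWithin_univ] at ht
  obtain ⟨s, hst, hs, hxs⟩ := _root_.mem_nhds_iff.1 ht
  refine ⟨s ∩ {x | ¬DifferentiableAt ℝ f x}, ?_, ?_⟩
  · rw [nhdsWithin]
    exact Filter.inter_mem_inf (hs.mem_nhds hxs) (Filter.mem_principal_self _)
  · have h1 := (hK.mono hst).ae_differentiableWithinAt_of_mem (μ := volume)
    refine measure_mono_null (fun y hy => ?_) h1
    simp only [mem_compl_iff, mem_ofPred_eq, not_forall] at *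
    exact ⟨hy.1, fun h => hy.2 (h.differentiableAt (hs.mem_nhds hy.1))⟩

theorem measurable_gradient (f : E → ℝ) : Measurable (gradient f) :=
  (InnerProductSpace.toDual ℝ E).symm.continuous.measurable.comp (measurable_fderiv ℝ f)

theorem Convex.volume_inter_interior {Ω : Set E} (hΩ : Convex ℝ Ω) (S : Set E) :
    volume (S ∩ interior Ω) = volume (S ∩ Ω) := by
  refine le_antisymm (measure_mono (inter_subset_inter_right _ interior_subset)) ?_
  have h : S ∩ Ω ⊆ (S ∩ interior Ω) ∪ frontier Ω := by
    rintro x ⟨hx, hx'⟩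
    by_cases h : x ∈ interior Ω
    · exact Or.inl ⟨hx, h⟩
    · exact Or.inr ⟨subset_closure hx', h⟩
  calc volume (S ∩ Ω) ≤ volume ((S ∩ interior Ω) ∪ frontier Ω) := measure_mono h
    _ ≤ volume (S ∩ interior Ω) + volume (frontier Ω) := measure_union_le _ _
    _ = _ := by rw [hΩ.addHaar_frontier volume, add_zero]

/-- Almost every subgradient is the gradient at some point of the interior of the source. -/
theorem Alex.volume_sub_diff_eq_zero {w : E → ℝ} (hw : ConvexOn ℝ univ w) {Ω Ω' : Set E}
    (hΩ : Convex ℝ Ω) (h : Alex w Ω) (hg : ∀ x ∈ Ω, gradient w x ∈ Ω') :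
    volume ({p | ∃ x, IsSub w x p} \ Ω') = 0 := by
  set N : Set E := {x | ¬DifferentiableAt ℝ w x} with hN
  have hNm : MeasurableSet N := (measurableSet_of_differentiableAt ℝ w).compl
  have h1 := h N hNm
  have h2 := h (interior Ω)ᶜ isOpen_interior.measurableSet.compl
  rw [measure_mono_null inter_subset_left hw.volume_not_differentiableAt] at h1
  rw [← hΩ.volume_inter_interior, compl_inter_self, measure_empty] at h2
  refine measure_mono_null ?_ (measure_union_null h1 h2)
  rintro p ⟨⟨x, hx⟩, hp⟩
  by_cases hxN : x ∈ N
  · exact Or.inl (mem_iUnion₂.2 ⟨x, hxN, hx⟩)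
  · refine Or.inr (mem_iUnion₂.2 ⟨x, fun hxi => hp ?_, hx⟩)
    rw [hx.eq_gradient (not_not.1 hxN)]
    exact hg x (interior_subset hxi)

/-- The subgradients of a transport potential lie in the closure of the target. -/
theorem Alex.isSub_mem_closure {w w' : E → ℝ} (hw : ConvexOn ℝ univ w) (hw' : ConvexOn ℝ univ w')
    {Ω Ω' : Set E} (hΩ : Convex ℝ Ω) (h : Alex w Ω) (hg : ∀ x ∈ Ω, gradient w x ∈ Ω')
    (hne : (interior Ω').Nonempty) (hY : ∀ y ∈ Ω', ∀ x, ⟪x, y⟫ ≤ w x + w' y) {x p : E}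
    (hp : IsSub w x p) : p ∈ closure Ω' := by
  by_contra hpc
  obtain ⟨y0, hy0⟩ := hne
  obtain ⟨r, hr, hball⟩ := Metric.isOpen_iff.1 isOpen_interior y0 hy0
  obtain ⟨ρ, hρ, hball'⟩ := Metric.isOpen_iff.1 isClosed_closure.isOpen_compl p hpc
  set l := min 1 (ρ / (2 * (‖y0 - p‖ + r))) with hl
  have hl0 : 0 < l := by positivity
  have hlr : l * (‖y0 - p‖ + r) < ρ := by
    have h1 : l ≤ ρ / (2 * (‖y0 - p‖ + r)) := min_le_right _ _
    have h2 : 0 < ‖y0 - p‖ + r := by positivity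
    rw [le_div_iff₀ (by positivity)] at h1
    nlinarith
  have hz := h.volume_sub_diff_eq_zero hw hΩ hg
  have hsub : ball (p + l • (y0 - p)) (l * (r / 2)) ⊆ {p | ∃ x, IsSub w x p} \ Ω' := by
    intro q hq
    set y := p + l⁻¹ • (q - p) with hy
    have hqy : q = p + l • (y - p) := by
      rw [hy, add_sub_cancel_left, smul_smul, mul_inv_cancel₀ hl0.ne', one_smul]; abel
    have hyy : l • (y - y0) = q - (p + l • (y0 - p)) := by
      rw [hqy]; module
    have hyb : y ∈ ball y0 (r / 2) := by
      rw [mem_ball, dist_eq_norm] at hq ⊢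
      rw [← hyy, norm_smul, Real.norm_eq_abs, abs_of_pos hl0] at hq
      exact lt_of_mul_lt_mul_left hq hl0.le
    refine ⟨?_, fun hqΩ => ?_⟩
    · obtain ⟨x', hx'⟩ := exists_isSub_of_segment hw hw' hp hr
        (fun y hy => hY y (interior_subset (hball hy))) hyb hl0 (min_le_left _ _)
      exact ⟨x', hqy ▸ hx'⟩
    · refine hball' (mem_ball.2 ?_) (subset_closure hqΩ)
      have h1 : ‖y - p‖ ≤ ‖y0 - p‖ + r := by
        rw [mem_ball, dist_eq_norm] at hyb
        have := norm_add_le (y - y0) (y0 - p)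
        rw [sub_add_sub_cancel] at this
        linarith
      rw [dist_eq_norm, hqy, add_sub_cancel_left, norm_smul, Real.norm_eq_abs, abs_of_pos hl0]
      exact (mul_le_mul_of_nonneg_left h1 hl0.le).trans_lt hlr
  have h0 := measure_mono_null hsub hz
  have hpos := measure_ball_pos (volume : Measure E) (p + l • (y0 - p))
    (show 0 < l * (r / 2) by positivity)
  exact hpos.ne' h0

end Potentials

/-- Conjugate transport potentials between open convex sets having the origin on their
boundary. -/
structure DualPair {E : Type*} [NormedAddCommGroup E] [InnerProductSpace ℝ E] [MeasureSpace E]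
    (u v : E → ℝ) (A B : Set E) : Prop where
  convexOn : ConvexOn ℝ univ u
  convexOn' : ConvexOn ℝ univ v
  isOpen : IsOpen A
  isOpen' : IsOpen B
  convex : Convex ℝ A
  convex' : Convex ℝ B
  zero_mem : (0 : E) ∈ closure A
  zero_mem' : (0 : E) ∈ closure B
  zero_notMem : (0 : E) ∉ A
  zero_notMem' : (0 : E) ∉ B
  alex : Alex u A
  alex' : Alex v B
  nonneg : ∀ x, 0 ≤ u x
  nonneg' : ∀ y, 0 ≤ v y
  map_zero : u 0 = 0
  map_zero' : v 0 = 0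
  mem : ∀ {x y}, IsSub u x y → y ∈ closure B
  mem' : ∀ {y x}, IsSub v y x → x ∈ closure A
  young : ∀ (x : E) {y}, y ∈ closure B → ⟪x, y⟫ ≤ u x + v y
  young' : ∀ {x} (y : E), x ∈ closure A → ⟪x, y⟫ ≤ u x + v y
  eq : ∀ {x y}, IsSub u x y → u x + v y = ⟪x, y⟫
  eq' : ∀ {y x}, IsSub v y x → u x + v y = ⟪x, y⟫

namespace DualPair

section

variable {E : Type*} [NormedAddCommGroup E] [InnerProductSpace ℝ E] [MeasureSpace E]
  {u v : E → ℝ} {A B : Set E}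

theorem symm (h : DualPair u v A B) : DualPair v u B A where
  convexOn := h.convexOn'
  convexOn' := h.convexOn
  isOpen := h.isOpen'
  isOpen' := h.isOpen
  convex := h.convex'
  convex' := h.convex
  zero_mem := h.zero_mem'
  zero_mem' := h.zero_mem
  zero_notMem := h.zero_notMem'
  zero_notMem' := h.zero_notMem
  alex := h.alex'
  alex' := h.alex
  nonneg := h.nonneg'
  nonneg' := h.nonneg
  map_zero := h.map_zero'
  map_zero' := h.map_zero
  mem := h.mem'
  mem' := h.mem
  young y x hx := by rw [real_inner_comm, add_comm]; exact h.young' y hx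
  young' x hy := by rw [real_inner_comm, add_comm]; exact h.young x hy
  eq hs := by rw [real_inner_comm, add_comm]; exact h.eq' hs
  eq' hs := by rw [real_inner_comm, add_comm]; exact h.eq hs

theorem isSub_of_eq (h : DualPair u v A B) {x y : E} (hy : y ∈ closure B)
    (he : u x + v y = ⟪x, y⟫) : IsSub u x y := by
  intro x'
  have := h.young x' hy
  rw [inner_sub_right, real_inner_comm x' y, real_inner_comm x y]
  linarith

theorem isSub_symm (h : DualPair u v A B) {x y : E} (hx : x ∈ closure A) (hs : IsSub u x y) :
    IsSub v y x :=
  h.symm.isSub_of_eq hx (by rw [add_comm, h.eq hs, real_inner_comm])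

/-- Subgradients persist along outer normals of the target. -/
theorem isSub_add_normal [FiniteDimensional ℝ E] (h : DualPair u v A B) {x y m : E}
    (hs : IsSub u x y) (hm : ∀ y' ∈ B, ⟪m, y'⟫ ≤ ⟪m, y⟫) {t : ℝ} (ht : 0 ≤ t) :
    IsSub u (x + t • m) y := by
  obtain ⟨y', hy'⟩ := exists_isSub h.convexOn (x + t • m)
  have h1 : ⟪m, y'⟫ ≤ ⟪m, y⟫ := by
    have hcl : IsClosed {y' : E | ⟪m, y'⟫ ≤ ⟪m, y⟫} := isClosed_le (by fun_prop) (by fun_prop)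
    exact closure_minimal (fun y' hy' => hm y' hy') hcl (h.mem hy')
  apply hs.of_value_le
  have h2 := hy' x
  rw [sub_add_cancel_left, inner_neg_right, inner_smul_right, real_inner_comm] at h2
  rw [add_sub_cancel_left, inner_smul_right, real_inner_comm]
  nlinarith

end

/-- Change of variables by a rescaled isometry. -/
theorem comp_sc {F : Type*} [NormedAddCommGroup F] [InnerProductSpace ℝ F]
    [FiniteDimensional ℝ F] [MeasurableSpace F] [BorelSpace F] {u v : F → ℝ} {A B : Set F}
    (h : DualPair u v A B) {L l : ℝ} (hL : 0 < L) (hl : 0 < l) (J : ℂ ≃ₗᵢ[ℝ] F) :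
    DualPair (fun a => u (sc L l J a) / (L * l)) (fun a => v (sc l L J a) / (l * L))
      (sc L l J ⁻¹' A) (sc l L J ⁻¹' B) where
  convexOn := convexOn_sc h.convexOn hL hl
  convexOn' := convexOn_sc h.convexOn' hl hL
  isOpen := h.isOpen.preimage continuous_sc
  isOpen' := h.isOpen'.preimage continuous_sc
  convex := h.convex.linear_preimage (scLin L l J)
  convex' := h.convex'.linear_preimage (scLin l L J)
  zero_mem := by
    rw [← preimage_closure_sc hL hl, mem_preimage, sc_zero]; exact h.zero_mem
  zero_mem' := by
    rw [← preimage_closure_sc hl hL, mem_preimage, sc_zero]; exact h.zero_mem'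
  zero_notMem := by rw [mem_preimage, sc_zero]; exact h.zero_notMem
  zero_notMem' := by rw [mem_preimage, sc_zero]; exact h.zero_notMem'
  alex := h.alex.comp_sc hL hl J
  alex' := h.alex'.comp_sc hl hL J
  nonneg x := div_nonneg (h.nonneg _) (by positivity)
  nonneg' x := div_nonneg (h.nonneg' _) (by positivity)
  map_zero := by rw [sc_zero, h.map_zero, zero_div]
  map_zero' := by rw [sc_zero, h.map_zero', zero_div]
  mem hs := by
    rw [← preimage_closure_sc hl hL]; exact h.mem ((isSub_sc hL hl).1 hs)
  mem' hs := by
    rw [← preimage_closure_sc hL hl]; exact h.mem' ((isSub_sc hl hL).1 hs)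
  young x y hy := by
    rw [← preimage_closure_sc hl hL] at hy
    have := h.young (sc L l J x) hy
    rw [inner_sc_sc, ← cinner] at this
    rw [mul_comm l L, ← add_div, le_div_iff₀ (by positivity)]
    linarith
  young' {x} y hx := by
    rw [← preimage_closure_sc hL hl] at hx
    have := h.young' (sc l L J y) hx
    rw [inner_sc_sc, ← cinner] at this
    rw [mul_comm l L, ← add_div, le_div_iff₀ (by positivity)]
    linarith
  eq {x y} hs := by
    have := h.eq ((isSub_sc hL hl).1 hs)
    rw [inner_sc_sc, ← cinner] at this
    rw [mul_comm l L, ← add_div, div_eq_iff (by positivity)]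
    linarith
  eq' {y x} hs := by
    have := h.eq' ((isSub_sc hl hL).1 hs)
    rw [inner_sc_sc, ← cinner] at this
    rw [mul_comm l L, ← add_div, div_eq_iff (by positivity)]
    linarith

/-- Transport potentials that are conjugate on the target form a dual pair. -/
theorem of_transport {E : Type*} [NormedAddCommGroup E] [InnerProductSpace ℝ E]
    [FiniteDimensional ℝ E] [MeasurableSpace E] [BorelSpace E] {u v : E → ℝ} {Ω₁ Ω₂ : Set E}
    (hu : ConvexOn ℝ univ u) (hv : ConvexOn ℝ univ v) (h₁ : Convex ℝ Ω₁) (h₂ : Convex ℝ Ω₂)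
    (hi₁ : (interior Ω₁).Nonempty) (hi₂ : (interior Ω₂).Nonempty) (h0₁ : (0 : E) ∈ frontier Ω₁)
    (h0₂ : (0 : E) ∈ frontier Ω₂) (hg₁ : gradient u '' Ω₁ = Ω₂) (hg₂ : gradient v '' Ω₂ = Ω₁)
    (hA₁ : Alex u Ω₁) (hu0 : u 0 = 0) (hus : IsSub u 0 0) (hA₂ : Alex v Ω₂) (hv0 : v 0 = 0)
    (hvs : IsSub v 0 0) (hL : ∀ y ∈ Ω₂, v y = ⨆ x, (⟪x, y⟫ - u x)) :
    DualPair u v (interior Ω₁) (interior Ω₂) := by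
  have hcu := hu.continuous_of_univ
  have hcv := hv.continuous_of_univ
  have hc₁ := h₁.closure_interior_eq_closure_of_nonempty_interior hi₁
  have hc₂ := h₂.closure_interior_eq_closure_of_nonempty_interior hi₂
  have hsub : ∀ y ∈ Ω₂, ∃ x, IsSub u x y := by
    intro y hy
    rw [← hg₁] at hy
    obtain ⟨x, -, rfl⟩ := hy
    by_cases hd : DifferentiableAt ℝ u x
    · exact ⟨x, isSub_gradient hu hd⟩
    · have : gradient u x = 0 := by rw [gradient, fderiv_zero_of_not_differentiableAt hd, _root_.map_zero]
      exact ⟨0, this ▸ hus⟩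
  have hle : ∀ {x y : E}, IsSub u x y → ∀ x', ⟪x', y⟫ - u x' ≤ ⟪x, y⟫ - u x := by
    intro x y hs x'
    have := hs x'
    rw [inner_sub_right, real_inner_comm x' y, real_inner_comm x y] at this
    linarith
  have hY : ∀ y ∈ Ω₂, ∀ x, ⟪x, y⟫ ≤ u x + v y := by
    intro y hy x
    obtain ⟨x0, hx0⟩ := hsub y hy
    have hb : BddAbove (range fun x => ⟪x, y⟫ - u x) :=
      ⟨_, by rintro _ ⟨x', rfl⟩; exact hle hx0 x'⟩
    have := le_ciSup hb x
    rw [← hL y hy] at this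
    linarith
  have hYc : ∀ x, ∀ y ∈ closure Ω₂, ⟪x, y⟫ ≤ u x + v y := by
    intro x y hy
    exact closure_minimal (fun y hy => hY y hy x)
      (isClosed_le (f := fun y => ⟪x, y⟫) (g := fun y => u x + v y) (by fun_prop) (by fun_prop)) hy
  have hmem : ∀ {x y}, IsSub u x y → y ∈ closure Ω₂ := fun hs =>
    hA₁.isSub_mem_closure hu hv h₁ (fun x hx => hg₁ ▸ mem_image_of_mem _ hx) hi₂ hY hs
  have heq : ∀ {x y}, IsSub u x y → u x + v y = ⟪x, y⟫ := by
    intro x y hs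
    refine le_antisymm ?_ (hYc x y (hmem hs))
    obtain ⟨y0, hy0⟩ := hi₂
    have hev : ∀ t ∈ Ioc (0 : ℝ) 1, v (y + t • (y0 - y)) ≤
        (1 - t) * (⟪x, y⟫ - u x) + t * v y0 := by
      intro t ht
      have hin : y + t • (y0 - y) ∈ Ω₂ := by
        have := h₂.add_smul_sub_mem_interior' (hmem hs) hy0 ht
        exact interior_subset this
      rw [hL _ hin]
      refine ciSup_le fun x' => ?_
      have h1 := hle hs x'
      have h2 := hY y0 (interior_subset hy0) x'
      have h3 : ⟪x', y + t • (y0 - y)⟫ = (1 - t) * ⟪x', y⟫ + t * ⟪x', y0⟫ := by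
        rw [inner_add_right, inner_smul_right, inner_sub_right]; ring
      rw [h3]
      nlinarith [ht.1, ht.2]
    have hlim : Filter.Tendsto (fun t : ℝ => v (y + t • (y0 - y))) (nhdsWithin 0 (Ioi 0))
        (nhds (v y)) := by
      have : Continuous fun t : ℝ => v (y + t • (y0 - y)) := by fun_prop
      have h1 := this.tendsto 0
      simp only [zero_smul, add_zero] at h1
      exact h1.mono_left nhdsWithin_le_nhds
    have hlim2 : Filter.Tendsto (fun t : ℝ => (1 - t) * (⟪x, y⟫ - u x) + t * v y0)
        (nhdsWithin 0 (Ioi 0)) (nhds (⟪x, y⟫ - u x)) := by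
      have : Continuous fun t : ℝ => (1 - t) * (⟪x, y⟫ - u x) + t * v y0 := by fun_prop
      have h1 := this.tendsto 0
      simp only [sub_zero, one_mul, zero_mul, add_zero] at h1
      exact h1.mono_left nhdsWithin_le_nhds
    have := le_of_tendsto_of_tendsto hlim hlim2 (by
      filter_upwards [Ioc_mem_nhdsGT (zero_lt_one' ℝ)] with t ht using hev t ht)
    linarith
  have hY' : ∀ y, ∀ x ∈ closure Ω₁, ⟪x, y⟫ ≤ u x + v y := by
    intro y
    set N : Set E := {x | ¬DifferentiableAt ℝ u x} with hN
    set T : Set E := Nᶜ ∩ gradient u ⁻¹' frontier Ω₂ with hT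
    have hTm : MeasurableSet T := (measurableSet_of_differentiableAt ℝ u).compl.compl.inter
      (measurable_gradient u isClosed_frontier.measurableSet)
    have hT0 : volume (T ∩ Ω₁) = 0 := by
      rw [← hA₁ T hTm]
      refine measure_mono_null (iUnion₂_subset fun x hx p hp => ?_) (h₂.addHaar_frontier volume)
      rw [IsSub.eq_gradient hp (not_not.1 hx.1)]
      exact hx.2
    have hgood : ∀ x ∈ interior Ω₁, x ∉ N → x ∉ T → ⟪x, y⟫ ≤ u x + v y := by
      intro x hx hxN hxT
      have hd : DifferentiableAt ℝ u x := not_not.1 hxN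
      set y0 := gradient u x with hy0
      have hs : IsSub u x y0 := isSub_gradient hu hd
      have hyi : y0 ∈ interior Ω₂ := by
        by_contra hni
        exact hxT ⟨hxN, subset_closure (hg₁ ▸ mem_image_of_mem _ (interior_subset hx)), hni⟩
      have hmin : IsLocalMin (fun y' => v y' - ⟪x, y'⟫) y0 := by
        filter_upwards [isOpen_interior.mem_nhds hyi] with y' hy'
        have h1 := hY y' (interior_subset hy') x
        have h2 := heq hs
        linarith
      have hcx : ConvexOn ℝ univ (fun y' => v y' - ⟪x, y'⟫) :=
        hv.sub ((innerSL ℝ x).toLinearMap.concaveOn convex_univ)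
      have h1 := IsMinOn.of_isLocalMin_of_convex_univ hmin hcx y
      have h2 := heq hs
      linarith
    have hG : IsOpen (interior Ω₁ ∩ {x | u x + v y < ⟪x, y⟫}) :=
      isOpen_interior.inter (isOpen_lt (by fun_prop) (by fun_prop))
    have hG0 : volume (interior Ω₁ ∩ {x | u x + v y < ⟪x, y⟫}) = 0 := by
      refine measure_mono_null ?_ (measure_union_null hu.volume_not_differentiableAt hT0)
      rintro x ⟨hx, hx'⟩
      by_contra hcon
      simp only [mem_union, not_or] at hcon
      exact absurd (hgood x hx hcon.1 fun hxT => hcon.2 ⟨hxT, interior_subset hx⟩) (not_le.2 hx')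
    rw [hG.measure_eq_zero_iff volume] at hG0
    intro x hx
    rw [← hc₁] at hx
    refine closure_minimal (fun x hx => ?_)
      (isClosed_le (f := fun x => ⟪x, y⟫) (g := fun x => u x + v y) (by fun_prop) (by fun_prop)) hx
    by_contra hcon
    have hlt : u x + v y < ⟪x, y⟫ := not_le.1 hcon
    have hmem : x ∈ interior Ω₁ ∩ {x | u x + v y < ⟪x, y⟫} := ⟨hx, hlt⟩
    rw [hG0] at hmem
    exact hmem
  have hmem' : ∀ {y x}, IsSub v y x → x ∈ closure Ω₁ := fun hs =>
    hA₂.isSub_mem_closure hv hu h₂ (fun y hy => hg₂ ▸ mem_image_of_mem _ hy) hi₁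
      (fun x hx y => by rw [real_inner_comm, add_comm]; exact hY' y x (subset_closure hx)) hs
  have heq' : ∀ {y x}, IsSub v y x → u x + v y = ⟪x, y⟫ := by
    intro y x hs
    refine le_antisymm ?_ (hY' y x (hmem' hs))
    obtain ⟨x0, hx0⟩ := hi₁
    have hev : ∀ t ∈ Ioc (0 : ℝ) 1, u (x + t • (x0 - x)) ≤
        (1 - t) * (⟪x, y⟫ - v y) + t * u x0 := by
      intro t ht
      obtain ⟨y', hy'⟩ := exists_isSub hu (x + t • (x0 - x))
      have h0 := heq hy'
      have h1 := hs y'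
      have h2 := hY' y' x0 (subset_closure (interior_subset hx0))
      have h3 : ⟪x + t • (x0 - x), y'⟫ = (1 - t) * ⟪x, y'⟫ + t * ⟪x0, y'⟫ := by
        rw [inner_add_left, inner_smul_left, inner_sub_left]; simp; ring
      rw [inner_sub_right] at h1
      rw [h3] at h0
      nlinarith [ht.1, ht.2]
    have hlim : Filter.Tendsto (fun t : ℝ => u (x + t • (x0 - x))) (nhdsWithin 0 (Ioi 0))
        (nhds (u x)) := by
      have : Continuous fun t : ℝ => u (x + t • (x0 - x)) := by fun_prop
      have h1 := this.tendsto 0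
      simp only [zero_smul, add_zero] at h1
      exact h1.mono_left nhdsWithin_le_nhds
    have hlim2 : Filter.Tendsto (fun t : ℝ => (1 - t) * (⟪x, y⟫ - v y) + t * u x0)
        (nhdsWithin 0 (Ioi 0)) (nhds (⟪x, y⟫ - v y)) := by
      have : Continuous fun t : ℝ => (1 - t) * (⟪x, y⟫ - v y) + t * u x0 := by fun_prop
      have h1 := this.tendsto 0
      simp only [sub_zero, one_mul, zero_mul, add_zero] at h1
      exact h1.mono_left nhdsWithin_le_nhds
    have := le_of_tendsto_of_tendsto hlim hlim2 (by
      filter_upwards [Ioc_mem_nhdsGT (zero_lt_one' ℝ)] with t ht using hev t ht)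
    linarith
  exact
    { convexOn := hu
      convexOn' := hv
      isOpen := isOpen_interior
      isOpen' := isOpen_interior
      convex := h₁.interior
      convex' := h₂.interior
      zero_mem := hc₁ ▸ h0₁.1
      zero_mem' := hc₂ ▸ h0₂.1
      zero_notMem := h0₁.2
      zero_notMem' := h0₂.2
      alex := fun S hS => (hA₁ S hS).trans (h₁.volume_inter_interior S).symm
      alex' := fun S hS => (hA₂ S hS).trans (h₂.volume_inter_interior S).symm
      nonneg := fun x => by simpa [hu0] using hus x
      nonneg' := fun y => by simpa [hv0] using hvs y
      map_zero := hu0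
      map_zero' := hv0
      mem := fun hs => by rw [hc₂]; exact hmem hs
      mem' := fun hs => by rw [hc₁]; exact hmem' hs
      young := fun x y hy => hYc x y (hc₂ ▸ hy)
      young' := fun y hx => hY' y _ (hc₁ ▸ hx)
      eq := heq
      eq' := heq' }

end DualPair

/-- Normalized potentials grow at least linearly away from the origin. -/
theorem linear_growth {κ ρ : ℝ} (hκ : 0 < κ) (hκ1 : κ ≤ 1) (hρ : 0 < ρ) :
    ∃ φ : ℝ, 0 < φ ∧ ∀ (U : ℂ → ℝ) (A : Set ℂ), Normalized κ U A →
      ∀ x ∈ closure A, ρ ≤ ‖x‖ → φ * ‖x‖ ≤ U x := by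
  obtain ⟨φ, hφ, h⟩ := strict_convexity hκ hκ1 hρ
  refine ⟨φ / ρ, by positivity, fun U A hU x hx hxρ => ?_⟩
  have hx0 : 0 < ‖x‖ := hρ.trans_le hxρ
  have h0 : (0 : ℝ) ≤ 1 - ρ / ‖x‖ := by rw [sub_nonneg, div_le_one hx0]; exact hxρ
  have h0' : (0 : ℝ) ≤ ρ / ‖x‖ := by positivity
  have h1 := hU.convex.closure hU.zero_mem hx h0 h0' (by ring)
  have h2 := hU.convexOn.2 (mem_univ 0) (mem_univ x) h0 h0' (by ring)
  simp only [smul_zero, zero_add, hU.zero, smul_eq_mul, mul_zero] at h1 h2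
  have h3 := h U A hU _ h1 (by
    rw [norm_smul, Real.norm_eq_abs, abs_of_nonneg h0', div_mul_cancel₀ _ hx0.ne'])
  have h4 := h3.trans h2
  rw [div_mul_eq_mul_div, div_le_iff₀ hρ]
  rw [div_mul_eq_mul_div, le_div_iff₀ hx0] at h4
  linarith

section Scales

variable {F : Type*} [NormedAddCommGroup F] [InnerProductSpace ℝ F]

/-- The section of `u` of height about `L l` is comparable to the ellipse with half-axes
`L`, `l` in the frame `J`. -/
def NormalizedAt (κ : ℝ) (u : F → ℝ) (A : Set F) (L l : ℝ) (J : ℂ ≃ₗᵢ[ℝ] F) : Prop :=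
  0 < L ∧ 0 < l ∧ Normalized κ (fun a => u (sc L l J a) / (L * l)) (sc L l J ⁻¹' A)

variable {κ : ℝ} {u v : F → ℝ} {A B : Set F} {L l L' l' : ℝ} {J J' : ℂ ≃ₗᵢ[ℝ] F}

namespace NormalizedAt

theorem growth (h : NormalizedAt κ u A L l J) {ρ φ : ℝ}
    (hφ : ∀ (U : ℂ → ℝ) (A : Set ℂ), Normalized κ U A →
      ∀ x ∈ closure A, ρ ≤ ‖x‖ → φ * ‖x‖ ≤ U x) {x : F} (hx : x ∈ closure A)
    (hρ : ρ ≤ ‖usc L l J x‖) : φ * ‖usc L l J x‖ * (L * l) ≤ u x := by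
  obtain ⟨hL, hl, hN⟩ := h
  have h1 := hφ _ _ hN (usc L l J x) (by
    rw [← preimage_closure_sc hL hl, mem_preimage, sc_usc hL hl]; exact hx) hρ
  rwa [sc_usc hL hl, le_div_iff₀ (by positivity)] at h1

theorem bound (h : NormalizedAt κ u A L l J) {x : F} (hx : ‖usc L l J x‖ ≤ 1) :
    u x ≤ L * l / κ := by
  obtain ⟨hL, hl, hN⟩ := h
  have h1 := hN.bound _ hx
  rw [sc_usc hL hl, div_le_iff₀ (by positivity)] at h1
  calc u x ≤ _ := h1
    _ = _ := by ring

/-- Comparison of the norms attached to two heights. -/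
theorem norm_usc_le (hκ : 0 < κ) (hκ1 : κ ≤ 1) (h : NormalizedAt κ u A L l J)
    {ρ : ℝ} (hu : ∀ x ∈ A, ρ ≤ ‖usc L' l' J' x‖ → L * l / κ < u x) (w : F) :
    ‖usc L' l' J' w‖ ≤ 4 * ρ / κ * ‖usc L l J w‖ := by
  obtain ⟨hL, hl, hN⟩ := id h
  obtain ⟨a, ha, hball⟩ := hN.ball
  have key : ∀ b : ℂ, ‖b‖ ≤ κ / 2 → ‖usc L' l' J' (sc L l J (a + b))‖ ≤ ρ := by
    intro b hb
    by_contra hcon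
    have hm : a + b ∈ ball a κ := by
      rw [mem_ball, dist_eq_norm, add_sub_cancel_left]; linarith
    refine absurd (hu _ (hball hm) (not_le.1 hcon).le) (not_lt.2 (h.bound ?_))
    rw [usc_sc hL hl]
    have := norm_add_le a b
    linarith
  have key2 : ∀ b : ℂ, ‖b‖ ≤ κ / 2 → ‖usc L' l' J' (sc L l J b)‖ ≤ 2 * ρ := by
    intro b hb
    have h1 := key b hb
    have h2 := key 0 (by simp; positivity)
    have h3 : usc L' l' J' (sc L l J b) =
        usc L' l' J' (sc L l J (a + b)) - usc L' l' J' (sc L l J (a + 0)) := by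
      rw [← usc_sub, ← sc_sub]; simp
    rw [h3]
    have := norm_sub_le (usc L' l' J' (sc L l J (a + b))) (usc L' l' J' (sc L l J (a + 0)))
    linarith
  set b := usc L l J w with hb
  have hw : w = sc L l J b := (sc_usc hL hl w).symm
  by_cases hb0 : b = 0
  · rw [hw, hb0, sc_zero, usc_zero]; simp
  have hbp : 0 < ‖b‖ := norm_pos_iff.2 hb0
  have h1 := key2 ((κ / 2 / ‖b‖) • b) (by
    rw [norm_smul, Real.norm_eq_abs, abs_of_pos (by positivity), div_mul_cancel₀ _ hbp.ne'])
  rw [sc_smul, ← hw, usc_smul, norm_smul, Real.norm_eq_abs, abs_of_pos (by positivity),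
    div_mul_eq_mul_div, div_le_iff₀ hbp] at h1
  rw [div_mul_eq_mul_div, le_div_iff₀ hκ]
  linarith

end NormalizedAt

/-- Both members of a dual pair are normalized by the frame `J` and dual half-axes. -/
structure Scale (κ : ℝ) (u v : F → ℝ) (A B : Set F) (L l : ℝ) (J : ℂ ≃ₗᵢ[ℝ] F) : Prop where
  le : l ≤ L
  fst : NormalizedAt κ u A L l J
  snd : NormalizedAt κ v B l L J

theorem Scale.pos (h : Scale κ u v A B L l J) : 0 < L := h.fst.1

theorem Scale.pos' (h : Scale κ u v A B L l J) : 0 < l := h.fst.2.1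

/-- Comparison of the norms attached to two scales. -/
def ScaleLE (c : ℝ) (L l : ℝ) (J : ℂ ≃ₗᵢ[ℝ] F) (L' l' : ℝ) (J' : ℂ ≃ₗᵢ[ℝ] F) : Prop :=
  ∀ w : F, ‖usc L' l' J' w‖ ≤ c * ‖usc L l J w‖ ∧ ‖usc l' L' J' w‖ ≤ c * ‖usc l L J w‖ ∧
    L * l * ‖usc L l J w‖ ≤ c * (L' * l') * ‖usc L' l' J' w‖ ∧
    L * l * ‖usc l L J w‖ ≤ c * (L' * l') * ‖usc l' L' J' w‖

theorem norm_usc_le_of_dual (hL : 0 < L) (hl : 0 < l) (hL' : 0 < L') (hl' : 0 < l') {c : ℝ}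
    (h : ∀ w, ‖usc l' L' J' w‖ ≤ c * ‖usc l L J w‖) (w : F) :
    L * l * ‖usc L l J w‖ ≤ c * (L' * l') * ‖usc L' l' J' w‖ := by
  set y := sc l L J (usc L l J w) with hy
  have h1 := inner_le_usc hL' hl' J' w y
  have h2 : ⟪w, y⟫ = L * l * (‖usc L l J w‖ * ‖usc L l J w‖) := by
    rw [inner_eq_usc hL hl J, hy, usc_sc hl hL, real_inner_self_eq_norm_mul_norm]
  have h3 := h y
  rw [hy, usc_sc hl hL, ← hy] at h3
  by_cases h0 : ‖usc L l J w‖ = 0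
  · rw [h0] at h3 ⊢
    simp only [mul_zero] at h3 ⊢
    have hc : 0 ≤ c := by
      by_contra hc
      have h4 := h (sc l L J 1)
      rw [usc_sc hl hL, norm_one] at h4
      have := norm_nonneg (usc l' L' J' (sc l L J 1))
      linarith
    positivity
  have h0' : 0 < ‖usc L l J w‖ := lt_of_le_of_ne (norm_nonneg _) (Ne.symm h0)
  have h4 : L' * l' * (‖usc L' l' J' w‖ * ‖usc l' L' J' y‖) ≤
      L' * l' * (‖usc L' l' J' w‖ * (c * ‖usc L l J w‖)) := by gcongr
  rw [h2] at h1
  have h5 := h1.trans h4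
  refine le_of_mul_le_mul_right ?_ h0'
  linarith

theorem scaleLE_of_dual (hL : 0 < L) (hl : 0 < l) (hL' : 0 < L') (hl' : 0 < l') {c : ℝ}
    (h : ∀ w, ‖usc L' l' J' w‖ ≤ c * ‖usc L l J w‖)
    (h' : ∀ w, ‖usc l' L' J' w‖ ≤ c * ‖usc l L J w‖) : ScaleLE c L l J L' l' J' := fun w =>
  ⟨h w, h' w, norm_usc_le_of_dual hL hl hL' hl' h' w, by
    have := norm_usc_le_of_dual hl hL hl' hL' h w
    rwa [mul_comm l L, mul_comm l' L'] at this⟩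

theorem norm_le_mul_norm_usc (hL : 0 < L) (hl : 0 < l) (h : l ≤ L) (w : F) :
    ‖w‖ ≤ L * ‖usc L l J w‖ := by
  rw [← sc_usc (J := J) hL hl w, usc_sc hL hl, sc, J.norm_map]
  set a := usc L l J w
  rw [Complex.norm_eq_sqrt_sq_add_sq, Complex.norm_eq_sqrt_sq_add_sq]
  apply Real.sqrt_le_iff.2
  refine ⟨by positivity, ?_⟩
  simp only [mul_pow]
  rw [Real.sq_sqrt (by positivity)]
  have : l ^ 2 ≤ L ^ 2 := by gcongr
  nlinarith [sq_nonneg a.im]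

theorem Scale.le_of_scaleLE (h : Scale κ u v A B L l J) (h' : Scale κ u v A B L' l' J') {c : ℝ}
    (hc : ScaleLE c L l J L' l' J') : L ≤ c * L' ∧ l ≤ c * l' := by
  have hL := h.pos; have hl := h.pos'; have hL' := h'.pos; have hl' := h'.pos'
  constructor
  · obtain ⟨h1, -⟩ := hc (sc L l J 1)
    have h2 := norm_le_mul_norm_usc (J := J') hL' hl' h'.le (sc L l J 1)
    have h3 : ‖sc L l J 1‖ = L := by
      rw [sc, J.norm_map, show (⟨L * (1 : ℂ).re, l * (1 : ℂ).im⟩ : ℂ) = (L : ℂ) by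
        apply Complex.ext <;> simp]
      simp [abs_of_pos hL]
    rw [usc_sc hL hl, norm_one, mul_one] at h1
    rw [h3] at h2
    nlinarith
  · obtain ⟨-, -, h1, -⟩ := hc (sc L' l' J' 1)
    have h2 := norm_le_mul_norm_usc (J := J) hL hl h.le (sc L' l' J' 1)
    have h3 : ‖sc L' l' J' 1‖ = L' := by
      rw [sc, J'.norm_map, show (⟨L' * (1 : ℂ).re, l' * (1 : ℂ).im⟩ : ℂ) = (L' : ℂ) by
        apply Complex.ext <;> simp]
      simp [abs_of_pos hL']
    rw [usc_sc hL' hl', norm_one, mul_one] at h1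
    rw [h3] at h2
    have h4 : l * L' ≤ c * l' * L' := by nlinarith
    exact le_of_mul_le_mul_right h4 hL'

theorem Scale.exists_scaleLE (hκ : 0 < κ) (hκ1 : κ ≤ 1) :
    ∃ C : ℝ, 1 ≤ C ∧ ∀ (F : Type) [NormedAddCommGroup F] [InnerProductSpace ℝ F]
      (u v : F → ℝ) (A B : Set F) (L l L' l' : ℝ) (J J' : ℂ ≃ₗᵢ[ℝ] F),
      Scale κ u v A B L l J → Scale κ u v A B L' l' J' → L * l ≤ L' * l' →
      ScaleLE C L l J L' l' J' := by
  obtain ⟨φ, hφ, hg⟩ := linear_growth hκ hκ1 one_pos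
  set ρ := max 1 (2 / (κ * φ)) with hρ
  have hρ1 : 1 ≤ ρ := le_max_left _ _
  have hρ2 : 2 / (κ * φ) ≤ ρ := le_max_right _ _
  rw [div_le_iff₀ (by positivity)] at hρ2
  have key : ∀ (F : Type) [NormedAddCommGroup F] [InnerProductSpace ℝ F]
      (u : F → ℝ) (A : Set F) (L l L' l' : ℝ) (J J' : ℂ ≃ₗᵢ[ℝ] F),
      NormalizedAt κ u A L l J → NormalizedAt κ u A L' l' J' → L * l ≤ L' * l' →
      ∀ w, ‖usc L' l' J' w‖ ≤ 4 * ρ / κ * ‖usc L l J w‖ := by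
    intro F _ _ u A L l L' l' J J' h h' hle w
    refine h.norm_usc_le hκ hκ1 (fun x hx hxρ => ?_) w
    have h1 := h'.growth hg (subset_closure hx) (hρ1.trans hxρ)
    have hLl' : 0 < L' * l' := mul_pos h'.1 h'.2.1
    refine lt_of_lt_of_le ?_ h1
    rw [div_lt_iff₀ hκ]
    have h2 : φ * ρ * κ * (L' * l') ≤ φ * ‖usc L' l' J' x‖ * (L' * l') * κ := by
      have : φ * ρ ≤ φ * ‖usc L' l' J' x‖ := by gcongr
      nlinarith [mul_pos hκ hLl']
    nlinarith
  refine ⟨4 * ρ / κ, ?_, fun F _ _ u v A B L l L' l' J J' h h' hle => ?_⟩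
  · rw [le_div_iff₀ hκ]; linarith
  · exact scaleLE_of_dual h.pos h.pos' h'.pos h'.pos' (key F u A L l L' l' J J' h.fst h'.fst hle)
      (key F v B l L l' L' J J' h.snd h'.snd (by rwa [mul_comm l, mul_comm l']))

theorem Scale.exists_scaleLE_small (hκ : 0 < κ) (hκ1 : κ ≤ 1) {c : ℝ} (hc : 0 < c) :
    ∃ lam : ℝ, 1 ≤ lam ∧ ∀ (F : Type) [NormedAddCommGroup F] [InnerProductSpace ℝ F]
      (u v : F → ℝ) (A B : Set F) (L l L' l' : ℝ) (J J' : ℂ ≃ₗᵢ[ℝ] F),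
      Scale κ u v A B L l J → Scale κ u v A B L' l' J' → lam * (L * l) ≤ L' * l' →
      ScaleLE c L l J L' l' J' := by
  set ρ := c * κ / 4 with hρ
  have hρ0 : 0 < ρ := by positivity
  have hρc : 4 * ρ / κ = c := by rw [hρ]; field_simp
  obtain ⟨φ, hφ, hg⟩ := linear_growth hκ hκ1 hρ0
  set lam := max 1 (2 / (κ * φ * ρ)) with hlam
  have hl2 : 2 / (κ * φ * ρ) ≤ lam := le_max_right _ _
  rw [div_le_iff₀ (by positivity)] at hl2
  have key : ∀ (F : Type) [NormedAddCommGroup F] [InnerProductSpace ℝ F]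
      (u : F → ℝ) (A : Set F) (L l L' l' : ℝ) (J J' : ℂ ≃ₗᵢ[ℝ] F),
      NormalizedAt κ u A L l J → NormalizedAt κ u A L' l' J' → lam * (L * l) ≤ L' * l' →
      ∀ w, ‖usc L' l' J' w‖ ≤ c * ‖usc L l J w‖ := by
    intro F _ _ u A L l L' l' J J' h h' hle w
    rw [← hρc]
    refine h.norm_usc_le hκ hκ1 (fun x hx hxρ => ?_) w
    have h1 := h'.growth hg (subset_closure hx) hxρ
    have hLl' : 0 < L' * l' := mul_pos h'.1 h'.2.1
    have hLl : 0 < L * l := mul_pos h.1 h.2.1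
    refine lt_of_lt_of_le ?_ h1
    rw [div_lt_iff₀ hκ]
    have h2 : φ * ρ * κ * (L' * l') ≤ φ * ‖usc L' l' J' x‖ * (L' * l') * κ := by
      have : φ * ρ ≤ φ * ‖usc L' l' J' x‖ := by gcongr
      nlinarith [mul_pos hκ hLl']
    have h3 : φ * ρ * κ * (lam * (L * l)) ≤ φ * ρ * κ * (L' * l') := by gcongr
    nlinarith
  refine ⟨lam, le_max_left _ _, fun F _ _ u v A B L l L' l' J J' h h' hle => ?_⟩
  exact scaleLE_of_dual h.pos h.pos' h'.pos h'.pos' (key F u A L l L' l' J J' h.fst h'.fst hle)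
    (key F v B l L l' L' J J' h.snd h'.snd (by rwa [mul_comm l, mul_comm l']))

end Scales

/-- A holomorphic function on an annular sector of opening `b - a` taking values in a sector of
opening `w` grows at most like the power `w / (b - a)` of the radius. -/
theorem growth_le_of_sector {z : ℂ → ℂ} {c : ℂ} {a₁ a₂ a b w Z₁ Z₂ : ℝ} (hc : ‖c‖ = 1)
    (ha : a₁ ≤ a₂) (hab : a ≤ b) (hw : w < 2 * Real.pi) (hZ₂ : 0 < Z₂)
    (hz : ∀ ω : ℂ, ω.re ∈ Icc a₁ a₂ → ω.im ∈ Icc a b → DifferentiableAt ℂ z (Complex.exp ω) ∧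
      z (Complex.exp ω) ≠ 0 ∧ |(c * z (Complex.exp ω)).arg| ≤ w / 2)
    (h₁ : ∀ ω : ℂ, ω.re = a₁ → ω.im ∈ Icc a b → ‖z (Complex.exp ω)‖ ≤ Z₁)
    (h₂ : ∀ ω : ℂ, ω.re = a₂ → ω.im ∈ Icc a b → Z₂ ≤ ‖z (Complex.exp ω)‖) :
    (b - a) * (Real.log Z₂ - Real.log Z₁) ≤ w * (a₂ - a₁) := by
  set g : ℂ → ℂ := fun ω => Complex.log (c * z (Complex.exp ω)) with hg
  have hc0 : c ≠ 0 := by rintro rfl; simp at hc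
  have hslit : ∀ ω : ℂ, ω.re ∈ Icc a₁ a₂ → ω.im ∈ Icc a b →
      c * z (Complex.exp ω) ∈ Complex.slitPlane := by
    intro ω h1 h2
    obtain ⟨-, h0, h3⟩ := hz ω h1 h2
    rw [Complex.mem_slitPlane_iff_arg]
    refine ⟨fun h => ?_, mul_ne_zero hc0 h0⟩
    rw [h, abs_of_pos Real.pi_pos] at h3
    linarith
  have hgd : ∀ ω : ℂ, ω.re ∈ Icc a₁ a₂ → ω.im ∈ Icc a b → DifferentiableAt ℂ g ω := by
    intro ω h1 h2
    have h3 : DifferentiableAt ℂ (fun ω => c * z (Complex.exp ω)) ω :=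
      ((hz ω h1 h2).1.comp ω Complex.differentiableAt_exp).const_mul c
    exact h3.clog (hslit ω h1 h2)
  have hre : ∀ ω : ℂ, (g ω).re = Real.log ‖z (Complex.exp ω)‖ := by
    intro ω; simp [hg, Complex.log_re, hc]
  have him : ∀ ω : ℂ, ω.re ∈ Icc a₁ a₂ → ω.im ∈ Icc a b → |(g ω).im| ≤ w / 2 := by
    intro ω h1 h2
    simpa [hg, Complex.log_im] using (hz ω h1 h2).2.2
  have hC := Complex.integral_boundary_rect_eq_zero_of_differentiableOn g ⟨a₁, a⟩ ⟨a₂, b⟩ (by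
    intro ω hω
    rw [Complex.mem_reProdIm, uIcc_of_le ha, uIcc_of_le hab] at hω
    exact (hgd ω hω.1 hω.2).differentiableWithinAt)
  simp only at hC
  have key : ∀ {p q : ℝ} {k : ℝ → ℂ}, p ≤ q → (∀ s ∈ Icc p q, (k s).re ∈ Icc a₁ a₂ ∧
      (k s).im ∈ Icc a b) → Continuous k →
      IntervalIntegrable (fun s => g (k s)) volume p q := by
    intro p q k hpq hk hkc
    apply ContinuousOn.intervalIntegrable
    rw [uIcc_of_le hpq]
    intro s hs
    exact ((hgd _ (hk s hs).1 (hk s hs).2).continuousAt.comp hkc.continuousAt).continuousWithinAt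
  have i1 := key (k := fun x : ℝ => (x : ℂ) + (a : ℂ) * Complex.I) ha
    (fun s hs => by simpa using ⟨hs, hab⟩) (by fun_prop)
  have i2 := key (k := fun x : ℝ => (x : ℂ) + (b : ℂ) * Complex.I) ha
    (fun s hs => by simpa using ⟨hs, hab⟩) (by fun_prop)
  have i3 := key (k := fun y : ℝ => (a₂ : ℂ) + (y : ℂ) * Complex.I) hab
    (fun s hs => by simpa using ⟨ha, hs⟩) (by fun_prop)
  have i4 := key (k := fun y : ℝ => (a₁ : ℂ) + (y : ℂ) * Complex.I) hab
    (fun s hs => by simpa using ⟨ha, hs⟩) (by fun_prop)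
  have hIm := congrArg Complex.im hC
  simp only [Complex.add_im, Complex.sub_im, smul_eq_mul, Complex.mul_im, Complex.I_re,
    Complex.I_im, zero_mul, one_mul, zero_add, Complex.zero_im] at hIm
  have imI : ∀ {p q : ℝ} {k : ℝ → ℂ}, IntervalIntegrable k volume p q →
      (∫ s in p..q, k s).im = ∫ s in p..q, (k s).im := by
    intro p q k hk
    exact ((Complex.imCLM.intervalIntegral_comp_comm hk)).symm
  have reI : ∀ {p q : ℝ} {k : ℝ → ℂ}, IntervalIntegrable k volume p q →
      (∫ s in p..q, k s).re = ∫ s in p..q, (k s).re := by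
    intro p q k hk
    exact ((Complex.reCLM.intervalIntegral_comp_comm hk)).symm
  rw [imI i1, imI i2, reI i3, reI i4] at hIm
  have imint : ∀ {p q : ℝ} {k : ℝ → ℂ}, IntervalIntegrable k volume p q →
      IntervalIntegrable (fun s => (k s).im) volume p q := fun hk =>
    ⟨Complex.imCLM.integrable_comp hk.1, Complex.imCLM.integrable_comp hk.2⟩
  have reint : ∀ {p q : ℝ} {k : ℝ → ℂ}, IntervalIntegrable k volume p q →
      IntervalIntegrable (fun s => (k s).re) volume p q := fun hk =>
    ⟨Complex.reCLM.integrable_comp hk.1, Complex.reCLM.integrable_comp hk.2⟩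
  have b1 : -(w / 2) * (a₂ - a₁) ≤ ∫ x in a₁..a₂, (g ((x : ℂ) + (a : ℂ) * Complex.I)).im := by
    have := intervalIntegral.integral_mono_on ha (intervalIntegrable_const (c := -(w / 2)))
      (imint i1) (fun x hx => (abs_le.1 (him ((x : ℂ) + (a : ℂ) * Complex.I) (by simpa using hx)
        (by simpa using hab))).1)
    rw [intervalIntegral.integral_const, smul_eq_mul] at this
    linarith
  have b2 : ∫ x in a₁..a₂, (g ((x : ℂ) + (b : ℂ) * Complex.I)).im ≤ w / 2 * (a₂ - a₁) := by
    have := intervalIntegral.integral_mono_on ha (imint i2)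
      (intervalIntegrable_const (c := w / 2))
      (fun x hx => (abs_le.1 (him ((x : ℂ) + (b : ℂ) * Complex.I) (by simpa using hx)
        (by simpa using hab))).2)
    rw [intervalIntegral.integral_const, smul_eq_mul] at this
    linarith
  have b3 : Real.log Z₂ * (b - a) ≤ ∫ y in a..b, (g ((a₂ : ℂ) + (y : ℂ) * Complex.I)).re := by
    have := intervalIntegral.integral_mono_on hab (intervalIntegrable_const (c := Real.log Z₂))
      (reint i3) (fun y hy => by
        rw [hre]
        exact Real.log_le_log hZ₂ (h₂ _ (by simp) (by simpa using hy)))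
    rw [intervalIntegral.integral_const, smul_eq_mul] at this
    linarith
  have b4 : ∫ y in a..b, (g ((a₁ : ℂ) + (y : ℂ) * Complex.I)).re ≤ Real.log Z₁ * (b - a) := by
    have := intervalIntegral.integral_mono_on hab
      (reint i4) (intervalIntegrable_const (c := Real.log Z₁)) (fun y hy => by
        rw [hre]
        refine Real.log_le_log ?_ (h₁ _ (by simp) (by simpa using hy))
        exact norm_pos_iff.2 (hz _ (by simpa using ha) (by simpa using hy)).2.1)
    rw [intervalIntegral.integral_const, smul_eq_mul] at this
    linarith
  linarith

theorem Complex.abs_arg_le_of_re {w : ℂ} {s : ℝ} (hw : w ≠ 0) (hs0 : 0 ≤ s)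
    (h : -Real.sin s * ‖w‖ ≤ w.re) : |w.arg| ≤ Real.pi / 2 + s := by
  have hw' : 0 < ‖w‖ := norm_pos_iff.2 hw
  by_contra hcon
  push Not at hcon
  have h1 : Real.cos |w.arg| < Real.cos (Real.pi / 2 + s) :=
    Real.cos_lt_cos_of_nonneg_of_le_pi (by positivity) (Complex.abs_arg_le_pi w) hcon
  rw [Real.cos_abs, Complex.cos_arg hw, add_comm, Real.cos_add_pi_div_two, div_lt_iff₀ hw'] at h1
  linarith

theorem Complex.abs_arg_le_of_re_im {z : ℂ} {s : ℝ} (hz : z ≠ 0) (hs0 : 0 ≤ s)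
    (hs : s ≤ Real.pi / 8) (h : -Real.sin s * ‖z‖ ≤ z.re) (h' : -Real.sin s * ‖z‖ ≤ z.im) :
    |(Complex.exp (-(Real.pi / 4 : ℝ) * Complex.I) * z).arg| ≤ Real.pi / 4 + s := by
  have hz' : 0 < ‖z‖ := norm_pos_iff.2 hz
  set w := Complex.exp (-(Real.pi / 4 : ℝ) * Complex.I) * z with hw
  have hwn : ‖w‖ = ‖z‖ := by
    have := Complex.norm_exp_ofReal_mul_I (-(Real.pi / 4))
    rw [hw, norm_mul]; push_cast at this ⊢; rw [this, one_mul]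
  have hzw : z = Complex.exp ((Real.pi / 4 : ℝ) * Complex.I) * w := by
    rw [hw, ← mul_assoc, ← Complex.exp_add]; simp
  have hpol : z = ‖z‖ * Complex.exp ((w.arg + Real.pi / 4 : ℝ) * Complex.I) := by
    conv_lhs => rw [hzw, ← Complex.norm_mul_exp_arg_mul_I w, hwn]
    rw [mul_left_comm, ← Complex.exp_add]; push_cast; ring_nf
  have hre : z.re = ‖z‖ * Real.cos (w.arg + Real.pi / 4) := by
    conv_lhs => rw [hpol, Complex.re_ofReal_mul, Complex.exp_ofReal_mul_I_re]
  have him : z.im = ‖z‖ * Real.sin (w.arg + Real.pi / 4) := by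
    conv_lhs => rw [hpol, Complex.im_ofReal_mul, Complex.exp_ofReal_mul_I_im]
  have hsin : Real.sin (w.arg + Real.pi / 4) = Real.cos (-w.arg + Real.pi / 4) := by
    rw [← Real.cos_pi_div_two_sub]; congr 1; ring
  rw [hre] at h
  rw [him, hsin] at h'
  have h1 : -Real.sin s ≤ Real.cos (w.arg + Real.pi / 4) := by nlinarith
  have h2 : -Real.sin s ≤ Real.cos (-w.arg + Real.pi / 4) := by nlinarith
  have hpi := Real.pi_pos
  have habs := Complex.abs_arg_le_pi w
  have h3 : -Real.sin s ≤ Real.cos (|w.arg| + Real.pi / 4) := by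
    rcases abs_cases w.arg with ⟨h, -⟩ | ⟨h, -⟩ <;> rw [h] <;> assumption
  by_contra hcon
  push Not at hcon
  have hkey : ∀ β : ℝ, Real.pi / 2 + s < β → β ≤ 5 * Real.pi / 4 → Real.cos β < -Real.sin s := by
    intro β hb1 hb2
    rw [← Real.cos_add_pi_div_two]
    rcases le_total β Real.pi with hb | hb
    · exact Real.cos_lt_cos_of_nonneg_of_le_pi (by linarith) hb (by linarith)
    · have : Real.cos β = Real.cos (2 * Real.pi - β) := (Real.cos_two_pi_sub β).symm
      rw [this]
      exact Real.cos_lt_cos_of_nonneg_of_le_pi (by linarith) (by linarith) (by linarith)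
  have := hkey (|w.arg| + Real.pi / 4) (by linarith) (by linarith)
  linarith

theorem exists_outer_normal {E : Type*} [NormedAddCommGroup E] [InnerProductSpace ℝ E]
    [CompleteSpace E] {B : Set E} (hB : Convex ℝ B) (hBo : IsOpen B) {y : E} (hy : y ∉ B) :
    ∃ m : E, ∀ y' ∈ B, ⟪m, y'⟫ < ⟪m, y⟫ := by
  obtain ⟨f, hf⟩ := geometric_hahn_banach_open_point hB hBo hy
  refine ⟨(InnerProductSpace.toDual ℝ E).symm f, fun y' hy' => ?_⟩
  simpa using hf y' hy'

theorem inner_le_of_mem_closure {E : Type*} [NormedAddCommGroup E] [InnerProductSpace ℝ E]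
    {B : Set E} {m : E} {c : ℝ} (h : ∀ y ∈ B, ⟪m, y⟫ ≤ c) {y : E} (hy : y ∈ closure B) :
    ⟪m, y⟫ ≤ c := by
  have hcl : IsClosed {y' : E | ⟪m, y'⟫ ≤ c} := isClosed_le (by fun_prop) (by fun_prop)
  exact closure_minimal (fun y' hy' => h y' hy') hcl hy

theorem isSub_translate {E : Type*} [NormedAddCommGroup E] [InnerProductSpace ℝ E] {u : E → ℝ}
    {x y w p : E} :
    IsSub (fun w => u (x + w) - u x - ⟪y, w⟫) w p ↔ IsSub u (x + w) (y + p) := by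
  constructor
  · intro h z
    have := h (z - x)
    simp only [add_sub_cancel, inner_sub_right, inner_add_left, inner_add_right] at this ⊢
    linarith
  · intro h z
    have := h (x + z)
    simp only [inner_sub_right, inner_add_left, inner_add_right] at this ⊢
    linarith

theorem Alex.translate {u : ℂ → ℝ} {A : Set ℂ} (h : Alex u A) (x y : ℂ) :
    Alex (fun w => u (x + w) - u x - ⟪y, w⟫) ((fun w => x + w) ⁻¹' A) := by
  intro S hS
  have h1 := h ((fun w => -x + w) ⁻¹' S) (hS.preimage (measurable_const_add _))
  have h2 : (⋃ w ∈ S, {p : ℂ | IsSub (fun w => u (x + w) - u x - ⟪y, w⟫) w p}) =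
      (fun p => y + p) ⁻¹' (⋃ a ∈ (fun w => -x + w) ⁻¹' S, {p : ℂ | IsSub u a p}) := by
    ext p
    simp only [mem_iUnion, mem_ofPred_eq, exists_prop, mem_preimage, isSub_translate]
    constructor
    · rintro ⟨w, hw, hp⟩
      exact ⟨x + w, by simpa using hw, hp⟩
    · rintro ⟨a, ha, hp⟩
      exact ⟨-x + a, ha, by simpa using hp⟩
  have h3 : S ∩ (fun w => x + w) ⁻¹' A =
      (fun w => x + w) ⁻¹' ((fun w => -x + w) ⁻¹' S ∩ A) := by
    ext w; simp
  rw [h2, h3, measure_preimage_add, measure_preimage_add, h1]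

/-- Interior points are mapped to interior points. -/
theorem DualPair.mem_of_mem {u v : ℂ → ℝ} {A B : Set ℂ} (h : DualPair u v A B) {x y : ℂ}
    (hx : x ∈ A) (hs : IsSub u x y) : y ∈ B := by
  by_contra hy
  obtain ⟨m, hm⟩ := exists_outer_normal h.convex' h.isOpen' hy
  have hB : B.Nonempty := closure_nonempty_iff.1 ⟨y, h.mem hs⟩
  have hm0 : m ≠ 0 := by
    rintro rfl
    obtain ⟨b, hb⟩ := hB
    simpa using hm b hb
  have hc := h.convexOn.continuous_of_univ
  set W : ℂ → ℝ := fun w => u (x + w) - u x - ⟪y, w⟫ with hW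
  have hWc : Continuous W := by fun_prop
  obtain ⟨C, hC⟩ := (isCompact_closedBall (0 : ℂ) 1).exists_bound_of_continuousOn hWc.continuousOn
  obtain ⟨r, hr, hrA⟩ := Metric.isOpen_iff.1 h.isOpen x hx
  set κ := min r (1 / (1 + |C|)) with hκ
  have hκ0 : 0 < κ := lt_min hr (by positivity)
  have hκ1 : κ ≤ 1 := (min_le_right _ _).trans (by
    rw [div_le_one (by positivity)]; linarith [abs_nonneg C])
  have hN : Normalized κ W ((fun w => x + w) ⁻¹' A) :=
    { convexOn := by
        have h1 : ConvexOn ℝ univ (fun w => u (x + w)) := by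
          have := h.convexOn.translate_right x
          rwa [preimage_univ] at this
        refine ⟨convex_univ, fun a _ b _ s t hs ht hst => ?_⟩
        have h2 := h1.2 (mem_univ a) (mem_univ b) hs ht hst
        simp only [hW, smul_eq_mul, inner_add_right, real_inner_smul_right] at h2 ⊢
        have : s * u x + t * u x = u x := by rw [← add_mul, hst, one_mul]
        linarith
      isOpen := h.isOpen.preimage (by fun_prop)
      convex := h.convex.translate_preimage_right x
      alex := h.alex.translate x y
      nonneg := fun w => by
        have := hs (x + w)
        simp only [add_sub_cancel_left] at this
        simp only [hW]; linarith
      zero := by simp [hW]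
      bound := fun w hw => by
        have h1 := hC w (by simpa using hw)
        have h2 : 1 + |C| ≤ 1 / κ := by
          rw [le_div_iff₀ hκ0]
          have := min_le_right r (1 / (1 + |C|))
          rw [← hκ, le_div_iff₀ (by positivity)] at this
          linarith
        have := (Real.le_norm_self _).trans h1
        linarith [le_abs_self C]
      zero_mem := subset_closure (by simpa using hx)
      ball := ⟨0, by norm_num, fun w hw => hrA (by
        rw [mem_ball, dist_eq_norm] at hw ⊢
        have := min_le_left r (1 / (1 + |C|))
        simp only [sub_zero, add_sub_cancel_left] at hw ⊢
        linarith)⟩ }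
  have hρ : 0 < κ / 2 := by positivity
  obtain ⟨φ, hφ, hst⟩ := strict_convexity hκ0 hκ1 hρ
  have hm1 : 0 < ‖m‖ := norm_pos_iff.2 hm0
  set t := κ / 2 / ‖m‖ with ht
  have htn : ‖t • m‖ = κ / 2 := by
    rw [norm_smul, Real.norm_eq_abs, abs_of_pos (by positivity), ht, div_mul_cancel₀ _ hm1.ne']
  have h1 := hst W _ hN (t • m) (subset_closure (hrA (by
    rw [mem_ball, dist_eq_norm, add_sub_cancel_left, htn]
    have := min_le_left r (1 / (1 + |C|))
    linarith))) htn.ge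
  have h2 := h.isSub_add_normal hs (fun y' hy' => (hm y' hy').le) (t := t) (by positivity) x
  simp only [hW, sub_add_cancel_left, inner_neg_right] at h1 h2
  linarith

theorem DualPair.inner_nonneg {E : Type*} [NormedAddCommGroup E] [InnerProductSpace ℝ E]
    [MeasureSpace E] {u v : E → ℝ} {A B : Set E} (h : DualPair u v A B) {x y : E}
    (hs : IsSub u x y) : 0 ≤ ⟪x, y⟫ := by
  rw [← h.eq hs]
  exact add_nonneg (h.nonneg x) (h.nonneg' y)

theorem DualPair.le_inner {E : Type*} [NormedAddCommGroup E] [InnerProductSpace ℝ E]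
    [MeasureSpace E] {u v : E → ℝ} {A B : Set E} (h : DualPair u v A B) {x y : E}
    (hs : IsSub u x y) : u x ≤ ⟪x, y⟫ ∧ v y ≤ ⟪x, y⟫ := by
  rw [← h.eq hs]
  constructor
  · linarith [h.nonneg' y]
  · linarith [h.nonneg x]

/-- Points of an open convex set may be moved towards a point of its closure. -/
theorem Convex.smul_mem_of_zero_mem_closure {E : Type*} [NormedAddCommGroup E] [NormedSpace ℝ E]
    {A : Set E} (hA : Convex ℝ A) (hAo : IsOpen A) (h0 : (0 : E) ∈ closure A) {g : E} (hg : g ∈ A)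
    {t : ℝ} (ht : 0 < t) (ht1 : t ≤ 1) : t • g ∈ A := by
  have := hA.combo_interior_closure_mem_interior (x := g) (y := 0)
    (by rwa [hAo.interior_eq]) h0 ht (by linarith : (0 : ℝ) ≤ 1 - t) (by ring)
  rwa [smul_zero, add_zero, hAo.interior_eq] at this

theorem dualPair_comp_isometry {u v : ℂ → ℝ} {A B : Set ℂ} (h : DualPair u v A B)
    (ρ : ℂ ≃ₗᵢ[ℝ] ℂ) :
    DualPair (fun w => u (ρ w)) (fun w => v (ρ w)) (ρ ⁻¹' A) (ρ ⁻¹' B) := by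
  have := h.comp_sc one_pos one_pos ρ
  have hs : sc 1 1 ρ = ρ := by funext a; simp [sc]
  simpa [hs] using this

/-- Reflection of the plane in the diagonal. -/
def diagRefl : ℂ ≃ₗᵢ[ℝ] ℂ where
  toFun z := ⟨z.im, z.re⟩
  invFun z := ⟨z.im, z.re⟩
  map_add' _ _ := rfl
  map_smul' r z := by apply Complex.ext <;> simp
  left_inv _ := rfl
  right_inv _ := rfl
  norm_map' z := by
    change ‖(⟨z.im, z.re⟩ : ℂ)‖ = ‖z‖
    rw [Complex.norm_eq_sqrt_sq_add_sq, Complex.norm_eq_sqrt_sq_add_sq, add_comm]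

@[simp] theorem diagRefl_re (z : ℂ) : (diagRefl z).re = z.im := rfl

@[simp] theorem diagRefl_im (z : ℂ) : (diagRefl z).im = z.re := rfl

@[simp] theorem diagRefl_symm : diagRefl.symm = diagRefl := rfl

/-- Reflection of the plane in the coordinate axes, for signs `a` and `b`. -/
def axisRefl (a b : ℝ) (ha : a * a = 1) (hb : b * b = 1) : ℂ ≃ₗᵢ[ℝ] ℂ where
  toFun z := ⟨a * z.re, b * z.im⟩
  invFun z := ⟨a * z.re, b * z.im⟩
  map_add' z w := by apply Complex.ext <;> simp <;> ring
  map_smul' r z := by apply Complex.ext <;> simp <;> ring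
  left_inv z := by apply Complex.ext <;> simp [← mul_assoc, ha, hb]
  right_inv z := by apply Complex.ext <;> simp [← mul_assoc, ha, hb]
  norm_map' z := by
    change ‖(⟨a * z.re, b * z.im⟩ : ℂ)‖ = ‖z‖
    rw [Complex.norm_eq_sqrt_sq_add_sq, Complex.norm_eq_sqrt_sq_add_sq]
    congr 1
    simp only
    linear_combination z.re ^ 2 * ha + z.im ^ 2 * hb

section ScaleTransport

variable {F : Type*} [NormedAddCommGroup F] [InnerProductSpace ℝ F]
variable {κ : ℝ} {u v : F → ℝ} {A B : Set F} {L l : ℝ} {J : ℂ ≃ₗᵢ[ℝ] F}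

theorem NormalizedAt.swap (h : NormalizedAt κ u A L l J) :
    NormalizedAt κ u A l L (diagRefl.trans J) := by
  refine ⟨h.2.1, h.1, ?_⟩
  have h1 := h.2.2.comp_isometry diagRefl
  have hs : sc l L (diagRefl.trans J) = fun a => sc L l J (diagRefl a) := by
    funext a; rfl
  rw [hs, mul_comm l L]
  exact h1

theorem Scale.swap (h : Scale κ u v A B L l J) : Scale κ v u B A L l (diagRefl.trans J) :=
  ⟨h.le, h.snd.swap, h.fst.swap⟩

theorem NormalizedAt.axisRefl (h : NormalizedAt κ u A L l J) (a b : ℝ) (ha : a * a = 1)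
    (hb : b * b = 1) : NormalizedAt κ u A L l ((axisRefl a b ha hb).trans J) := by
  refine ⟨h.1, h.2.1, ?_⟩
  have h1 := h.2.2.comp_isometry (_root_.axisRefl a b ha hb)
  have hs : sc L l ((_root_.axisRefl a b ha hb).trans J) =
      fun w => sc L l J (_root_.axisRefl a b ha hb w) := by
    funext w
    change J ⟨a * (L * w.re), b * (l * w.im)⟩ = J ⟨L * (a * w.re), l * (b * w.im)⟩
    congr 1; apply Complex.ext <;> simp <;> ring
  rw [hs]
  exact h1

theorem Scale.axisRefl (h : Scale κ u v A B L l J) (a b : ℝ) (ha : a * a = 1)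
    (hb : b * b = 1) : Scale κ u v A B L l ((axisRefl a b ha hb).trans J) :=
  ⟨h.le, h.fst.axisRefl a b ha hb, h.snd.axisRefl a b ha hb⟩

theorem NormalizedAt.comp_sc (h : NormalizedAt κ u A L l J) {r : ℝ} (hr : 0 < r)
    (J₀ : ℂ ≃ₗᵢ[ℝ] F) :
    NormalizedAt κ (fun a => u (sc r r J₀ a) / (r * r)) (sc r r J₀ ⁻¹' A) (L / r) (l / r)
      (J.trans J₀.symm) := by
  refine ⟨div_pos h.1 hr, div_pos h.2.1 hr, ?_⟩
  have hs : ∀ a, sc r r J₀ (sc (L / r) (l / r) (J.trans J₀.symm) a) = sc L l J a := by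
    intro a
    have h1 : sc (L / r) (l / r) (J.trans J₀.symm) a = r⁻¹ • J₀.symm (sc L l J a) := by
      rw [sc, sc, LinearIsometryEquiv.trans_apply, ← map_smul, ← map_smul]
      congr 2
      apply Complex.ext <;> simp <;> ring
    have h2 : ∀ w : ℂ, sc r r J₀ w = r • J₀ w := by
      intro w
      rw [sc, ← map_smul]; congr 1
      apply Complex.ext <;> simp
    rw [h1, h2, map_smul, smul_smul, mul_inv_cancel₀ hr.ne', one_smul, J₀.apply_symm_apply]
  have hu : (fun a => u (sc r r J₀ (sc (L / r) (l / r) (J.trans J₀.symm) a)) / (r * r) /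
      (L / r * (l / r))) = fun a => u (sc L l J a) / (L * l) := by
    funext a
    rw [hs, div_div]; congr 1; field_simp
  have hA : sc (L / r) (l / r) (J.trans J₀.symm) ⁻¹' (sc r r J₀ ⁻¹' A) = sc L l J ⁻¹' A := by
    ext a; simp only [mem_preimage, hs]
  simp only [hu, hA]
  exact h.2.2

theorem Scale.comp_sc (h : Scale κ u v A B L l J) {r : ℝ} (hr : 0 < r) (J₀ : ℂ ≃ₗᵢ[ℝ] F) :
    Scale κ (fun a => u (sc r r J₀ a) / (r * r)) (fun a => v (sc r r J₀ a) / (r * r))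
      (sc r r J₀ ⁻¹' A) (sc r r J₀ ⁻¹' B) (L / r) (l / r) (J.trans J₀.symm) :=
  ⟨div_le_div_of_nonneg_right h.le hr.le, h.fst.comp_sc hr J₀, h.snd.comp_sc hr J₀⟩

end ScaleTransport

section

variable {κ : ℝ} {u v : ℂ → ℝ} {A B : Set ℂ} {L l L' l' : ℝ} {J J' : ℂ ≃ₗᵢ[ℝ] ℂ}

theorem Scale.comp_isometry (h : Scale κ u v A B L l J) (ρ : ℂ ≃ₗᵢ[ℝ] ℂ) :
    Scale κ (fun w => u (ρ w)) (fun w => v (ρ w)) (ρ ⁻¹' A) (ρ ⁻¹' B) L l (J.trans ρ.symm) := by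
  have := h.comp_sc one_pos ρ
  have hs : sc 1 1 ρ = ρ := by funext a; simp [sc]
  simpa [hs] using this

/-- A dual pair in the plane normalized at a very eccentric scale, whose eccentricity decays
slowly over a long range of larger scales. -/
structure Ctx (κ β ε Λ τ : ℝ) (u v : ℂ → ℝ) (A B : Set ℂ) : Prop where
  dual : DualPair u v A B
  base : Scale κ u v A B 1 τ (LinearIsometryEquiv.refl ℝ ℂ)
  fam : ∀ m, 1 ≤ m → m ≤ Λ → ∃ L l J, Scale κ u v A B L l J ∧ L * l = m * τ ∧
    (2 ≤ m → τ * m ^ ε * L ≤ l)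
  fat : ∀ w : ℂ, ‖w‖ = 1 → ∃ g ∈ A, ‖g‖ ≤ 1 ∧ β ≤ |⟪g, w⟫|
  fat' : ∀ w : ℂ, ‖w‖ = 1 → ∃ g ∈ B, ‖g‖ ≤ 1 ∧ β ≤ |⟪g, w⟫|

namespace Ctx

variable {β ε Λ τ : ℝ}

theorem pos (h : Ctx κ β ε Λ τ u v A B) : 0 < τ := h.base.pos'

theorem swap (h : Ctx κ β ε Λ τ u v A B) :
    Ctx κ β ε Λ τ (fun w => v (diagRefl w)) (fun w => u (diagRefl w)) (diagRefl ⁻¹' B)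
      (diagRefl ⁻¹' A) where
  dual := dualPair_comp_isometry h.dual.symm diagRefl
  base := h.base.swap.comp_isometry diagRefl
  fam m h1 h2 := by
    obtain ⟨L, l, J, hS, h3⟩ := h.fam m h1 h2
    exact ⟨L, l, _, hS.swap.comp_isometry diagRefl, h3⟩
  fat w hw := by
    obtain ⟨g, hg, hg1, hg2⟩ := h.fat' (diagRefl w) (by simpa using hw)
    refine ⟨diagRefl g, hg, by simpa using hg1, ?_⟩
    simpa [cinner, add_comm] using hg2
  fat' w hw := by
    obtain ⟨g, hg, hg1, hg2⟩ := h.fat (diagRefl w) (by simpa using hw)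
    refine ⟨diagRefl g, hg, by simpa using hg1, ?_⟩
    simpa [cinner, add_comm] using hg2

theorem axisRefl (h : Ctx κ β ε Λ τ u v A B) (a b : ℝ) (ha : a * a = 1) (hb : b * b = 1) :
    Ctx κ β ε Λ τ (fun w => u (axisRefl a b ha hb w)) (fun w => v (_root_.axisRefl a b ha hb w))
      (_root_.axisRefl a b ha hb ⁻¹' A) (_root_.axisRefl a b ha hb ⁻¹' B) where
  dual := dualPair_comp_isometry h.dual _
  base := by
    have := (h.base.axisRefl a b ha hb).comp_isometry (_root_.axisRefl a b ha hb)
    rwa [show ((_root_.axisRefl a b ha hb).trans (LinearIsometryEquiv.refl ℝ ℂ)).trans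
      (_root_.axisRefl a b ha hb).symm = LinearIsometryEquiv.refl ℝ ℂ by ext z; simp] at this
  fam m h1 h2 := by
    obtain ⟨L, l, J, hS, h3⟩ := h.fam m h1 h2
    exact ⟨L, l, _, hS.comp_isometry _, h3⟩
  fat w hw := by
    obtain ⟨g, hg, hg1, hg2⟩ := h.fat (_root_.axisRefl a b ha hb w) (by simpa using hw)
    refine ⟨(_root_.axisRefl a b ha hb).symm g, by simpa using hg, by simpa using hg1, ?_⟩
    rwa [← (_root_.axisRefl a b ha hb).inner_map_map, LinearIsometryEquiv.apply_symm_apply]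
  fat' w hw := by
    obtain ⟨g, hg, hg1, hg2⟩ := h.fat' (_root_.axisRefl a b ha hb w) (by simpa using hw)
    refine ⟨(_root_.axisRefl a b ha hb).symm g, by simpa using hg, by simpa using hg1, ?_⟩
    rwa [← (_root_.axisRefl a b ha hb).inner_map_map, LinearIsometryEquiv.apply_symm_apply]

/-- Every moderately large radius is comparable to the long half-axis of some scale. -/
theorem exists_near (hκ : 0 < κ) (hκ1 : κ ≤ 1) :
    ∃ C₀ : ℝ, 1 ≤ C₀ ∧ ∀ R : ℝ, ∃ Λ₀ : ℝ, 1 ≤ Λ₀ ∧ ∀ (β ε Λ τ : ℝ) (u v : ℂ → ℝ) (A B : Set ℂ),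
      Ctx κ β ε Λ τ u v A B → Λ₀ ≤ Λ → ∀ r, C₀ ≤ r → r ≤ R → ∃ m L l J, 1 ≤ m ∧ m ≤ Λ₀ ∧
        r ≤ C₀ * m ∧ Scale κ u v A B L l J ∧ L * l = m * τ ∧ (2 ≤ m → τ * m ^ ε * L ≤ l) ∧
        r ≤ C₀ * L ∧ L ≤ r := by
  obtain ⟨C, hC, hCS⟩ := Scale.exists_scaleLE hκ hκ1
  refine ⟨2 * C ^ 2, by nlinarith, fun R => ?_⟩
  have hR0 : (0 : ℝ) < |R| + 1 := by positivity
  obtain ⟨lam, hlam, hS⟩ := Scale.exists_scaleLE_small hκ hκ1 (inv_pos.2 hR0)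
  obtain ⟨N, hN⟩ := pow_unbounded_of_one_lt lam (one_lt_two)
  refine ⟨2 ^ N, one_le_pow₀ (by norm_num), fun β ε Λ τ u v A B h hΛ r hr1 hr2 => ?_⟩
  have hτ := h.pos
  have hfam : ∀ k : ℕ, ∃ L l J, k ≤ N → Scale κ u v A B L l J ∧ L * l = 2 ^ k * τ ∧
      ((2 : ℝ) ≤ 2 ^ k → τ * ((2 : ℝ) ^ k) ^ ε * L ≤ l) := by
    intro k
    by_cases hk : k ≤ N
    · obtain ⟨L, l, J, h1⟩ := h.fam (2 ^ k) (one_le_pow₀ (by norm_num))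
        ((pow_le_pow_right₀ (by norm_num) hk).trans hΛ)
      exact ⟨L, l, J, fun _ => h1⟩
    · exact ⟨0, 0, LinearIsometryEquiv.refl ℝ ℂ, fun h => absurd h hk⟩
  choose Lf lf Jf hf using hfam
  have hexN : r < Lf N := by
    obtain ⟨h1, h2, -⟩ := hf N le_rfl
    have h3 := h.base.le_of_scaleLE h1
      (hS ℂ _ _ _ _ _ _ _ _ _ _ h.base h1 (by rw [h2]; nlinarith))
    have h4 := h3.1
    rw [inv_mul_eq_div, le_div_iff₀ hR0] at h4
    linarith [le_abs_self R]
  classical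
  have hex : ∃ k, r < Lf k := ⟨N, hexN⟩
  set k := Nat.find hex with hk
  have hkr : r < Lf k := Nat.find_spec hex
  have hkN : k ≤ N := Nat.find_min' hex hexN
  have hk0 : k ≠ 0 := by
    intro hk0
    rw [hk0] at hkr
    obtain ⟨h1, h2, -⟩ := hf 0 (Nat.zero_le _)
    have h3 := h.base.le_of_scaleLE h1
      (hCS ℂ _ _ _ _ _ _ _ _ _ _ h.base h1 (by rw [h2]; simp))
    have h4 := h1.pos'
    have h5 : Lf 0 * lf 0 ≤ C * lf 0 := by rw [h2]; simpa using h3.2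
    have h6 := le_of_mul_le_mul_right h5 h4
    nlinarith
  obtain ⟨j, hj⟩ := Nat.exists_eq_succ_of_ne_zero hk0
  have hjk : j < k := by omega
  have hjr : Lf j ≤ r := not_lt.1 (Nat.find_min hex hjk)
  obtain ⟨h1, h2, h3⟩ := hf j (by omega)
  obtain ⟨h1', h2', -⟩ := hf k hkN
  have hle := h1.le_of_scaleLE h1' (hCS ℂ _ _ _ _ _ _ _ _ _ _ h1 h1' (by
    rw [h2, h2']; gcongr; norm_num))
  have hle0 := h.base.le_of_scaleLE h1 (hCS ℂ _ _ _ _ _ _ _ _ _ _ h.base h1 (by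
    rw [h2]; gcongr; exact one_le_pow₀ (by norm_num)))
  have hLj := h1.pos; have hlj := h1.pos'; have hlk := h1'.pos'; have hLk := h1'.pos
  have hkj : Lf k ≤ 2 * C * Lf j := by
    have h5 : Lf k * lf k = 2 * (Lf j * lf j) := by
      rw [h2, h2', hj, pow_succ]; ring
    have h6 : Lf k * lf k ≤ 2 * C * Lf j * lf k := by
      rw [h5]
      have := mul_le_mul_of_nonneg_left hle.2 hLj.le
      linarith
    exact le_of_mul_le_mul_right h6 hlk
  have hjm : Lf j ≤ C * 2 ^ j := by
    have h6 : Lf j * τ ≤ C * 2 ^ j * τ := by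
      have := mul_le_mul_of_nonneg_left hle0.2 hLj.le
      nlinarith
    exact le_of_mul_le_mul_right h6 hτ
  refine ⟨2 ^ j, Lf j, lf j, Jf j, one_le_pow₀ (by norm_num),
    pow_le_pow_right₀ (by norm_num) (by omega), ?_, h1, h2, h3, ?_, hjr⟩
  · have : 2 * C * Lf j ≤ 2 * C * (C * 2 ^ j) := by gcongr
    nlinarith
  · have : 2 * C * Lf j ≤ 2 * C ^ 2 * Lf j := by
      have : C ≤ C ^ 2 := by nlinarith
      gcongr
    linarith

end Ctx

theorem Complex.abs_re_usc_le (hL : 0 < L) (w : ℂ) : |(usc L l J w).re| ≤ ‖w‖ / L := by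
  rw [usc]
  simp only [abs_div, abs_of_pos hL]
  gcongr
  exact (Complex.abs_re_le_norm _).trans (by simp)

theorem Complex.abs_im_usc_le (hl : 0 < l) (w : ℂ) : |(usc L l J w).im| ≤ ‖w‖ / l := by
  rw [usc]
  simp only [abs_div, abs_of_pos hl]
  gcongr
  exact (Complex.abs_im_le_norm _).trans (by simp)

/-- Points of the graph of the subdifferential whose long coordinates are controlled by a scale
are controlled by that scale. -/
theorem Scale.exists_norm_le (hκ : 0 < κ) (hκ1 : κ ≤ 1) (r : ℝ) :
    ∃ lam : ℝ, 1 ≤ lam ∧ ∀ (u v : ℂ → ℝ) (A B : Set ℂ) (L l L' l' : ℝ) (J J' : ℂ ≃ₗᵢ[ℝ] ℂ),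
      DualPair u v A B → Scale κ u v A B L l J → Scale κ u v A B L' l' J' →
      lam * (L * l) ≤ L' * l' → ∀ x y, x ∈ closure A → IsSub u x y → |(usc L l J x).re| ≤ r →
      |(usc l L J y).im| ≤ r → ‖usc L l J x‖ + ‖usc l L J y‖ ≤ 4 * (L' * l' / (L * l)) := by
  obtain ⟨φ, hφ, hg⟩ := linear_growth hκ hκ1 one_pos
  set D := max 1 (2 * r / φ) with hD
  have hD1 : 1 ≤ D := le_max_left _ _
  have hD2 : 2 * r / φ ≤ D := le_max_right _ _
  rw [div_le_iff₀ hφ] at hD2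
  have hD0 : 0 < D := by linarith
  obtain ⟨lam, hlam, hS⟩ := Scale.exists_scaleLE_small hκ hκ1 (inv_pos.2 hD0)
  refine ⟨lam, hlam, fun u v A B L l L' l' J J' hd h h' hle x y hx hs hr hr' => ?_⟩
  have hL := h.pos; have hl := h.pos'; have hL' := h'.pos; have hl' := h'.pos'
  have hSc := hS ℂ _ _ _ _ _ _ _ _ _ _ h h' hle
  have hLl : 0 < L * l := by positivity
  have hLl' : 0 < L' * l' := by positivity
  have hu : φ * (D * (L * l) * ‖usc L l J x‖ - L' * l') ≤ u x := by
    obtain ⟨-, -, h1, -⟩ := hSc x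
    rw [inv_mul_eq_div, div_mul_eq_mul_div, le_div_iff₀ hD0] at h1
    by_cases hc : 1 ≤ ‖usc L' l' J' x‖
    · refine le_trans ?_ (h'.fst.growth hg hx hc)
      have h2 := mul_le_mul_of_nonneg_left h1 hφ.le
      have h3 := mul_pos hφ hLl'
      linarith
    · refine le_trans ?_ (hd.nonneg x)
      apply mul_nonpos_of_nonneg_of_nonpos hφ.le
      nlinarith
  have hv : φ * (D * (L * l) * ‖usc l L J y‖ - L' * l') ≤ v y := by
    obtain ⟨-, -, -, h1⟩ := hSc y
    rw [inv_mul_eq_div, div_mul_eq_mul_div, le_div_iff₀ hD0] at h1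
    by_cases hc : 1 ≤ ‖usc l' L' J' y‖
    · refine le_trans ?_ (h'.snd.growth hg (hd.mem hs) hc)
      have h2 := mul_le_mul_of_nonneg_left h1 hφ.le
      have h3 := mul_pos hφ hLl'
      linarith
    · refine le_trans ?_ (hd.nonneg' y)
      apply mul_nonpos_of_nonneg_of_nonpos hφ.le
      nlinarith
  have he := hd.eq hs
  rw [inner_eq_usc hL hl J, cinner] at he
  have hr0 : 0 ≤ r := (abs_nonneg _).trans hr
  have h1 : (usc L l J x).re * (usc l L J y).re ≤ r * ‖usc l L J y‖ := by
    refine (le_abs_self _).trans ?_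
    rw [abs_mul]
    exact mul_le_mul hr (Complex.abs_re_le_norm _) (abs_nonneg _) hr0
  have h2 : (usc L l J x).im * (usc l L J y).im ≤ r * ‖usc L l J x‖ := by
    refine (le_abs_self _).trans ?_
    rw [abs_mul, mul_comm]
    exact mul_le_mul hr' (Complex.abs_im_le_norm _) (abs_nonneg _) hr0
  set N := ‖usc L l J x‖ + ‖usc l L J y‖ with hN
  have hN0 : 0 ≤ N := by positivity
  have h3 : φ * (D * (L * l) * N - 2 * (L' * l')) ≤ L * l * (r * N) := by
    have : L * l * ((usc L l J x).re * (usc l L J y).re + (usc L l J x).im * (usc l L J y).im) ≤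
      L * l * (r * N) := by gcongr; rw [hN]; linarith
    rw [hN] at this ⊢
    linarith
  have h4 : L * l * (2 * r * N) ≤ L * l * (D * φ * N) := by gcongr
  have h5 : φ * (D * (L * l * N)) ≤ φ * (4 * (L' * l')) := by linarith
  have h6 := le_of_mul_le_mul_left h5 hφ
  have h7 : L * l * N ≤ D * (L * l * N) := by
    have : 0 ≤ L * l * N := by positivity
    nlinarith
  rw [mul_div_assoc', le_div_iff₀ hLl]
  linarith

/-- Lower bound for the energy of points which are not small compared with a scale. -/
theorem Scale.exists_le_inner (hκ : 0 < κ) (hκ1 : κ ≤ 1) {d : ℝ} (hd : 0 < d) :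
    ∃ φ : ℝ, 0 < φ ∧ ∀ (u v : ℂ → ℝ) (A B : Set ℂ) (L l : ℝ) (J : ℂ ≃ₗᵢ[ℝ] ℂ),
      DualPair u v A B → Scale κ u v A B L l J → ∀ x y, x ∈ closure A → IsSub u x y →
      d * L ≤ ‖x‖ + ‖y‖ → φ * (L * l) ≤ ⟪x, y⟫ := by
  obtain ⟨φ, hφ, hg⟩ := linear_growth hκ hκ1 (half_pos hd)
  refine ⟨φ * (d / 2), by positivity, fun u v A B L l J hp h x y hx hs hxy => ?_⟩
  have hL := h.pos; have hl := h.pos'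
  have h1 := norm_le_mul_norm_usc (J := J) hL hl h.le x
  have h2 : ‖y‖ ≤ L * ‖usc l L J y‖ := by
    have := norm_le_mul_norm_usc (J := diagRefl.trans J) hL hl h.le y
    have e : usc L l (diagRefl.trans J) y = diagRefl (usc l L J y) := by
      apply Complex.ext <;> simp [usc]
    rwa [e, diagRefl.norm_map] at this
  have hLl : 0 < L * l := by positivity
  have h3 := hp.le_inner hs
  by_cases hc : d / 2 ≤ ‖usc L l J x‖
  · refine le_trans ?_ ((h.fst.growth hg hx hc).trans h3.1)
    gcongr
  · have hc' : d / 2 ≤ ‖usc l L J y‖ := by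
      push Not at hc
      by_contra hc2
      push Not at hc2
      have : L * (‖usc L l J x‖ + ‖usc l L J y‖) < L * d := by gcongr; linarith
      linarith
    refine le_trans ?_ ((h.snd.growth hg (hp.mem hs) hc').trans h3.2)
    rw [mul_comm L l]
    gcongr

end

/-- The data of a rescaled planar configuration: eccentricity, potentials and domains. -/
structure Config where
  /-- The inverse eccentricity of the base scale. -/
  τ : ℝ
  /-- The potential. -/
  u : ℂ → ℝ
  /-- The dual potential. -/
  v : ℂ → ℝ
  /-- The source domain. -/
  A : Set ℂ
  /-- The target domain. -/
  B : Set ℂ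

namespace Config

/-- The graph of the subdifferential over the closed source. -/
def Graph (d : Config) (x y : ℂ) : Prop := x ∈ closure d.A ∧ IsSub d.u x y

/-- Both domains point to the positive side in the direction in which they are fat. -/
def Signed (β : ℝ) (d : Config) : Prop :=
  (∃ g ∈ d.A, ‖g‖ ≤ 1 ∧ β ≤ g.im) ∧ ∃ g ∈ d.B, ‖g‖ ≤ 1 ∧ β ≤ g.re

/-- Exchange of the roles of source and target. -/
def swap (d : Config) : Config :=
  ⟨d.τ, fun w => d.v (diagRefl w), fun w => d.u (diagRefl w), diagRefl ⁻¹' d.B, diagRefl ⁻¹' d.A⟩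

/-- The scale with `L * l = m * τ`, together with the slow decay of the eccentricity. -/
structure Fam (κ ε : ℝ) (d : Config) (m L l : ℝ) (J : ℂ ≃ₗᵢ[ℝ] ℂ) : Prop where
  scale : Scale κ d.u d.v d.A d.B L l J
  mul_eq : L * l = m * d.τ
  decay : d.τ * m ^ ε * L ≤ l

/-- The source lies almost above the horizontal axis. -/
def Low (C : ℝ) (d : Config) : Prop := ∀ x ∈ d.A, -(C * d.τ * (1 + |x.re|)) ≤ x.im

/-- The source contains a point far below the horizontal axis. -/
def Dip (K : ℝ) (d : Config) : Prop := ∃ k ∈ d.A, |k.re| ≤ 1 / 2 ∧ k.im = -(K * d.τ)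

end Config

/-- The filter of configurations of arbitrarily high eccentricity whose eccentricity decays slowly
over arbitrarily long ranges of scales. -/
def ctxFilter (κ β ε : ℝ) : Filter Config where
  sets := {S | ∃ Λ τ₀ : ℝ, 0 < τ₀ ∧ ∀ d : Config, Ctx κ β ε Λ d.τ d.u d.v d.A d.B → d.Signed β →
    d.τ < τ₀ → d ∈ S}
  univ_sets := ⟨0, 1, one_pos, fun _ _ _ _ => mem_univ _⟩
  sets_of_superset := by
    rintro S T ⟨Λ, τ₀, h0, h⟩ hST
    exact ⟨Λ, τ₀, h0, fun d h1 h2 h3 => hST (h d h1 h2 h3)⟩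
  inter_sets := by
    rintro S T ⟨Λ, τ₀, h0, h⟩ ⟨Λ', τ₀', h0', h'⟩
    refine ⟨max Λ Λ', min τ₀ τ₀', lt_min h0 h0', fun d h1 h2 h3 => ⟨?_, ?_⟩⟩
    · refine h d ⟨h1.dual, h1.base, fun m hm hm' => h1.fam m hm (hm'.trans (le_max_left _ _)),
        h1.fat, h1.fat'⟩ h2 (h3.trans_le (min_le_left _ _))
    · refine h' d ⟨h1.dual, h1.base, fun m hm hm' => h1.fam m hm (hm'.trans (le_max_right _ _)),
        h1.fat, h1.fat'⟩ h2 (h3.trans_le (min_le_right _ _))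

section

variable {κ β ε : ℝ}

theorem eventually_ctxFilter {P : Config → Prop} : (∀ᶠ d in ctxFilter κ β ε, P d) ↔
    ∃ Λ τ₀ : ℝ, 0 < τ₀ ∧ ∀ d : Config, Ctx κ β ε Λ d.τ d.u d.v d.A d.B → d.Signed β →
      d.τ < τ₀ → P d := Iff.rfl

theorem eventually_ctx (κ β ε Λ : ℝ) : ∀ᶠ d in ctxFilter κ β ε,
    Ctx κ β ε Λ d.τ d.u d.v d.A d.B ∧ d.Signed β :=
  eventually_ctxFilter.2 ⟨Λ, 1, one_pos, fun _ h h' _ => ⟨h, h'⟩⟩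

theorem eventually_lt {c : ℝ} (hc : 0 < c) : ∀ᶠ d in ctxFilter κ β ε, d.τ < c :=
  eventually_ctxFilter.2 ⟨0, c, hc, fun _ _ _ h => h⟩

theorem eventually_mul_lt (C : ℝ) {c : ℝ} (hc : 0 < c) :
    ∀ᶠ d in ctxFilter κ β ε, C * d.τ < c := by
  filter_upwards [eventually_ctx κ β ε 0, eventually_lt (c := c / (|C| + 1)) (by positivity)]
    with d h1 h2
  have := h1.1.pos
  rw [lt_div_iff₀ (by positivity)] at h2
  nlinarith [le_abs_self C]

theorem diagRefl_diagRefl (w : ℂ) : diagRefl (diagRefl w) = w := by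
  apply Complex.ext <;> simp

theorem eventually_swap {P : Config → Prop} (h : ∀ᶠ d in ctxFilter κ β ε, P d) :
    ∀ᶠ d in ctxFilter κ β ε, P d.swap := by
  obtain ⟨Λ, τ₀, h0, h⟩ := eventually_ctxFilter.1 h
  refine eventually_ctxFilter.2 ⟨Λ, τ₀, h0, fun d h1 h2 h3 => h d.swap h1.swap ⟨?_, ?_⟩ h3⟩
  · obtain ⟨g, hg, h4, h5⟩ := h2.2
    exact ⟨diagRefl g, by simpa [Config.swap, diagRefl_diagRefl] using hg, by simpa using h4,
      by simpa using h5⟩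
  · obtain ⟨g, hg, h4, h5⟩ := h2.1
    exact ⟨diagRefl g, by simpa [Config.swap, diagRefl_diagRefl] using hg, by simpa using h4,
      by simpa using h5⟩

theorem Config.fam_swap {d : Config} {m L l : ℝ} {J : ℂ ≃ₗᵢ[ℝ] ℂ}
    (h : d.Fam κ ε m L l J) : d.swap.Fam κ ε m L l (diagRefl.trans (J.trans diagRefl.symm)) :=
  ⟨h.scale.swap.comp_isometry diagRefl, h.mul_eq, h.decay⟩

theorem Config.graph_swap {d : Config} (hd : DualPair d.u d.v d.A d.B) {x y : ℂ}
    (h : d.Graph x y) : d.swap.Graph (diagRefl y) (diagRefl x) := by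
  refine ⟨?_, ?_⟩
  · have := hd.mem h.2
    have e : closure (diagRefl ⁻¹' d.B) = diagRefl ⁻¹' closure d.B :=
      (diagRefl.toHomeomorph.preimage_closure d.B).symm
    change _ ∈ closure (diagRefl ⁻¹' d.B)
    rw [e]
    simpa [diagRefl_diagRefl] using this
  · change IsSub (fun w => d.v (diagRefl w)) _ _
    rw [isSub_comp_isometry, diagRefl_diagRefl, diagRefl_diagRefl]
    exact hd.isSub_symm h.1 h.2

theorem usc_refl (L l : ℝ) (w : ℂ) :
    usc L l (LinearIsometryEquiv.refl ℝ ℂ) w = ⟨w.re / L, w.im / l⟩ := rfl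

theorem sc_refl (L l : ℝ) (w : ℂ) :
    sc L l (LinearIsometryEquiv.refl ℝ ℂ) w = ⟨L * w.re, l * w.im⟩ := rfl

theorem eventually_exists_fam (M : ℝ) : ∀ᶠ d in ctxFilter κ β ε, ∀ m, 2 ≤ m → m ≤ M →
    ∃ L l J, d.Fam κ ε m L l J := by
  filter_upwards [eventually_ctx κ β ε M] with d hd m h1 h2
  obtain ⟨L, l, J, h3, h4, h5⟩ := hd.1.fam m (by linarith) h2
  exact ⟨L, l, J, h3, h4, h5 h1⟩

theorem exists_near (hκ : 0 < κ) (hκ1 : κ ≤ 1) (β ε : ℝ) : ∃ C₀ : ℝ, 1 ≤ C₀ ∧ ∀ R : ℝ, ∃ M : ℝ,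
    2 ≤ M ∧ ∀ᶠ d in ctxFilter κ β ε, ∀ r, C₀ ≤ r → r ≤ R → ∃ m L l J, 2 ≤ m ∧ m ≤ M ∧ r ≤ C₀ * m ∧
      d.Fam κ ε m L l J ∧ r ≤ C₀ * L ∧ L ≤ r := by
  obtain ⟨C, hC, h⟩ := Ctx.exists_near hκ hκ1
  refine ⟨2 * C, by linarith, fun R => ?_⟩
  obtain ⟨Λ, hΛ, h⟩ := h R
  refine ⟨max 2 Λ, le_max_left _ _, ?_⟩
  filter_upwards [eventually_ctx κ β ε Λ] with d hd r h1 h2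
  obtain ⟨m, L, l, J, h3, h4, h5, h6, h7, h8, h9, h10⟩ := h β ε Λ _ _ _ _ _ hd.1 le_rfl r
    (by linarith) h2
  have hm : 2 ≤ m := by nlinarith
  refine ⟨m, L, l, J, hm, h4.trans (le_max_right _ _), by nlinarith, ⟨h6, h7, h8 hm⟩, ?_, h10⟩
  have := h6.pos
  nlinarith

/-- Points of the graph with bounded long coordinates have short coordinates of order `τ`. -/
theorem exists_short_le (hκ : 0 < κ) (hκ1 : κ ≤ 1) (β ε R : ℝ) : ∃ C : ℝ, 0 < C ∧
    ∀ᶠ d in ctxFilter κ β ε, ∀ x y, d.Graph x y → |x.re| ≤ R → |y.im| ≤ R →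
      |x.im| ≤ C * d.τ ∧ |y.re| ≤ C * d.τ := by
  obtain ⟨lam, hlam, h⟩ := Scale.exists_norm_le hκ hκ1 R
  refine ⟨4 * lam, by linarith, ?_⟩
  filter_upwards [eventually_ctx κ β ε lam] with d hd x y hg hx hy
  obtain ⟨L, l, J, h3, h4, -⟩ := hd.1.fam lam hlam le_rfl
  have hτ := hd.1.pos
  have h5 := h _ _ _ _ _ _ _ _ _ _ hd.1.dual hd.1.base h3 (by rw [h4]; simp) x y hg.1 hg.2
    (by simpa [usc_refl] using hx) (by simpa [usc_refl] using hy)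
  rw [h4, one_mul, mul_div_assoc, div_self hτ.ne', mul_one] at h5
  rw [usc_refl, usc_refl] at h5
  have h6 := Complex.abs_im_le_norm (⟨x.re / 1, x.im / d.τ⟩ : ℂ)
  have h7 := Complex.abs_re_le_norm (⟨y.re / d.τ, y.im / 1⟩ : ℂ)
  simp only [abs_div, abs_of_pos hτ] at h6 h7
  rw [div_le_iff₀ hτ] at h6 h7
  have h8 := norm_nonneg (⟨x.re / 1, x.im / d.τ⟩ : ℂ)
  have h9 := norm_nonneg (⟨y.re / d.τ, y.im / 1⟩ : ℂ)
  constructor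
  · exact h6.trans (by gcongr; linarith)
  · exact h7.trans (by gcongr; linarith)

theorem Complex.inner_le_long_short (x y : ℂ) :
    ⟪x, y⟫ ≤ ‖(⟨x.re, y.im⟩ : ℂ)‖ * ‖(⟨y.re, x.im⟩ : ℂ)‖ := by
  have := real_inner_le_norm (⟨x.re, y.im⟩ : ℂ) ⟨y.re, x.im⟩
  simp only [cinner] at this ⊢
  linarith

theorem Complex.long_le (x y : ℂ) : ‖(⟨x.re, y.im⟩ : ℂ)‖ ≤ ‖x‖ + ‖y‖ :=
  (Complex.norm_le_abs_re_add_abs_im _).trans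
    (add_le_add (Complex.abs_re_le_norm x) (Complex.abs_im_le_norm y))

/-- Superlinear growth of the short coordinates along the graph. -/
theorem exists_le_short (hκ : 0 < κ) (hκ1 : κ ≤ 1) (hε : 0 < ε) (β : ℝ) : ∃ c r₀ : ℝ, 0 < c ∧ 1 ≤ r₀ ∧
    ∀ R, ∀ᶠ d in ctxFilter κ β ε, ∀ x y, d.Graph x y → r₀ ≤ ‖(⟨x.re, y.im⟩ : ℂ)‖ →
      ‖(⟨x.re, y.im⟩ : ℂ)‖ ≤ R →
      c * ‖(⟨x.re, y.im⟩ : ℂ)‖ ^ (1 + ε) * d.τ ≤ ‖(⟨y.re, x.im⟩ : ℂ)‖ := by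
  obtain ⟨C₀, hC₀, hn⟩ := exists_near hκ hκ1 β ε
  obtain ⟨φ, hφ, hin⟩ := Scale.exists_le_inner hκ hκ1 one_pos
  have hC0 : 0 < C₀ := by linarith
  refine ⟨φ * (C₀ ^ (2 + ε))⁻¹, C₀, by positivity, hC₀, fun R => ?_⟩
  obtain ⟨M, -, hn⟩ := hn R
  filter_upwards [eventually_ctx κ β ε 0, hn] with d hd hn x y hg h1 h2
  obtain ⟨m, L, l, J, hm, -, h3, h4, h5, h6⟩ := hn _ h1 h2
  have hτ := hd.1.pos
  have h7 := hin _ _ _ _ L l J hd.1.dual h4.scale x y hg.1 hg.2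
    (by linarith [Complex.long_le x y])
  have h8 := h7.trans (Complex.inner_le_long_short x y)
  set ρ := ‖(⟨x.re, y.im⟩ : ℂ)‖ with hρ
  have hρ0 : 0 < ρ := by linarith
  have hL := h4.scale.pos
  have h9 : d.τ * ((ρ / C₀) ^ ε * ((ρ / C₀) * (ρ / C₀))) ≤ L * l := by
    have e1 : ρ / C₀ ≤ m := by rw [div_le_iff₀ hC0]; linarith
    have e2 : ρ / C₀ ≤ L := by rw [div_le_iff₀ hC0]; linarith
    calc d.τ * ((ρ / C₀) ^ ε * ((ρ / C₀) * (ρ / C₀))) ≤ d.τ * (m ^ ε * (L * L)) := by gcongr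
      _ = L * (d.τ * m ^ ε * L) := by ring
      _ ≤ L * l := by gcongr; exact h4.decay
  have h10 : φ * (C₀ ^ (2 + ε))⁻¹ * ρ ^ (1 + ε) * d.τ * ρ =
      φ * (d.τ * ((ρ / C₀) ^ ε * ((ρ / C₀) * (ρ / C₀)))) := by
    rw [Real.div_rpow hρ0.le hC0.le, Real.rpow_add hC0, Real.rpow_add hρ0, Real.rpow_one,
      Real.rpow_two]
    field_simp
  refine le_of_mul_le_mul_right ?_ hρ0
  rw [h10, mul_comm _ ρ]
  exact (mul_le_mul_of_nonneg_left h9 hφ.le).trans h8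

end

section

variable {κ β ε : ℝ}

theorem NormalizedAt.norm_usc_sub_le {u : ℂ → ℝ} {A : Set ℂ} {L l : ℝ} {J : ℂ ≃ₗᵢ[ℝ] ℂ}
    (h : NormalizedAt κ u A L l J) {x y : ℂ} (hs : IsSub u x y) {r : ℝ} (hr : 0 < r)
    (hx : ‖usc L l J x‖ + r ≤ 1) : ‖usc l L J y‖ ≤ 1 / κ / r := by
  obtain ⟨hL, hl, hN⟩ := h
  have h1 : IsSub (fun a => u (sc L l J a) / (L * l)) (usc L l J x) (usc l L J y) := by
    rw [isSub_sc hL hl, sc_usc hL hl, sc_usc hl hL]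
    exact hs
  refine h1.norm_le_of_bound (hN.nonneg _) hr fun w hw => hN.bound w ?_
  have := norm_add_le (w - usc L l J x) (usc L l J x)
  rw [sub_add_cancel] at this
  linarith

/-- Either the source lies almost in a half plane, or it contains a point well below it. -/
theorem eventually_low_or_dip (hκ : 0 < κ) {K : ℝ} (hK : 1 ≤ K) :
    ∃ C : ℝ, 0 < C ∧ ∀ᶠ d in ctxFilter κ β ε, d.Low C ∨ d.Dip K := by
  refine ⟨K + 2 / κ * (K + 1 / 2), by positivity, ?_⟩
  filter_upwards [eventually_ctx κ β ε 0] with d hd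
  have hτ := hd.1.pos
  obtain ⟨-, -, hN⟩ := hd.1.base.fst
  obtain ⟨a, ha, hball⟩ := hN.ball
  have hare := (Complex.abs_re_le_norm a).trans ha
  have haim := (Complex.abs_im_le_norm a).trans ha
  by_cases hk : (⟨a.re, -(K * d.τ)⟩ : ℂ) ∈ d.A
  · exact Or.inr ⟨_, hk, hare, rfl⟩
  left
  obtain ⟨n, hn⟩ := exists_outer_normal hd.1.dual.convex hd.1.dual.isOpen hk
  simp only [cinner] at hn
  have hmem : ∀ b : ℂ, ‖b‖ < κ → (⟨a.re + b.re, d.τ * (a.im + b.im)⟩ : ℂ) ∈ d.A := by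
    intro b hb
    have := hball (show a + b ∈ ball a κ by simpa using hb)
    simpa [sc_refl] using this
  have h0 := hn _ (hmem 0 (by simpa using hκ))
  have h1 := hn _ (hmem ((κ / 2 : ℝ) : ℂ) (by
    rw [Complex.norm_real, Real.norm_eq_abs, abs_of_pos (by positivity)]; linarith))
  have h2 := hn _ (hmem ((-(κ / 2) : ℝ) : ℂ) (by
    rw [Complex.norm_real, Real.norm_eq_abs, abs_neg, abs_of_pos (by positivity)]; linarith))
  simp only [Complex.zero_re, Complex.zero_im, Complex.ofReal_re, Complex.ofReal_im, add_zero]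
    at h0 h1 h2
  obtain ⟨q, hq⟩ : ∃ q, q = -(d.τ * n.im) := ⟨_, rfl⟩
  rw [abs_le] at haim hare
  have hq0 : 0 < q := by
    have : q * (a.im + K) > 0 := by rw [hq]; linarith
    exact (pos_iff_pos_of_mul_pos this).2 (by linarith)
  have hq1 : |n.re| ≤ 2 / κ * (K + 1 / 2) * q := by
    have e1 : |n.re| * (κ / 2) ≤ (K + a.im) * q := by
      rw [hq]
      rcases abs_cases n.re with ⟨h, -⟩ | ⟨h, -⟩ <;> rw [h] <;> linarith
    have e2 : (K + a.im) * q ≤ (K + 1 / 2) * q := by gcongr; linarith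
    calc |n.re| = 2 / κ * (|n.re| * (κ / 2)) := by field_simp
      _ ≤ 2 / κ * ((K + 1 / 2) * q) :=
          mul_le_mul_of_nonneg_left (e1.trans e2) (by positivity)
      _ = _ := by ring
  intro x hx
  have h3 := hn x hx
  set D := 2 / κ * (K + 1 / 2) with hD
  have hD0 : 0 < D := by positivity
  have h4 : n.re * (a.re - x.re) ≤ D * q * (1 / 2 + |x.re|) := by
    refine (le_abs_self _).trans ?_
    rw [abs_mul]
    have : |a.re - x.re| ≤ 1 / 2 + |x.re| := by
      refine (abs_sub _ _).trans ?_
      gcongr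
      exact abs_le.2 hare
    gcongr
  have h5 : 0 ≤ q * (x.im + (K + D) * d.τ * (1 + |x.re|)) := by
    have e1 : d.τ * n.re * (a.re - x.re) ≤ d.τ * (D * q * (1 / 2 + |x.re|)) := by
      rw [mul_assoc]; gcongr
    have e2 : n.im * d.τ = -q := by rw [hq]; ring
    have e3 : d.τ * (n.re * x.re + n.im * x.im) < d.τ * (n.re * a.re + n.im * (-(K * d.τ))) := by
      gcongr
    have e4 : d.τ * (n.im * x.im) = -q * x.im := by rw [← e2]; ring
    have e5 : d.τ * (n.im * (-(K * d.τ))) = q * K * d.τ := by rw [hq]; ring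
    have e6 : 0 ≤ q * K * d.τ * |x.re| := by positivity
    have e7 : 0 ≤ d.τ * D * q := by positivity
    linarith
  have h6 := nonneg_of_mul_nonneg_right h5 hq0
  linarith

/-- Source and target cannot both dip far below their respective axes. -/
theorem eventually_not_dip (hκ : 0 < κ) (hκ1 : κ ≤ 1) (hβ : 0 < β) (ε : ℝ) : ∃ K : ℝ, 1 ≤ K ∧
    ∀ᶠ d in ctxFilter κ β ε, ¬ (d.Dip K ∧ d.swap.Dip K) := by
  obtain ⟨φ, hφ, hg⟩ := linear_growth hκ hκ1 (ρ := 1 / 4) (by norm_num)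
  have hK0 : 0 < 8 / (κ * φ) := by positivity
  refine ⟨1 + 8 / (κ * φ), by linarith, ?_⟩
  obtain ⟨K, hK⟩ : ∃ K, K = 1 + 8 / (κ * φ) := ⟨_, rfl⟩
  rw [← hK]
  have hK1 : 1 ≤ K := by linarith
  have hKφ : 8 ≤ K * (κ * φ) := by
    have : 8 / (κ * φ) ≤ K := by linarith
    rwa [div_le_iff₀ (by positivity)] at this
  filter_upwards [eventually_ctx κ β ε 0, eventually_mul_lt (κ := κ) (β := β) (ε := ε) K hβ,
    eventually_lt (κ := κ) (β := β) (ε := ε) hβ] with d hd hτβ hτβ' hdip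
  have hτ := hd.1.pos
  have hp := hd.1.dual
  obtain ⟨⟨k₁, hk₁, hk₁r, hk₁i⟩, ⟨k₂, hk₂, hk₂r, hk₂i⟩⟩ := hdip
  obtain ⟨⟨g₁, hg₁, hg₁n, hg₁i⟩, ⟨g₂, hg₂, hg₂n, hg₂r⟩⟩ := hd.2
  have hg₁r := (Complex.abs_re_le_norm g₁).trans hg₁n
  have hg₂i := (Complex.abs_im_le_norm g₂).trans hg₂n
  obtain ⟨m, hm⟩ := exists_outer_normal hp.convex' hp.isOpen' hp.zero_notMem'
  have hmcl : ∀ y ∈ closure d.B, ⟪m, y⟫ ≤ 0 := fun y hy =>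
    inner_le_of_mem_closure (fun y' hy' => by simpa using (hm y' hy').le) hy
  have h1 := hm _ hk₂
  have h2 := hm _ hg₂
  simp only [cinner, Complex.zero_re, Complex.zero_im, mul_zero, add_zero, diagRefl_re,
    diagRefl_im, hk₂i] at h1 h2 hmcl
  change _ + m.im * k₂.re < 0 at h1
  -- slope of the normal
  have hslope : K * |d.τ * m.re| ≤ |m.im| := by
    have e1 : |m.im * k₂.re| ≤ |m.im| * (1 / 2) := by
      rw [abs_mul]; gcongr
    have e2 : |m.im * g₂.im| ≤ |m.im| * 1 := by
      rw [abs_mul]; gcongr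
    rw [abs_le] at e1 e2
    rcases abs_cases (d.τ * m.re) with ⟨h, h'⟩ | ⟨h, h'⟩ <;> rw [h]
    · have hmre : 0 ≤ m.re := by
        by_contra hc; push Not at hc; nlinarith
      have e3 : m.re * (K * d.τ) ≤ m.re * g₂.re := by gcongr; linarith
      linarith [e2.1]
    · change m.re * -(K * d.τ) + _ < 0 at h1
      linarith [e1.1, abs_nonneg m.im]
  have hpt : ∀ (x : ℂ) (σ : ℝ), x ∈ d.A → σ * σ = 1 → |x.re| ≤ 1 / (4 * K) → x.im = σ * (d.τ / 4) →
      ∃ y ∈ closure d.B, |y.re / d.τ| ≤ 2 / κ ∧ φ / 2 ≤ σ * y.im := by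
    intro x σ hx hσ hxr hxi
    obtain ⟨y, hy⟩ := exists_isSub hp.convexOn x
    have hσa : |σ| = 1 := by
      rcases mul_self_eq_one_iff.1 hσ with h | h <;> rw [h] <;> simp
    have hxK : |x.re| ≤ 1 / 4 := hxr.trans (by
      apply one_div_le_one_div_of_le <;> linarith)
    have hxu : usc 1 d.τ (LinearIsometryEquiv.refl ℝ ℂ) x = ⟨x.re, σ / 4⟩ := by
      rw [usc_refl, hxi]
      apply Complex.ext
      · simp
      · change σ * (d.τ / 4) / d.τ = σ / 4
        field_simp
    have hn1 : ‖(⟨x.re, σ / 4⟩ : ℂ)‖ ≤ 1 / 2 := by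
      refine (Complex.norm_le_abs_re_add_abs_im _).trans ?_
      simp only [abs_div, hσa, abs_of_pos (by norm_num : (0 : ℝ) < 4)]
      linarith
    have hn2 : 1 / 4 ≤ ‖(⟨x.re, σ / 4⟩ : ℂ)‖ := by
      refine le_trans ?_ (Complex.abs_im_le_norm _)
      simp only [abs_div, hσa, abs_of_pos (by norm_num : (0 : ℝ) < 4), le_refl]
    have hy1 := hd.1.base.fst.norm_usc_sub_le hy (r := 1 / 2) (by norm_num) (by rw [hxu]; linarith)
    have hy2 := hd.1.base.fst.growth hg (subset_closure hx) (by rw [hxu]; exact hn2)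
    have hy3 := (hp.le_inner hy).1
    rw [hxu, one_mul] at hy2
    have hyr : |y.re / d.τ| ≤ 2 / κ := by
      refine (Complex.abs_re_le_norm (usc d.τ 1 (LinearIsometryEquiv.refl ℝ ℂ) y)).trans
        (hy1.trans (le_of_eq ?_))
      field_simp
    refine ⟨y, hp.mem hy, hyr, ?_⟩
    rw [cinner, hxi] at hy3
    have e1 : x.re * y.re ≤ 1 / (4 * K) * (2 / κ) * d.τ := by
      have : x.re * y.re = x.re * (y.re / d.τ) * d.τ := by field_simp
      rw [this]
      refine mul_le_mul_of_nonneg_right ((le_abs_self _).trans ?_) hτ.le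
      rw [abs_mul]
      gcongr
    have e2 : φ * (1 / 4) * d.τ ≤ φ * ‖(⟨x.re, σ / 4⟩ : ℂ)‖ * d.τ := by gcongr
    have e3 : (φ * (1 / 4)) * d.τ ≤ (1 / (4 * K) * (2 / κ) + σ * y.im / 4) * d.τ := by linarith
    have e4 := le_of_mul_le_mul_right e3 hτ
    have e5 : 1 / (4 * K) * (2 / κ) ≤ φ / 16 := by
      rw [div_mul_div_comm, div_le_div_iff₀ (by positivity) (by norm_num)]
      linarith
    linarith
  have hconcl : ∀ σ : ℝ, 0 ≤ σ * m.im →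
      (∃ y ∈ closure d.B, |y.re / d.τ| ≤ 2 / κ ∧ φ / 2 ≤ σ * y.im) → |σ| = 1 → m.im = 0 := by
    rintro σ hσ ⟨y, hy, hy1, hy2⟩ hσ1
    have e1 := hmcl y hy
    have e2 : m.re * y.re = d.τ * m.re * (y.re / d.τ) := by field_simp
    have e3 : |d.τ * m.re * (y.re / d.τ)| ≤ |d.τ * m.re| * (2 / κ) := by
      rw [abs_mul]; gcongr
    have hσσ : σ * σ = 1 := by rw [← abs_mul_abs_self, hσ1, one_mul]
    have e4 : m.im * y.im = |m.im| * (σ * y.im) := by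
      have : |m.im| = σ * m.im := by
        rw [← abs_of_nonneg hσ, abs_mul, hσ1, one_mul]
      rw [this]
      calc m.im * y.im = (σ * σ) * (m.im * y.im) := by rw [hσσ, one_mul]
        _ = _ := by ring
    have e5 : |m.im| * (φ / 2) ≤ |m.im| * (σ * y.im) := by gcongr
    have e6 : K * (|m.im| * (φ / 2)) ≤ |m.im| * (2 / κ) := by
      have : |m.im| * (φ / 2) ≤ |d.τ * m.re| * (2 / κ) := by
        linarith [neg_abs_le (d.τ * m.re * (y.re / d.τ))]
      calc _ ≤ K * (|d.τ * m.re| * (2 / κ)) := by gcongr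
        _ = K * |d.τ * m.re| * (2 / κ) := by ring
        _ ≤ _ := by gcongr
    have e7 : |m.im| * (K * (κ * φ)) ≤ |m.im| * 4 := by
      calc |m.im| * (K * (κ * φ)) = 2 * κ * (K * (|m.im| * (φ / 2))) := by ring
        _ ≤ 2 * κ * (|m.im| * (2 / κ)) := by gcongr
        _ = _ := by field_simp; ring
    have e8 : |m.im| * 8 ≤ |m.im| * (K * (κ * φ)) := by gcongr
    exact abs_nonpos_iff.1 (by linarith)
  have hm0 : m.im = 0 := by
    rcases le_total 0 m.im with h | h
    · refine hconcl 1 (by simpa using h) ?_ (by simp)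
      refine hpt (((d.τ / (4 * g₁.im) : ℝ)) • g₁) 1 (hp.convex.smul_mem_of_zero_mem_closure
        hp.isOpen hp.zero_mem hg₁ (by have := hβ.trans_le hg₁i; positivity) ?_) (by norm_num) ?_ ?_
      · rw [div_le_one (by linarith)]; linarith
      · have h0 := hβ.trans_le hg₁i
        rw [Complex.smul_re, smul_eq_mul, abs_mul, abs_of_pos (by positivity)]
        calc d.τ / (4 * g₁.im) * |g₁.re| ≤ d.τ / (4 * g₁.im) * 1 := by gcongr
          _ = d.τ / (4 * g₁.im) := mul_one _
          _ ≤ _ := by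
            rw [div_le_div_iff₀ (by positivity) (by positivity)]
            nlinarith
      · have h0 := hβ.trans_le hg₁i
        rw [Complex.smul_im, smul_eq_mul]
        field_simp
    · refine hconcl (-1) (by linarith) ?_ (by simp)
      refine hpt (((1 / (4 * K) : ℝ)) • k₁) (-1) (hp.convex.smul_mem_of_zero_mem_closure
        hp.isOpen hp.zero_mem hk₁ (by positivity) ?_) (by norm_num) ?_ ?_
      · rw [div_le_one (by linarith)]; linarith
      · rw [Complex.smul_re, smul_eq_mul, abs_mul, abs_of_pos (by positivity)]
        have : 1 / (4 * K) * |k₁.re| ≤ 1 / (4 * K) * 1 := by gcongr; linarith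
        linarith
      · rw [Complex.smul_im, smul_eq_mul, hk₁i]
        field_simp
  rw [hm0, abs_zero] at hslope
  have hz : d.τ * m.re = 0 := abs_nonpos_iff.1 (by nlinarith [abs_nonneg (d.τ * m.re)])
  rw [hm0, (mul_eq_zero.1 hz).resolve_left hτ.ne'] at h2
  simp at h2

end

section

variable {κ β ε : ℝ}

theorem norm_le_mul_norm_usc_swap {L l : ℝ} {J : ℂ ≃ₗᵢ[ℝ] ℂ} (hL : 0 < L) (hl : 0 < l) (h : l ≤ L)
    (y : ℂ) : ‖y‖ ≤ L * ‖usc l L J y‖ := by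
  have := norm_le_mul_norm_usc (J := diagRefl.trans J) hL hl h y
  have e : usc L l (diagRefl.trans J) y = diagRefl (usc l L J y) := by
    apply Complex.ext <;> simp [usc]
  rwa [e, diagRefl.norm_map] at this

theorem Config.Fam.le_of_le {d : Config} {m L l : ℝ} {J : ℂ ≃ₗᵢ[ℝ] ℂ} (h : d.Fam κ ε m L l J)
    (hτ : 0 < d.τ) (hε : 0 < ε) (hm : 1 ≤ m) : d.τ * L ≤ l := by
  refine le_trans ?_ h.decay
  have h1 := Real.one_le_rpow hm hε.le
  have h2 := h.scale.pos
  calc d.τ * L = d.τ * 1 * L := by ring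
    _ ≤ _ := by gcongr

theorem Config.Fam.le_mul {d : Config} {m L l M : ℝ} {J : ℂ ≃ₗᵢ[ℝ] ℂ} (h : d.Fam κ ε m L l J)
    (hτ : 0 < d.τ) (hL : 1 ≤ L) (hm : m ≤ M) : l ≤ M * d.τ := by
  have h2 := h.scale.pos'
  calc l ≤ L * l := by nlinarith
    _ = m * d.τ := h.mul_eq
    _ ≤ _ := by gcongr

/-- At every scale there is a small point of the source with a subgradient which is comparable to
the scale and points upwards. -/
theorem exists_pole (hκ : 0 < κ) (hκ1 : κ ≤ 1) (hβ : 0 < β) (hε : 0 < ε) {C : ℝ} (hC : 0 < C) :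
    ∃ r c : ℝ, 1 ≤ r ∧ 0 < c ∧ ∀ R M, ∀ᶠ d in ctxFilter κ β ε, d.Low C → ∀ m L l J, 1 ≤ m → m ≤ M →
      d.Fam κ ε m L l J → r ≤ L → L ≤ R → ∃ x ∈ d.A, ∃ y, IsSub d.u x y ∧
        1 / 4 ≤ ‖usc L l J x‖ ∧ ‖usc L l J x‖ ≤ 1 / 2 ∧ ‖usc l L J y‖ ≤ 2 / κ ∧
        ‖x‖ ≤ l / (4 * β) ∧ c * L ≤ y.im ∧ y.im ≤ 2 / κ * L := by
  obtain ⟨φ, hφ, hg⟩ := linear_growth hκ hκ1 (ρ := 1 / 4) (by norm_num)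
  have hr0 : 0 < 32 * C / (φ * κ) := by positivity
  refine ⟨1 + 32 * C / (φ * κ), φ * β / 2, by linarith, by positivity, fun R M => ?_⟩
  obtain ⟨D, hD, hshort⟩ := exists_short_le hκ hκ1 β ε (2 / κ * |R| + 1)
  filter_upwards [eventually_ctx κ β ε 0, hshort, eventually_mul_lt (κ := κ) (β := β) (ε := ε) M hβ,
    eventually_mul_lt (κ := κ) (β := β) (ε := ε) D (c := φ * β / 2) (by positivity)]
    with d hd hshort hMτ hDτ hlow m L l J hm hmM hfam hLr hLR
  have hτ := hd.1.pos
  have hp := hd.1.dual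
  have hL := hfam.scale.pos
  have hl := hfam.scale.pos'
  have hL1 : 1 ≤ L := by linarith
  have hlM := hfam.le_mul hτ hL1 hmM
  have hlβ : l < β := hlM.trans_lt hMτ
  have hlL := hfam.le_of_le hτ hε hm
  obtain ⟨g, hgA, hg1, hgβ⟩ := hd.1.fat (J Complex.I) (by simp)
  obtain ⟨a, ha⟩ : ∃ a, a = |⟪g, J Complex.I⟫| := ⟨_, rfl⟩
  have hgim : ⟪g, J Complex.I⟫ = (J.symm g).im := by
    rw [← J.symm.inner_map_map, LinearIsometryEquiv.symm_apply_apply, cinner]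
    simp
  rw [← ha] at hgβ
  have ha0 : 0 < a := by linarith
  have hla : 0 < l / (4 * a) := by positivity
  have hlaβ : l / (4 * a) ≤ l / (4 * β) := by gcongr
  have hlaβ4 : l / (4 * β) ≤ 1 / 4 := by
    rw [div_le_div_iff₀ (by positivity) (by norm_num)]; linarith
  set x := (l / (4 * a)) • g with hx
  have hxA : x ∈ d.A := hp.convex.smul_mem_of_zero_mem_closure hp.isOpen hp.zero_mem hgA hla
    (by linarith)
  have hxn : ‖x‖ ≤ l / (4 * β) := by
    rw [hx, norm_smul, Real.norm_eq_abs, abs_of_pos hla]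
    calc l / (4 * a) * ‖g‖ ≤ l / (4 * a) * 1 := by gcongr
      _ ≤ _ := by linarith
  have hxi : |(usc L l J x).im| = 1 / 4 := by
    rw [hx, usc_smul, Complex.smul_im, smul_eq_mul, abs_mul, abs_of_pos hla, usc]
    simp only [abs_div, abs_of_pos hl]
    rw [← hgim, ← ha]
    field_simp
  have hxr : |(usc L l J x).re| ≤ 1 / 4 := by
    refine (Complex.abs_re_usc_le hL x).trans ?_
    rw [div_le_iff₀ hL]
    linarith
  have hu1 : 1 / 4 ≤ ‖usc L l J x‖ := hxi ▸ Complex.abs_im_le_norm _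
  have hu2 : ‖usc L l J x‖ ≤ 1 / 2 := by
    refine (Complex.norm_le_abs_re_add_abs_im _).trans ?_
    linarith
  obtain ⟨y, hy⟩ := exists_isSub hp.convexOn x
  have hy1 : ‖usc l L J y‖ ≤ 2 / κ :=
    (hfam.scale.fst.norm_usc_sub_le hy (r := 1 / 2) (by norm_num) (by linarith)).trans
      (le_of_eq (by field_simp))
  have hyq : |y.im| ≤ 2 / κ * L := by
    refine (Complex.abs_im_le_norm y).trans ((norm_le_mul_norm_usc_swap hL hl hfam.scale.le y
      (J := J)).trans ?_)
    rw [mul_comm]; gcongr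
  have hκ2 : 0 < 2 / κ := by positivity
  have hyR : |y.im| ≤ 2 / κ * |R| + 1 := by
    have : 2 / κ * L ≤ 2 / κ * |R| := by gcongr; exact hLR.trans (le_abs_self R)
    linarith
  have hxre := (Complex.abs_re_le_norm x).trans hxn
  have hxim := (Complex.abs_im_le_norm x).trans hxn
  have hpD := (hshort x y ⟨subset_closure hxA, hy⟩ (by nlinarith [abs_nonneg R]) hyR).2
  have hen : φ * (1 / 4) * (L * l) ≤ x.re * y.re + x.im * y.im := by
    have e1 := hfam.scale.fst.growth hg (subset_closure hxA) hu1
    have e2 := (hp.le_inner hy).1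
    rw [cinner] at e2
    have e3 : φ * (1 / 4) * (L * l) ≤ φ * ‖usc L l J x‖ * (L * l) := by gcongr
    linarith
  have hsp : x.re * y.re ≤ φ / 8 * (L * l) := by
    refine (le_abs_self _).trans ?_
    rw [abs_mul]
    calc |x.re| * |y.re| ≤ l / (4 * β) * (D * d.τ) := by gcongr
      _ ≤ l / (4 * β) * (φ * β / 2) := by gcongr
      _ = φ / 8 * (1 * l) := by field_simp; ring
      _ ≤ _ := by gcongr
  have htq : φ / 8 * (L * l) ≤ x.im * y.im := by linarith
  have htq0 : 0 < x.im * y.im := lt_of_lt_of_le (by positivity) htq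
  have ht : 0 < x.im := by
    by_contra hc
    push Not at hc
    have e1 := hlow x hxA
    have e2 : -x.im ≤ 2 * C * d.τ := by
      have : C * d.τ * (1 + |x.re|) ≤ C * d.τ * 2 := by gcongr; linarith
      linarith
    have e3 : x.im * y.im ≤ 2 * C * d.τ * (2 / κ * L) := by
      calc x.im * y.im ≤ |x.im * y.im| := le_abs_self _
        _ = (-x.im) * |y.im| := by rw [abs_mul, abs_of_nonpos hc]
        _ ≤ _ := by gcongr
    have e4 : φ / 8 * (L * (d.τ * L)) ≤ φ / 8 * (L * l) := by gcongr
    have e5 : d.τ * L * (φ / 8 * L) ≤ d.τ * L * (2 * C * (2 / κ)) := by linarith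
    have e6 := le_of_mul_le_mul_left e5 (by positivity)
    have e7 : L ≤ 32 * C / (φ * κ) := by
      rw [le_div_iff₀ (by positivity)]
      calc L * (φ * κ) = 8 * κ * (φ / 8 * L) := by ring
        _ ≤ 8 * κ * (2 * C * (2 / κ)) := by gcongr
        _ = _ := by field_simp; ring
    linarith
  have hq : 0 < y.im := (pos_iff_pos_of_mul_pos htq0).1 ht
  refine ⟨x, hxA, y, hy, hu1, hu2, hy1, hxn, ?_, (le_abs_self _).trans hyq⟩
  have e1 : x.im * y.im ≤ l / (4 * β) * y.im := by
    gcongr; exact (le_abs_self _).trans hxim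
  have e2 : φ * β / 2 * L * (l / (4 * β)) ≤ y.im * (l / (4 * β)) := by
    calc _ = φ / 8 * (L * l) := by field_simp; ring
      _ ≤ y.im * (l / (4 * β)) := by linarith
  exact le_of_mul_le_mul_right e2 (by positivity)

end

section

variable {κ β ε : ℝ}

theorem DualPair.growth_le {u v : ℂ → ℝ} {A B : Set ℂ} (h : DualPair u v A B) {c : ℂ}
    {a₁ a₂ a b w Z₁ Z₂ : ℝ} (hc : ‖c‖ = 1) (ha : a₁ ≤ a₂) (hab : a ≤ b) (hw : w < 2 * Real.pi)
    (hZ₂ : 0 < Z₂)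
    (hz : ∀ ω : ℂ, ω.re ∈ Icc a₁ a₂ → ω.im ∈ Icc a b → ∀ x y, x ∈ closure A → IsSub u x y →
      x + y = Complex.exp ω → x ∈ A ∧ (⟨y.re, x.im⟩ : ℂ) ≠ 0 ∧ |(c * ⟨y.re, x.im⟩).arg| ≤ w / 2)
    (h₁ : ∀ ω : ℂ, ω.re = a₁ → ω.im ∈ Icc a b → ∀ x y, x ∈ closure A → IsSub u x y →
      x + y = Complex.exp ω → ‖(⟨y.re, x.im⟩ : ℂ)‖ ≤ Z₁)
    (h₂ : ∀ ω : ℂ, ω.re = a₂ → ω.im ∈ Icc a b → ∀ x y, x ∈ closure A → IsSub u x y →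
      x + y = Complex.exp ω → Z₂ ≤ ‖(⟨y.re, x.im⟩ : ℂ)‖)
    (hne : ∃ ω : ℂ, ω.re ∈ Icc a₁ a₂ ∧ ω.im ∈ Icc a b ∧ ∃ x ∈ A, ∃ y, IsSub u x y ∧
      x + y = Complex.exp ω) :
    (b - a) * (Real.log Z₂ - Real.log Z₁) ≤ w * (a₂ - a₁) := by
  obtain ⟨x, hx⟩ := exists_isProx h.convexOn h.nonneg
  have hxc : Continuous x := (hx.lipschitz).continuous
  set S : Set ℂ := {ω | ω.re ∈ Icc a₁ a₂ ∧ ω.im ∈ Icc a b} with hS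
  have hSc : IsPreconnected S :=
    (((convex_Icc a₁ a₂).linear_preimage Complex.reLm).inter
      ((convex_Icc a b).linear_preimage Complex.imLm)).isPreconnected
  set T : Set ℂ := {ω | x (Complex.exp ω) ∈ A} with hT
  have hTo : IsOpen T := h.isOpen.preimage (hxc.comp Complex.continuous_exp)
  have hST : S ⊆ T := by
    refine hSc.subset_of_closure_inter_subset hTo ?_ ?_
    · obtain ⟨ω, h1, h2, x₀, hx₀, y, hy, he⟩ := hne
      refine ⟨ω, ⟨h1, h2⟩, ?_⟩
      change x (Complex.exp ω) ∈ A
      rwa [← he, hx.eq_of_isSub hy]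
    · rintro ω ⟨h1, h2⟩
      have h3 : x (Complex.exp ω) ∈ closure A :=
        (hxc.comp Complex.continuous_exp).closure_preimage_subset A h1
      exact (hz ω h2.1 h2.2 _ _ h3 (hx _) (by simp)).1
  have hcl : ∀ ω ∈ S, x (Complex.exp ω) ∈ closure A := fun ω hω => subset_closure (hST hω)
  refine growth_le_of_sector (z := fun X => ⟨X.re - (x X).re, (x X).im⟩) hc ha hab hw hZ₂ ?_ ?_ ?_
  · intro ω h1 h2
    refine ⟨?_, (hz ω h1 h2 _ _ (hcl ω ⟨h1, h2⟩) (hx _) (by simp)).2⟩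
    exact (IsProx.differentiableOn_z h.convexOn hx h.isOpen h.alex).differentiableAt
      ((h.isOpen.preimage hxc).mem_nhds (hST ⟨h1, h2⟩))
  · intro ω h1 h2
    exact h₁ ω h1 h2 _ _ (hcl ω ⟨⟨h1.ge, by rw [h1]; exact ha⟩, h2⟩) (hx _) (by simp)
  · intro ω h1 h2
    exact h₂ ω h1 h2 _ _ (hcl ω ⟨⟨by rw [h1]; exact ha, h1.le⟩, h2⟩) (hx _) (by simp)

/-- Points of the graph with bounded sum are close to their long part. -/
theorem eventually_close (hκ : 0 < κ) (hκ1 : κ ≤ 1) (β ε R : ℝ) {η : ℝ} (hη : 0 < η) :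
    ∀ᶠ d in ctxFilter κ β ε, ∀ x y, d.Graph x y → ‖x + y‖ ≤ R →
      ‖(⟨x.re, y.im⟩ : ℂ)‖ ≤ ‖x + y‖ ∧ ‖(⟨y.re, x.im⟩ : ℂ)‖ ≤ η ∧
      ‖x + y‖ ≤ ‖(⟨x.re, y.im⟩ : ℂ)‖ + η := by
  obtain ⟨D, hD, hs⟩ := exists_short_le hκ hκ1 β ε R
  filter_upwards [eventually_ctx κ β ε 0, hs, eventually_mul_lt (2 * D) hη]
    with d hd hs hτ x y hg hR
  have hsum : x + y = ⟨x.re, y.im⟩ + ⟨y.re, x.im⟩ := by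
    apply Complex.ext <;> simp [add_comm]
  have hin : 0 ≤ ⟪(⟨x.re, y.im⟩ : ℂ), ⟨y.re, x.im⟩⟫ := by
    have := hd.1.dual.inner_nonneg hg.2
    simp only [cinner] at this ⊢
    linarith
  have h1 : ‖(⟨x.re, y.im⟩ : ℂ)‖ ≤ ‖x + y‖ := by
    rw [hsum]
    refine le_of_sq_le_sq ?_ (norm_nonneg _)
    rw [norm_add_sq_real]
    nlinarith [sq_nonneg ‖(⟨y.re, x.im⟩ : ℂ)‖]
  have h2 := hs x y hg ((Complex.abs_re_le_norm (⟨x.re, y.im⟩ : ℂ)).trans (h1.trans hR))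
    ((Complex.abs_im_le_norm (⟨x.re, y.im⟩ : ℂ)).trans (h1.trans hR))
  have h3 : ‖(⟨y.re, x.im⟩ : ℂ)‖ ≤ η := by
    refine (Complex.norm_le_abs_re_add_abs_im _).trans ?_
    simp only
    linarith
  exact ⟨h1, h3, by rw [hsum]; exact (norm_add_le _ _).trans (by gcongr)⟩

/-- The closed annular sector of radii `r ≤ R` and angles `a ≤ b`. -/
def annSector (a b r R : ℝ) : Set ℂ :=
  {X | ∃ ω : ℂ, ω.re ∈ Icc (Real.log r) (Real.log R) ∧ ω.im ∈ Icc a b ∧ X = Complex.exp ω}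

theorem mem_annSector {a b r R : ℝ} {X : ℂ} (hr : 0 < r) (hX : r ≤ ‖X‖) (hX' : ‖X‖ ≤ R)
    (ha : a ≤ X.arg) (hb : X.arg ≤ b) : X ∈ annSector a b r R := by
  have hX0 : X ≠ 0 := norm_pos_iff.1 (hr.trans_le hX)
  refine ⟨Complex.log X, ?_, ?_, (Complex.exp_log hX0).symm⟩
  · rw [Complex.log_re]
    exact ⟨Real.log_le_log hr hX, Real.log_le_log (hr.trans_le hX) hX'⟩
  · rw [Complex.log_im]
    exact ⟨ha, hb⟩

theorem norm_mem_of_mem_annSector {a b r R : ℝ} {X : ℂ} (hr : 0 < r) (hR : 0 < R)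
    (hX : X ∈ annSector a b r R) : r ≤ ‖X‖ ∧ ‖X‖ ≤ R := by
  obtain ⟨ω, h1, -, rfl⟩ := hX
  rw [Complex.norm_exp]
  exact ⟨(Real.log_le_iff_le_exp hr).1 h1.1, (Real.le_log_iff_exp_le hR).1 h1.2⟩

/-- A configuration cannot map a wide sector into a sector of comparable opening. -/
theorem exists_not_sector (hκ : 0 < κ) (hκ1 : κ ≤ 1) (hε : 0 < ε) (β : ℝ) {a b w : ℝ} {c : ℂ}
    (hab : a ≤ b) (hw : w < 2 * Real.pi) (hc : ‖c‖ = 1) (hgrow : w < (b - a) * (1 + ε)) :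
    ∃ r₀ : ℝ, 1 ≤ r₀ ∧ ∀ r, r₀ ≤ r → ∀ᶠ R in Filter.atTop, ∀ᶠ d in ctxFilter κ β ε,
      (∀ x y, d.Graph x y → x + y ∈ annSector a b r R →
        x ∈ d.A ∧ |(c * ⟨y.re, x.im⟩).arg| ≤ w / 2) →
      ¬ ∃ x ∈ d.A, ∃ y, IsSub d.u x y ∧ x + y ∈ annSector a b r R := by
  obtain ⟨c₁, r₀, hc₁, hr₀, hle⟩ := exists_le_short hκ hκ1 hε β
  refine ⟨r₀ + 1, by linarith, fun r hr => ?_⟩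
  obtain ⟨D, hD, hs⟩ := exists_short_le hκ hκ1 β ε r
  have hlim : Filter.Tendsto (fun R => ((b - a) * (1 + ε) - w) * Real.log R) Filter.atTop
      Filter.atTop := Real.tendsto_log_atTop.const_mul_atTop (by linarith)
  filter_upwards [hlim.eventually_gt_atTop (-(w * Real.log r) - (b - a) * (Real.log c₁ -
    (1 + ε) * Real.log 2 - Real.log (2 * D))), Filter.eventually_ge_atTop r] with R hR1 hR2
  filter_upwards [eventually_ctx κ β ε 0, hle R, hs,
    eventually_close hκ hκ1 β ε R (η := 1 / 2) (by norm_num)] with d hd hle hs hclose hin hne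
  have hr0 : 0 < r := by linarith
  have hR0 : 0 < R := by linarith
  have hτ := hd.1.pos
  have hlow : ∀ x y, d.Graph x y → r ≤ ‖x + y‖ → ‖x + y‖ ≤ R →
      c₁ * (‖x + y‖ / 2) ^ (1 + ε) * d.τ ≤ ‖(⟨y.re, x.im⟩ : ℂ)‖ := by
    intro x y hg h1 h2
    obtain ⟨e1, e2, e3⟩ := hclose x y hg h2
    refine le_trans ?_ (hle x y hg (by linarith) (e1.trans h2))
    gcongr
    linarith
  have key := hd.1.dual.growth_le (Z₁ := 2 * D * d.τ) (Z₂ := c₁ * (R / 2) ^ (1 + ε) * d.τ) hc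
    (Real.log_le_log hr0 hR2) hab hw (by positivity) ?_ ?_ ?_ ?_
  · rw [Real.log_mul (by positivity) hτ.ne', Real.log_mul (by positivity) (by positivity),
      Real.log_mul (by positivity) hτ.ne', Real.log_rpow (by positivity),
      Real.log_div hR0.ne' (by norm_num)] at key
    linarith
  · intro ω h1 h2 x y hx hy hxy
    have hsec : x + y ∈ annSector a b r R := ⟨ω, h1, h2, hxy⟩
    obtain ⟨e1, e2⟩ := norm_mem_of_mem_annSector hr0 hR0 hsec
    obtain ⟨h3, h4⟩ := hin x y ⟨hx, hy⟩ hsec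
    refine ⟨h3, norm_pos_iff.1 ?_, h4⟩
    have h0 : 0 < ‖x + y‖ := by linarith
    exact lt_of_lt_of_le (by positivity) (hlow x y ⟨hx, hy⟩ e1 e2)
  · intro ω h1 h2 x y hx hy hxy
    have hn : ‖x + y‖ = r := by
      rw [hxy, Complex.norm_exp, h1, Real.exp_log hr0]
    obtain ⟨e1, -⟩ := hclose x y ⟨hx, hy⟩ (by linarith)
    have h3 := hs x y ⟨hx, hy⟩
      ((Complex.abs_re_le_norm (⟨x.re, y.im⟩ : ℂ)).trans (by linarith))
      ((Complex.abs_im_le_norm (⟨x.re, y.im⟩ : ℂ)).trans (by linarith))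
    refine (Complex.norm_le_abs_re_add_abs_im _).trans ?_
    simp only
    linarith
  · intro ω h1 h2 x y hx hy hxy
    have hn : ‖x + y‖ = R := by
      rw [hxy, Complex.norm_exp, h1, Real.exp_log hR0]
    have := hlow x y ⟨hx, hy⟩ (by linarith) hn.le
    rwa [hn] at this
  · obtain ⟨x, hx, y, hy, ω, h1, h2, h3⟩ := hne
    exact ⟨ω, h1, h2, x, hx, y, hy, h3⟩

end

section

variable {κ β ε : ℝ}

theorem Complex.arg_mem_of_im {X : ℂ} {e : ℝ} (he : 0 < e) (he' : e ≤ Real.pi / 2) (hX : X ≠ 0)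
    (h : Real.sin e * ‖X‖ ≤ X.im) : e ≤ X.arg ∧ X.arg ≤ Real.pi - e := by
  have hn : 0 < ‖X‖ := norm_pos_iff.2 hX
  have hs : 0 < Real.sin e := Real.sin_pos_of_pos_of_lt_pi he (by linarith [Real.pi_pos])
  have him : 0 ≤ X.im := le_trans (by positivity) h
  have h0 : 0 ≤ X.arg := Complex.arg_nonneg_iff.2 him
  have hpi := Complex.arg_le_pi X
  have hsin : Real.sin e ≤ Real.sin X.arg := by
    rw [Complex.sin_arg, le_div_iff₀ hn]; exact h
  constructor
  · by_contra hc
    push Not at hc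
    exact absurd (Real.sin_lt_sin_of_lt_of_le_pi_div_two (by linarith) he' hc) (not_lt.2 hsin)
  · by_contra hc
    push Not at hc
    have := Real.sin_lt_sin_of_lt_of_le_pi_div_two (x := Real.pi - X.arg) (y := e)
      (by linarith) he' (by linarith)
    rw [Real.sin_pi_sub] at this
    linarith

theorem im_ge_of_mem_annSector {a b e r R : ℝ} {X : ℂ} (he : 0 < e) (he' : e ≤ Real.pi / 2)
    (ha : e ≤ a) (hb : b ≤ Real.pi - e) (hX : X ∈ annSector a b r R) :
    Real.sin e * ‖X‖ ≤ X.im := by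
  obtain ⟨ω, -, h2, rfl⟩ := hX
  rw [Complex.norm_exp, Complex.exp_im, mul_comm]
  have : Real.sin e ≤ Real.sin ω.im := by
    rcases le_total ω.im (Real.pi / 2) with h | h
    · exact Real.sin_le_sin_of_le_of_le_pi_div_two (by linarith) h (by linarith [h2.1])
    · rw [← Real.sin_pi_sub ω.im]
      exact Real.sin_le_sin_of_le_of_le_pi_div_two (by linarith) (by linarith) (by linarith [h2.2])
  gcongr

theorem Config.Low.of_mem_closure {d : Config} {C : ℝ} (h : d.Low C) {x : ℂ}
    (hx : x ∈ closure d.A) : -(C * d.τ * (1 + |x.re|)) ≤ x.im := by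
  have hcl : IsClosed {x : ℂ | -(C * d.τ * (1 + |x.re|)) ≤ x.im} :=
    isClosed_le (by fun_prop) (by fun_prop)
  exact closure_minimal (fun x hx => h x hx) hcl hx

/-- Far from the origin, the vertical coordinate is almost nonnegative relative to the short
part. -/
theorem exists_le_im_of_low (hκ : 0 < κ) (hκ1 : κ ≤ 1) (hε : 0 < ε) (β : ℝ) {C s : ℝ}
    (hC : 0 < C) (hs : 0 < s) : ∃ r₀ : ℝ, 1 ≤ r₀ ∧ ∀ R, ∀ᶠ d in ctxFilter κ β ε, d.Low C →
      ∀ x y, d.Graph x y → r₀ ≤ ‖(⟨x.re, y.im⟩ : ℂ)‖ → ‖(⟨x.re, y.im⟩ : ℂ)‖ ≤ R →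
      -s * ‖(⟨y.re, x.im⟩ : ℂ)‖ ≤ x.im := by
  obtain ⟨c₁, r₀, hc₁, hr₀, hle⟩ := exists_le_short hκ hκ1 hε β
  obtain ⟨r₁, hr₁⟩ := Filter.eventually_atTop.1
    ((tendsto_rpow_atTop hε).eventually_ge_atTop (2 * C / (s * c₁)))
  refine ⟨max r₀ r₁, hr₀.trans (le_max_left _ _), fun R => ?_⟩
  filter_upwards [eventually_ctx κ β ε 0, hle R] with d hd hle hlow x y hg h1 h2
  have hτ := hd.1.pos
  have h3 := hle x y hg ((le_max_left _ _).trans h1) h2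
  have h4 := hr₁ _ ((le_max_right _ _).trans h1)
  have h5 := hlow.of_mem_closure hg.1
  have h6 : |x.re| ≤ ‖(⟨x.re, y.im⟩ : ℂ)‖ := Complex.abs_re_le_norm (⟨x.re, y.im⟩ : ℂ)
  set ρ := ‖(⟨x.re, y.im⟩ : ℂ)‖
  have hρ : 1 ≤ ρ := hr₀.trans ((le_max_left _ _).trans h1)
  rw [div_le_iff₀ (by positivity)] at h4
  have h7 : C * d.τ * (1 + |x.re|) ≤ s * ‖(⟨y.re, x.im⟩ : ℂ)‖ := by
    calc C * d.τ * (1 + |x.re|) ≤ C * d.τ * (2 * ρ) := by gcongr; linarith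
      _ = (2 * C) * (d.τ * ρ) := by ring
      _ ≤ (ρ ^ ε * (s * c₁)) * (d.τ * ρ) := by gcongr
      _ = s * (c₁ * (ρ ^ (1 : ℝ) * ρ ^ ε) * d.τ) := by rw [Real.rpow_one]; ring
      _ = s * (c₁ * ρ ^ (1 + ε) * d.τ) := by rw [Real.rpow_add (by linarith)]
      _ ≤ _ := by gcongr
  linarith

/-- At every radius there is a point of the graph near the positive vertical axis. -/
theorem exists_pole_near (hκ : 0 < κ) (hκ1 : κ ≤ 1) (hβ : 0 < β) (hε : 0 < ε) {C : ℝ}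
    (hC : 0 < C) : ∃ ρ₀ c : ℝ, 1 ≤ ρ₀ ∧ 0 < c ∧ ∀ R η, 0 < η → ∀ᶠ d in ctxFilter κ β ε, d.Low C →
      ∀ ρ, ρ₀ ≤ ρ → ρ ≤ R → ∃ x ∈ d.A, ∃ y, IsSub d.u x y ∧ ‖x‖ ≤ η ∧ |y.re| ≤ η ∧
        c * ρ ≤ y.im ∧ y.im ≤ 2 / κ * ρ := by
  obtain ⟨C₀, hC₀, hnear⟩ := exists_near hκ hκ1 β ε
  obtain ⟨ra, c, hra, hc, hpole⟩ := exists_pole hκ hκ1 hβ hε hC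
  have hC0 : 0 < C₀ := by linarith
  refine ⟨C₀ * ra, c / C₀, by nlinarith, by positivity, fun R η hη => ?_⟩
  obtain ⟨M, -, hnear⟩ := hnear R
  obtain ⟨D, hD, hs⟩ := exists_short_le hκ hκ1 β ε (2 / κ * |R| + η)
  filter_upwards [eventually_ctx κ β ε 0, hnear, hpole R M, hs,
    eventually_mul_lt M (c := 4 * β * η) (by positivity), eventually_mul_lt D hη]
    with d hd hnear hpole hs hM hDη hlow ρ h1 h2
  obtain ⟨m, L, l, J, hm, hmM, -, hfam, h3, h4⟩ := hnear ρ (by nlinarith) h2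
  have hLra : ra ≤ L := by
    have : C₀ * ra ≤ C₀ * L := by linarith
    exact le_of_mul_le_mul_left this hC0
  obtain ⟨x, hx, y, hy, -, -, -, hxn, hy1, hy2⟩ := hpole hlow m L l J (by linarith) hmM hfam hLra
    (h4.trans h2)
  have hκ2 : 0 < 2 / κ := by positivity
  have hxη : ‖x‖ ≤ η := by
    refine hxn.trans ?_
    rw [div_le_iff₀ (by positivity)]
    have := hfam.le_mul hd.1.pos (by linarith) hmM
    linarith
  have hyL : y.im ≤ 2 / κ * ρ := hy2.trans (by gcongr)
  have hyim : |y.im| ≤ 2 / κ * |R| + η := by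
    rw [abs_of_nonneg (le_trans (by have := hfam.scale.pos; positivity) hy1)]
    have : 2 / κ * ρ ≤ 2 / κ * |R| := by gcongr; exact h2.trans (le_abs_self R)
    linarith
  refine ⟨x, hx, y, hy, hxη, ?_, le_trans ?_ hy1, hyL⟩
  · refine (hs x y ⟨subset_closure hx, hy⟩ ?_ hyim).2.trans hDη.le
    have := (Complex.abs_re_le_norm x).trans hxη
    have : 0 ≤ 2 / κ * |R| := by positivity
    linarith
  · rw [div_mul_eq_mul_div, div_le_iff₀ hC0]
    nlinarith

theorem Config.Graph.notMem_target {d : Config} (hd : DualPair d.u d.v d.A d.B) {x y : ℂ}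
    (h : d.Graph x y) (hx : x ∉ d.A) : y ∉ d.B := fun hy =>
  hx (hd.symm.mem_of_mem hy (hd.isSub_symm h.1 h.2))

end

section

variable {κ β ε : ℝ}

/-- A convex open set that is fat to the right, dips to the left near the axis, and reaches far up
along the vertical axis contains the points close to the vertical axis. -/
theorem mem_of_dip {B : Set ℂ} (hB : Convex ℝ B) (hBo : IsOpen B) (h0 : (0 : ℂ) ∈ closure B)
    {τ D R s : ℝ} (hτ : 0 < τ) (hβ : 0 < β) (hD : 0 < D) (hs : 0 < s) (hsR : s ≤ R)
    (hDτ : D * τ ≤ β / 2) (hRτ : 2 * (R + 1) / β * τ ≤ s / (8 * D + 8))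
    {g k y y' : ℂ} (hg : g ∈ B) (hg1 : ‖g‖ ≤ 1) (hgβ : β ≤ g.re)
    (hk : k ∈ B) (hk1 : |k.im| ≤ 1 / 2) (hk2 : k.re = -((D + (R + 1) / (s / (8 * D + 8))) * τ))
    (hy' : y' ∈ closure B) (hy'1 : 2 * R ≤ y'.im) (hy'2 : |y'.re| ≤ D * τ)
    (hy1 : s ≤ y.im) (hy2 : y.im ≤ R) (hy3 : |y.re| ≤ D * τ) : y ∈ B := by
  by_contra hy
  obtain ⟨m, hm⟩ := exists_outer_normal hB hBo hy
  have hcl : ∀ w ∈ closure B, ⟪m, w⟫ ≤ ⟪m, y⟫ := fun w hw =>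
    inner_le_of_mem_closure (fun z hz => (hm z hz).le) hw
  have hmg := hm g hg
  have hmk := hm k hk
  have hm0 := hcl 0 h0
  have hmy := hcl y' hy'
  simp only [cinner, Complex.zero_re, Complex.zero_im] at hmg hmk hm0 hmy
  set μ := s / (8 * D + 8) with hμ
  have hμ0 : 0 < μ := by positivity
  have hμs : μ * (8 * D + 8) = s := by rw [hμ]; field_simp
  have hR : 0 < R := by linarith
  have hDμ : 0 < D * μ := by positivity
  have hgim := abs_le.1 ((Complex.abs_im_le_norm g).trans hg1)
  have hkim := abs_le.1 hk1
  have hyre := abs_le.1 hy3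
  have hyre' := abs_le.1 hy'2
  have key : |m.re| * τ ≤ μ * |m.im| := by
    have h2 : m.im * (y.im - g.im) ≤ |m.im| * (R + 1) := by
      refine (le_abs_self _).trans ?_
      rw [abs_mul]
      gcongr
      exact abs_le.2 ⟨by linarith [hgim.2], by linarith [hgim.1]⟩
    have h3 : m.im * (y.im - k.im) ≤ |m.im| * (R + 1) := by
      refine (le_abs_self _).trans ?_
      rw [abs_mul]
      gcongr
      exact abs_le.2 ⟨by linarith [hkim.2], by linarith [hkim.1]⟩
    rcases le_total 0 m.re with h | h
    · rw [abs_of_nonneg h]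
      have h1 : m.re * (β / 2) ≤ m.re * (g.re - y.re) := by gcongr; linarith [hyre.2]
      have h4 : m.re * (β / 2) ≤ |m.im| * (R + 1) := by linarith
      have h5 : m.re ≤ 2 * (R + 1) / β * |m.im| := by
        rw [div_mul_eq_mul_div, le_div_iff₀ hβ]; linarith
      calc m.re * τ ≤ 2 * (R + 1) / β * |m.im| * τ := by gcongr
        _ = 2 * (R + 1) / β * τ * |m.im| := by ring
        _ ≤ _ := by gcongr
    · rw [abs_of_nonpos h]
      rw [hk2] at hmk
      have h1 : m.re * y.re ≤ -m.re * (D * τ) := by nlinarith [hyre.1]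
      have h4 : -m.re * ((R + 1) / μ * τ) ≤ |m.im| * (R + 1) := by linarith
      have h5 : -m.re * τ * (R + 1) ≤ μ * |m.im| * (R + 1) := by
        calc -m.re * τ * (R + 1) = μ * (-m.re * ((R + 1) / μ * τ)) := by field_simp
          _ ≤ μ * (|m.im| * (R + 1)) := by gcongr
          _ = _ := by ring
      exact le_of_mul_le_mul_right h5 (by linarith)
  have hre : ∀ t : ℝ, |t| ≤ D * τ → m.re * t ≤ D * μ * |m.im| := by
    intro t ht
    calc m.re * t ≤ |m.re| * |t| := by rw [← abs_mul]; exact le_abs_self _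
      _ ≤ |m.re| * (D * τ) := by gcongr
      _ = D * (|m.re| * τ) := by ring
      _ ≤ D * (μ * |m.im|) := by gcongr
      _ = _ := by ring
  rcases lt_trichotomy m.im 0 with h | h | h
  · have h1 := hre y.re hy3
    rw [abs_of_neg h] at h1
    have h2 : -m.im * s ≤ -m.im * y.im := by
      apply mul_le_mul_of_nonneg_left hy1; linarith
    have h3 : -m.im * (s - D * μ) ≤ 0 := by linarith
    have h4 : 0 < -m.im * (s - D * μ) := by
      apply mul_pos (by linarith); linarith
    linarith
  · rw [h, abs_zero, mul_zero] at key
    have : |m.re| = 0 := le_antisymm (by nlinarith [abs_nonneg m.re]) (abs_nonneg _)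
    rw [abs_eq_zero.1 this, h] at hmg
    simp at hmg
  · have h1 := hre y.re hy3
    have h2 := hre (-y'.re) (by rwa [abs_neg])
    rw [abs_of_pos h] at h1 h2
    have h3 : m.im * R ≤ m.im * (y'.im - y.im) := by
      apply mul_le_mul_of_nonneg_left _ h.le; linarith
    have h4 : m.im * (R - 2 * (D * μ)) ≤ 0 := by linarith
    have h5 : 0 < m.im * (R - 2 * (D * μ)) := by
      apply mul_pos h; linarith
    linarith

theorem exists_not_low_dip (hκ : 0 < κ) (hκ1 : κ ≤ 1) (hβ : 0 < β) (hε : 0 < ε) {C : ℝ}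
    (hC : 0 < C) : ∃ K : ℝ, 1 ≤ K ∧ ∀ᶠ d in ctxFilter κ β ε, d.Low C → ¬ d.swap.Dip K := by
  have hπ := Real.pi_pos
  obtain ⟨e, he⟩ : ∃ e : ℝ, e = ε * Real.pi / (8 * (1 + ε)) := ⟨_, rfl⟩
  have heq : e * (8 * (1 + ε)) = ε * Real.pi := by rw [he]; field_simp
  have he0 : 0 < e := by rw [he]; positivity
  have heπ : e ≤ Real.pi / 8 := by
    rw [he, div_le_div_iff₀ (by positivity) (by positivity)]
    nlinarith
  have hs0 : 0 < Real.sin e := Real.sin_pos_of_pos_of_lt_pi he0 (by linarith)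
  have hs1 : Real.sin e ≤ 1 / 2 := by
    rw [← Real.sin_pi_div_six]
    exact Real.sin_le_sin_of_le_of_le_pi_div_two (by linarith) (by linarith) (by linarith)
  obtain ⟨σ, hσ⟩ : ∃ σ : ℝ, σ = Real.sin e / 2 := ⟨_, rfl⟩
  have hσ0 : 0 < σ := by rw [hσ]; positivity
  have hnc : ‖(-Complex.I : ℂ)‖ = 1 := by simp
  obtain ⟨ra, hra, hns⟩ := exists_not_sector hκ hκ1 hε β (a := e) (b := Real.pi - e)
    (w := Real.pi + 2 * e) (by linarith) (by linarith) hnc (by nlinarith)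
  obtain ⟨rb, hrb, hlowim⟩ := exists_le_im_of_low hκ hκ1 hε β hC hs0
  obtain ⟨c₁, rc, hc₁, hrc, hshort⟩ := exists_le_short hκ hκ1 hε β
  obtain ⟨ρ₀, c, hρ₀, hc, hpole⟩ := exists_pole_near hκ hκ1 hβ hε hC
  obtain ⟨r, hr⟩ : ∃ r : ℝ, r = ra + rb + rc + 1 := ⟨_, rfl⟩
  obtain ⟨ρ₁, hρ₁⟩ : ∃ ρ : ℝ, ρ = max ρ₀ ((r + 1) / c) := ⟨_, rfl⟩
  obtain ⟨R, hR, hR1⟩ := ((hns r (by linarith)).and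
    (Filter.eventually_ge_atTop (2 / κ * ρ₁ + r + 2))).exists
  have hρ₁0 : 0 < ρ₁ := by rw [hρ₁]; exact lt_max_of_lt_left (by linarith)
  have hκρ : 0 < 2 / κ * ρ₁ := by positivity
  obtain ⟨ρ₂, hρ₂⟩ : ∃ ρ : ℝ, ρ = max ρ₀ (2 * R / c) := ⟨_, rfl⟩
  have hρ₂0 : 0 < ρ₂ := by rw [hρ₂]; exact lt_max_of_lt_left (by linarith)
  have hκρ2 : 0 < 2 / κ * ρ₂ := by positivity
  obtain ⟨D, hD, hDs⟩ := exists_short_le hκ hκ1 β ε (2 / κ * ρ₂ + 1 + R)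
  have hμ0 : 0 < σ / (8 * D + 8) := by positivity
  have hK : 1 ≤ (R + 1) / (σ / (8 * D + 8)) := by
    rw [le_div_iff₀ hμ0, one_mul, div_le_iff₀ (by positivity)]
    nlinarith
  refine ⟨D + (R + 1) / (σ / (8 * D + 8)), by linarith, ?_⟩
  filter_upwards [eventually_ctx κ β ε 0, hR, hlowim R, hshort R, hpole (ρ₁ + ρ₂) σ hσ0, hDs,
    eventually_close hκ hκ1 β ε R hσ0, eventually_mul_lt D (c := β / 2) (by positivity),
    eventually_mul_lt (2 * (R + 1) / β) hμ0]
    with d hd hR hlowim hshort hpole hDs hclose hDτ hRτ hlow hdip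
  obtain ⟨k, hk, hk1, hk2⟩ := hdip
  obtain ⟨-, g, hg, hg1, hgβ⟩ := hd.2
  have hB : Convex ℝ d.B := hd.1.dual.convex'
  refine hR ?_ ?_
  · intro x y hxy hX
    obtain ⟨hX1, hX2⟩ := norm_mem_of_mem_annSector (by linarith) (by linarith) hX
    have hXim := im_ge_of_mem_annSector he0 (by linarith) le_rfl le_rfl hX
    obtain ⟨e1, e2, e3⟩ := hclose x y hxy hX2
    have hxre : |x.re| ≤ R := (Complex.abs_re_le_norm (⟨x.re, y.im⟩ : ℂ)).trans (e1.trans hX2)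
    have hyim : |y.im| ≤ R := (Complex.abs_im_le_norm (⟨x.re, y.im⟩ : ℂ)).trans (e1.trans hX2)
    have hxim : |x.im| ≤ σ := (Complex.abs_im_le_norm (⟨y.re, x.im⟩ : ℂ)).trans e2
    have hz : 0 < ‖(⟨y.re, x.im⟩ : ℂ)‖ := by
      refine lt_of_lt_of_le ?_ (hshort x y hxy (by linarith) (e1.trans hX2))
      have := hd.1.pos
      have : 0 < ‖(⟨x.re, y.im⟩ : ℂ)‖ := by linarith
      positivity
    constructor
    · by_contra hxA
      refine hxy.notMem_target hd.1.dual hxA ?_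
      obtain ⟨x', hx', y', hy', hx'n, hy'1, hy'2, hy'3⟩ := hpole hlow ρ₂
        (by rw [hρ₂]; exact le_max_left _ _) (by linarith)
      have hy'R : 2 * R ≤ y'.im := by
        refine le_trans ?_ hy'2
        have : 2 * R / c ≤ ρ₂ := by rw [hρ₂]; exact le_max_right _ _
        rw [div_le_iff₀ hc] at this
        linarith
      have hg' : d.Graph x' y' := ⟨subset_closure hx', hy'⟩
      have hy'im : |y'.im| ≤ 2 / κ * ρ₂ + 1 + R := by
        rw [abs_of_nonneg (by linarith)]; linarith
      have hx're : |x'.re| ≤ 2 / κ * ρ₂ + 1 + R := by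
        have := (Complex.abs_re_le_norm x').trans hx'n
        linarith
      refine mem_of_dip hB hd.1.dual.isOpen' hd.1.dual.zero_mem' hd.1.pos hβ hD hσ0 (by linarith)
        hDτ.le hRτ.le hg hg1 hgβ (k := diagRefl k) hk (by simpa using hk1)
        (by simpa [Config.swap] using hk2)
        (hd.1.dual.mem hy') hy'R (hDs x' y' hg' hx're hy'im).2 ?_ (le_of_abs_le hyim)
        (hDs x y hxy (by linarith) (by linarith)).2
      have h1 : Real.sin e * 1 ≤ Real.sin e * ‖x + y‖ := by gcongr; linarith
      rw [Complex.add_im] at hXim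
      linarith [(abs_le.1 hxim).2]
    · have h1 := hlowim hlow x y hxy (by linarith) (e1.trans hX2)
      have h2 := Complex.abs_arg_le_of_re (w := -Complex.I * ⟨y.re, x.im⟩) (s := e)
        (by simpa [norm_pos_iff] using norm_pos_iff.1 hz) he0.le
        (by rw [norm_mul, hnc, one_mul]; simpa using h1)
      linarith
  · obtain ⟨x, hx, y, hy, hxn, hyre, hy1, hy2⟩ := hpole hlow ρ₁
      (by rw [hρ₁]; exact le_max_left _ _) (by linarith)
    refine ⟨x, hx, y, hy, ?_⟩
    have h1 : r + 1 ≤ c * ρ₁ := by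
      have : (r + 1) / c ≤ ρ₁ := by rw [hρ₁]; exact le_max_right _ _
      rw [div_le_iff₀ hc] at this
      linarith
    have hxre := abs_le.1 ((Complex.abs_re_le_norm x).trans hxn)
    have hxim := abs_le.1 ((Complex.abs_im_le_norm x).trans hxn)
    have hyre' := abs_le.1 hyre
    have hre : |(x + y).re| ≤ 2 * σ := by
      rw [Complex.add_re]; exact abs_le.2 ⟨by linarith, by linarith⟩
    have him : r + 1 - σ ≤ (x + y).im := by rw [Complex.add_im]; linarith
    have him2 : (x + y).im ≤ 2 / κ * ρ₁ + σ := by rw [Complex.add_im]; linarith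
    have hn := Complex.norm_le_abs_re_add_abs_im (x + y)
    have hn' := (le_abs_self _).trans (Complex.abs_im_le_norm (x + y))
    rw [abs_of_nonneg (show 0 ≤ (x + y).im by linarith)] at hn
    have hne : x + y ≠ 0 := by rw [← norm_pos_iff]; linarith
    have h3 : Real.sin e * ‖x + y‖ ≤ (x + y).im := by
      have : Real.sin e * ‖x + y‖ ≤ 1 / 2 * ‖x + y‖ := by gcongr
      linarith
    obtain ⟨h4, h5⟩ := Complex.arg_mem_of_im he0 (by linarith) hne h3
    exact mem_annSector (by linarith) (by linarith) (by linarith) h4 h5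

end

/-- A point of the graph near the vertical axis and a point near the horizontal axis, both of the
size of a given scale. -/
structure Config.Poles (κ c D : ℝ) (d : Config) (L l : ℝ) (J : ℂ ≃ₗᵢ[ℝ] ℂ) (x y x' y' : ℂ) :
    Prop where
  mem : x ∈ d.A
  mem' : x' ∈ d.A
  isSub : IsSub d.u x y
  isSub' : IsSub d.u x' y'
  le_usc : 1 / 4 ≤ ‖usc L l J x‖
  usc_le : ‖usc L l J x‖ ≤ 1 / 2
  usc_le' : ‖usc L l J x'‖ ≤ 2 / κ
  norm_le : ‖x‖ ≤ D * l
  le_im : c * L ≤ y.im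
  im_le : y.im ≤ 2 / κ * L
  le_re : c * L ≤ x'.re
  re_le : x'.re ≤ 2 / κ * L
  abs_re_le : |y.re| ≤ D * l
  abs_im_le : |x'.im| ≤ D * l
  val_le : d.v y ≤ L * l / κ
  val_le' : d.u x' ≤ L * l / κ

section

variable {κ β ε : ℝ}

theorem norm_usc_diagRefl (L l : ℝ) (J : ℂ ≃ₗᵢ[ℝ] ℂ) (w : ℂ) :
    ‖usc L l (diagRefl.trans (J.trans diagRefl.symm)) w‖ = ‖usc l L J (diagRefl w)‖ := by
  have : usc L l (diagRefl.trans (J.trans diagRefl.symm)) w =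
      diagRefl (usc l L J (diagRefl w)) := rfl
  rw [this, LinearIsometryEquiv.norm_map]

theorem Config.Low.swap_of_mem_closure {d : Config} {C : ℝ} (h : d.swap.Low C) {y : ℂ}
    (hy : y ∈ closure d.B) : -(C * d.τ * (1 + |y.im|)) ≤ y.re := by
  have e : closure (diagRefl ⁻¹' d.B) = diagRefl ⁻¹' closure d.B :=
    (diagRefl.toHomeomorph.preimage_closure d.B).symm
  have h1 : diagRefl y ∈ closure d.swap.A := by
    change _ ∈ closure (diagRefl ⁻¹' d.B)
    rw [e]
    simpa [diagRefl_diagRefl] using hy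
  simpa [Config.swap] using h.of_mem_closure h1

theorem exists_poles (hκ : 0 < κ) (hκ1 : κ ≤ 1) (hβ : 0 < β) (hε : 0 < ε) {C : ℝ} (hC : 0 < C) :
    ∃ r c D : ℝ, 1 ≤ r ∧ 0 < c ∧ 0 < D ∧ ∀ R M, ∀ᶠ d in ctxFilter κ β ε, d.Low C → d.swap.Low C →
      ∀ m L l J, 1 ≤ m → m ≤ M → d.Fam κ ε m L l J → r ≤ L → L ≤ R →
      ∃ x y x' y', d.Poles κ c D L l J x y x' y' := by
  obtain ⟨r, c, hr, hc, hpole⟩ := exists_pole hκ hκ1 hβ hε hC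
  obtain ⟨E, hE⟩ : ∃ E : ℝ, E = 2 / κ + 2 / κ * (C * (1 + 2 / κ)) := ⟨_, rfl⟩
  have hκ2 : 0 < 2 / κ := by positivity
  have hE0 : 0 < E := by rw [hE]; positivity
  refine ⟨r, c, 1 / (4 * β) + E / c + C * (1 + 2 / κ), hr, hc, by positivity, fun R M => ?_⟩
  filter_upwards [eventually_ctx κ β ε 0, hpole R M, eventually_swap (hpole R M)]
    with d hd h1 h2 hlow hlow' m L l J hm hmM hfam hrL hLR
  obtain ⟨x, hx, y, hy, hx1, hx2, hy1, hx3, hy2, hy3⟩ := h1 hlow m L l J hm hmM hfam hrL hLR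
  obtain ⟨b, hb, a, ha, hb1, hb2, ha1, hb3, ha2, ha3⟩ := h2 hlow' m L l _ hm hmM
    (Config.fam_swap hfam) hrL hLR
  rw [norm_usc_diagRefl] at hb1 hb2 ha1
  have hL := hfam.scale.pos
  have hl := hfam.scale.pos'
  have hτL := hfam.le_of_le hd.1.pos hε hm
  have hLl : 0 < L * l := by positivity
  have hτ := hd.1.pos
  have hb' : diagRefl b ∈ d.B := hb
  have hab : IsSub d.v (diagRefl b) (diagRefl a) := by
    rwa [← isSub_comp_isometry diagRefl]
  have hda : diagRefl a ∈ d.A := hd.1.dual.symm.mem_of_mem hb' hab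
  have hab' : IsSub d.u (diagRefl a) (diagRefl b) :=
    hd.1.dual.symm.isSub_symm (subset_closure hb') hab
  have hvy : d.v y ≤ L * l / κ := by
    refine (hd.1.dual.le_inner hy).2.trans ((inner_le_usc hL hl J x y).trans ?_)
    calc L * l * (‖usc L l J x‖ * ‖usc l L J y‖) ≤ L * l * (1 / 2 * (2 / κ)) := by gcongr
      _ = _ := by ring
  have hua : d.u (diagRefl a) ≤ L * l / κ := by
    refine (hd.1.dual.le_inner hab').1.trans ((inner_le_usc hL hl J _ _).trans ?_)
    calc L * l * (‖usc L l J (diagRefl a)‖ * ‖usc l L J (diagRefl b)‖)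
        ≤ L * l * (2 / κ * (1 / 2)) := by gcongr
      _ = _ := by ring
  have hyoung := hd.1.dual.young (diagRefl a) (hd.1.dual.mem hy)
  rw [cinner, diagRefl_re, diagRefl_im] at hyoung
  have hL1 : 1 ≤ L := hr.trans hrL
  have hsmall : ∀ q : ℝ, c * L ≤ q → q ≤ 2 / κ * L →
      C * d.τ * (1 + |q|) ≤ C * (1 + 2 / κ) * l := by
    intro q h1 h2
    rw [abs_of_nonneg (le_trans (by positivity) h1)]
    calc C * d.τ * (1 + q) ≤ C * d.τ * (L + 2 / κ * L) := by gcongr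
      _ = C * (1 + 2 / κ) * (d.τ * L) := by ring
      _ ≤ _ := by gcongr
  have hp := hlow'.swap_of_mem_closure (hd.1.dual.mem hy)
  have ht := hlow.of_mem_closure (subset_closure hda)
  rw [diagRefl_re, diagRefl_im] at ht
  have hp' := hp.trans' (neg_le_neg (hsmall _ hy2 hy3))
  have ht' := ht.trans' (neg_le_neg (hsmall _ ha2 ha3))
  have habs : ∀ p q s t : ℝ, c * L ≤ q → c * L ≤ s → s ≤ 2 / κ * L → -(C * (1 + 2 / κ) * l) ≤ p →
      s * p + t * q ≤ 2 * (L * l / κ) → t ≤ E / c * l := by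
    intro p q s t hq hs hs' hp h
    by_contra hcon
    push Not at hcon
    have hs0 : 0 ≤ s := le_trans (by positivity) hs
    have h3 : E * (L * l) < t * q := by
      calc E * (L * l) = E / c * l * (c * L) := by field_simp
        _ < t * (c * L) := by gcongr
        _ ≤ t * q := by gcongr; exact le_trans (by positivity) hcon.le
    have h4 : -(2 / κ * L * (C * (1 + 2 / κ) * l)) ≤ s * p := by
      calc -(2 / κ * L * (C * (1 + 2 / κ) * l)) ≤ -(s * (C * (1 + 2 / κ) * l)) := by gcongr
        _ = s * -(C * (1 + 2 / κ) * l) := by ring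
        _ ≤ _ := by gcongr
    have h5 : 2 * (L * l / κ) = 2 / κ * (L * l) := by ring
    rw [hE] at h3
    linarith
  have hD1 : 0 ≤ 1 / (4 * β) * l := by positivity
  have hD2 : 0 ≤ E / c * l := by positivity
  have hD3 : 0 ≤ C * (1 + 2 / κ) * l := by positivity
  have hte := habs y.re y.im a.im a.re hy2 ha2 ha3 hp' (by linarith)
  have hpf := habs a.re a.im y.im y.re ha2 hy2 hy3 ht' (by linarith)
  refine ⟨x, y, diagRefl a, diagRefl b, hx, hda, hy, hab', hx1, hx2, ha1, ?_, hy2, hy3,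
    by simpa using ha2, by simpa using ha3, abs_le.2 ⟨by linarith, by linarith⟩, ?_, hvy, hua⟩
  · refine hx3.trans ?_
    rw [div_eq_mul_one_div, mul_comm]
    linarith
  · rw [diagRefl_im]
    exact abs_le.2 ⟨by linarith, by linarith⟩

/-- Graph points of the size of a scale have their short coordinates controlled by its short
axis. -/
theorem exists_short_le_mul (hκ : 0 < κ) (hκ1 : κ ≤ 1) (hβ : 0 < β) (hε : 0 < ε) {C C₀ : ℝ}
    (hC : 0 < C) (hC₀ : 1 ≤ C₀) : ∃ r D : ℝ, 1 ≤ r ∧ 0 < D ∧ ∀ R M, ∀ᶠ d in ctxFilter κ β ε,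
      d.Low C → d.swap.Low C → ∀ m L l J, 2 ≤ m → m ≤ M → d.Fam κ ε m L l J → r ≤ L → L ≤ R →
      ∀ x y, d.Graph x y → ‖x + y‖ ≤ C₀ * L → |x.im| ≤ D * l ∧ |y.re| ≤ D * l := by
  obtain ⟨r, c, D, hr, hc, hD, hpoles⟩ := exists_poles hκ hκ1 hβ hε hC
  obtain ⟨lam, hlam, hnorm⟩ := Scale.exists_norm_le hκ hκ1 C₀
  obtain ⟨E, hE⟩ : ∃ E : ℝ, E = 16 * lam ^ 2 + 1 / κ + C₀ * D := ⟨_, rfl⟩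
  have hE0 : 0 < E := by rw [hE]; positivity
  refine ⟨r, E / c + C * (1 + C₀), hr, by positivity, fun R M => ?_⟩
  filter_upwards [eventually_ctx κ β ε 0, hpoles R M, eventually_exists_fam (lam * M)]
    with d hd hpoles hex hlow hlow' m L l J hm hmM hfam hrL hLR x y hxy hX
  obtain ⟨xf, yf, xe, ye, hp⟩ := hpoles hlow hlow' m L l J (by linarith) hmM hfam hrL hLR
  obtain ⟨L', l', J', hfam'⟩ := hex (lam * m) (by nlinarith) (by gcongr)
  have hL := hfam.scale.pos
  have hl := hfam.scale.pos'
  have hτ := hd.1.pos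
  have hL1 : 1 ≤ L := hr.trans hrL
  have hτL := hfam.le_of_le hτ hε (by linarith)
  have hin := hd.1.dual.inner_nonneg hxy.2
  have hxn : ‖x‖ ≤ C₀ * L := by
    refine le_trans (abs_le_of_sq_le_sq' ?_ (norm_nonneg _)).2 hX
    rw [norm_add_sq_real]; nlinarith [sq_nonneg ‖y‖]
  have hyn : ‖y‖ ≤ C₀ * L := by
    refine le_trans (abs_le_of_sq_le_sq' ?_ (norm_nonneg _)).2 hX
    rw [norm_add_sq_real]; nlinarith [sq_nonneg ‖x‖]
  have h1 := hnorm d.u d.v d.A d.B L l L' l' J J' hd.1.dual hfam.scale hfam'.scale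
    (by rw [hfam.mul_eq, hfam'.mul_eq]; linarith) x y hxy.1 hxy.2
    ((Complex.abs_re_usc_le hL x).trans (by rwa [div_le_iff₀ hL]))
    ((Complex.abs_im_usc_le hL y).trans (by rwa [div_le_iff₀ hL]))
  have h2 : L' * l' / (L * l) = lam := by
    rw [hfam.mul_eq, hfam'.mul_eq]; field_simp
  rw [h2] at h1
  have h3 : ⟪x, y⟫ ≤ 16 * lam ^ 2 * (L * l) := by
    have h4 : ‖usc L l J x‖ ≤ 4 * lam := by linarith [norm_nonneg (usc l L J y)]
    have h5 : ‖usc l L J y‖ ≤ 4 * lam := by linarith [norm_nonneg (usc L l J x)]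
    calc ⟪x, y⟫ ≤ L * l * (‖usc L l J x‖ * ‖usc l L J y‖) := inner_le_usc hL hl J x y
      _ ≤ L * l * ((4 * lam) * (4 * lam)) := by gcongr
      _ = _ := by ring
  obtain ⟨h4, h5⟩ := hd.1.dual.le_inner hxy.2
  have y1 := hd.1.dual.young x (hd.1.dual.mem hp.isSub)
  have y2 := hd.1.dual.young xe (hd.1.dual.mem hxy.2)
  rw [cinner] at y1 y2
  have hxre := (Complex.abs_re_le_norm x).trans hxn
  have hyim := (Complex.abs_im_le_norm y).trans hyn
  have hlo : ∀ s : ℝ, |s| ≤ C₀ * L → C * d.τ * (1 + |s|) ≤ C * (1 + C₀) * l := by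
    intro s hs
    calc C * d.τ * (1 + |s|) ≤ C * d.τ * (L + C₀ * L) := by gcongr
      _ = C * (1 + C₀) * (d.τ * L) := by ring
      _ ≤ _ := by gcongr
  have habs : ∀ p q s t : ℝ, c * L ≤ q → |s| ≤ C₀ * L → |p| ≤ D * l →
      s * p + t * q ≤ (16 * lam ^ 2 + 1 / κ) * (L * l) → t ≤ E / c * l := by
    intro p q s t hq hs hp h
    by_contra hcon
    push Not at hcon
    have h3 : E * (L * l) < t * q := by
      calc E * (L * l) = E / c * l * (c * L) := by field_simp
        _ < t * (c * L) := by gcongr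
        _ ≤ t * q := by gcongr; exact le_trans (by positivity) hcon.le
    have h4 : |s * p| ≤ (C₀ * L) * (D * l) := by rw [abs_mul]; gcongr
    rw [hE] at h3
    linarith [(abs_le.1 h4).1]
  have e1 : L * l / κ = 1 / κ * (L * l) := by ring
  have i1 := hp.val_le
  have i2 := hp.val_le'
  have k1 := habs yf.re yf.im x.re x.im hp.le_im hxre hp.abs_re_le (by linarith)
  have k2 := habs xe.im xe.re y.im y.re hp.le_re hyim hp.abs_im_le (by linarith)
  have k3 := (hlow.of_mem_closure hxy.1).trans' (neg_le_neg (hlo _ hxre))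
  have k4 := (hlow'.swap_of_mem_closure (hd.1.dual.mem hxy.2)).trans' (neg_le_neg (hlo _ hyim))
  have hD2 : 0 ≤ E / c * l := by positivity
  have hD3 : 0 ≤ C * (1 + C₀) * l := by positivity
  exact ⟨abs_le.2 ⟨by linarith, by linarith⟩, abs_le.2 ⟨by linarith, by linarith⟩⟩

end

section

variable {κ β ε : ℝ}

/-- Position of the rescaled outer normal `(a, -b)` at a boundary point `(s, t)`. -/
theorem normal_mem_quadrant {a b s t g h s' t' σ C₀ D H ν τ₁ : ℝ} (hσ : 0 < σ) (hC₀ : 0 < C₀)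
    (hD : 0 < D) (hτ₁ : 0 < τ₁) (hab : a ≠ 0 ∨ b ≠ 0) (hs : σ ≤ s) (hs' : s ≤ C₀) (ht : -ν ≤ t) (ht' : |t| ≤ D)
    (hg : |g| ≤ 1) (hh : H ≤ h) (he : 2 * C₀ ≤ s') (he' : |t'| ≤ D)
    (hH1 : (C₀ + 1) * D < σ * (H - D)) (hH2 : (C₀ + 1) * (2 * D) < C₀ * (H - D))
    (hν : ν ≤ τ₁ * σ) (h1 : a * g - b * h ≤ a * s - b * t) (h0 : 0 ≤ a * s - b * t)
    (h2 : a * s' - b * t' ≤ a * s - b * t) : 0 < b ∧ -(τ₁ * b) ≤ a := by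
  have hgs := abs_le.1 hg
  have htt := abs_le.1 ht'
  have hte := abs_le.1 he'
  have hHD : 0 < H - D := by
    by_contra hcon
    push Not at hcon
    have : σ * (H - D) ≤ 0 := mul_nonpos_of_nonneg_of_nonpos hσ.le hcon
    have : 0 < (C₀ + 1) * D := by positivity
    linarith
  have hb : 0 < b := by
    by_contra hb
    push Not at hb
    have k1 : -b * (H - D) ≤ |a| * (C₀ + 1) := by
      calc -b * (H - D) ≤ -b * (h - t) := by
            apply mul_le_mul_of_nonneg_left _ (by linarith); linarith
        _ ≤ a * (s - g) := by linarith
        _ ≤ |a| * |s - g| := by rw [← abs_mul]; exact le_abs_self _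
        _ ≤ _ := by gcongr; exact abs_le.2 ⟨by linarith, by linarith⟩
    rcases lt_trichotomy a 0 with ha | ha | ha
    · rw [abs_of_neg ha] at k1
      have k2 : -a * σ ≤ -b * D := by
        have : -a * σ ≤ -a * s := by apply mul_le_mul_of_nonneg_left hs; linarith
        have : -b * t ≤ -b * D := by apply mul_le_mul_of_nonneg_left htt.2; linarith
        linarith
      have k3 : -a * (σ * (H - D)) ≤ -a * ((C₀ + 1) * D) := by
        calc -a * (σ * (H - D)) = -a * σ * (H - D) := by ring
          _ ≤ -b * D * (H - D) := by gcongr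
          _ = -b * (H - D) * D := by ring
          _ ≤ -a * (C₀ + 1) * D := by gcongr
          _ = _ := by ring
      exact absurd (le_of_mul_le_mul_left k3 (by linarith)) (not_le.2 hH1)
    · rw [ha, abs_zero, zero_mul] at k1
      have : b ≠ 0 := by
        rcases hab with h | h
        · exact absurd ha h
        · exact h
      have : 0 < -b := by
        rcases hb.lt_or_eq with h | h
        · linarith
        · exact absurd h this
      have := mul_pos this hHD
      linarith
    · rw [abs_of_pos ha] at k1
      have k2 : a * C₀ ≤ -b * (2 * D) := by
        have i1 : a * C₀ ≤ a * (s' - s) := by apply mul_le_mul_of_nonneg_left _ ha.le; linarith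
        have i2 : -b * (t - t') ≤ -b * (2 * D) := by
          apply mul_le_mul_of_nonneg_left <;> linarith
        linarith
      have k3 : a * (C₀ * (H - D)) ≤ a * ((C₀ + 1) * (2 * D)) := by
        calc a * (C₀ * (H - D)) = a * C₀ * (H - D) := by ring
          _ ≤ -b * (2 * D) * (H - D) := by gcongr
          _ = -b * (H - D) * (2 * D) := by ring
          _ ≤ a * (C₀ + 1) * (2 * D) := by gcongr
          _ = _ := by ring
      exact absurd (le_of_mul_le_mul_left k3 ha) (not_le.2 hH2)
  refine ⟨hb, ?_⟩
  by_contra hcon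
  push Not at hcon
  rcases le_total 0 a with ha | ha
  · have := mul_pos hτ₁ hb
    linarith
  · have i1 : b * (-ν) ≤ b * t := by gcongr
    have i2 : a * s ≤ a * σ := by
      apply mul_le_mul_of_nonpos_left hs ha
    have i3 : b * ν ≤ b * (τ₁ * σ) := by gcongr
    have i4 : a * σ < -(τ₁ * b) * σ := by gcongr
    linarith

theorem lt_of_normals {a b c d s t p q C₀ τ₁ : ℝ} (hb : 0 < b) (ha : -(τ₁ * b) ≤ a) (hc : 0 < c)
    (hd : -(τ₁ * c) ≤ d) (hτ₁ : 0 < τ₁) (hs0 : 0 ≤ s) (hs : s ≤ C₀) (hq0 : 0 ≤ q) (hq : q ≤ C₀)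
    (h : a * c + b * d ≤ 0) (h1 : 0 ≤ a * s - b * t) (h2 : 0 ≤ d * q - c * p) :
    s * p + t * q ≤ 2 * τ₁ * C₀ ^ 2 := by
  have k1 : a ≤ τ₁ * b := by
    have : b * -(τ₁ * c) ≤ b * d := by gcongr
    have : a * c ≤ τ₁ * b * c := by linarith
    exact le_of_mul_le_mul_right this hc
  have k2 : d ≤ τ₁ * c := by
    have : -(τ₁ * b) * c ≤ a * c := by gcongr
    have : d * b ≤ τ₁ * c * b := by linarith
    exact le_of_mul_le_mul_right this hb
  have k3 : t ≤ τ₁ * C₀ := by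
    have : a * s ≤ τ₁ * b * C₀ := by gcongr
    have : t * b ≤ τ₁ * C₀ * b := by linarith
    exact le_of_mul_le_mul_right this hb
  have k4 : p ≤ τ₁ * C₀ := by
    have : d * q ≤ τ₁ * c * C₀ := by gcongr
    have : p * c ≤ τ₁ * C₀ * c := by linarith
    exact le_of_mul_le_mul_right this hc
  have k0 : 0 ≤ τ₁ * C₀ := by have := hs0.trans hs; positivity
  have k5 : s * p ≤ C₀ * (τ₁ * C₀) := by
    calc s * p ≤ s * (τ₁ * C₀) := by gcongr
      _ ≤ _ := by gcongr
  have k6 : t * q ≤ (τ₁ * C₀) * C₀ := by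
    calc t * q ≤ (τ₁ * C₀) * q := by gcongr
      _ ≤ _ := by gcongr
  linarith

/-- A pair of boundary points related by the subdifferential carries outer normals forming an
angle of at most a right angle. -/
theorem DualPair.exists_normals {u v : ℂ → ℝ} {A B : Set ℂ} (h : DualPair u v A B) {x y : ℂ}
    (hyB : y ∉ B) (hs : IsSub u x y) : ∃ N m : ℂ, (∀ a ∈ A, ⟪N, a⟫ < ⟪N, x⟫) ∧
      (∀ b ∈ B, ⟪m, b⟫ < ⟪m, y⟫) ∧ 0 ≤ ⟪N, m⟫ := by
  obtain ⟨m, hm⟩ := exists_outer_normal h.convex' h.isOpen' hyB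
  let T : Set ℂ := (fun t : ℝ => x + t • m) '' Ici 0
  have hT : Convex ℝ T := by
    rintro _ ⟨t₁, h1, rfl⟩ _ ⟨t₂, h2, rfl⟩ a b ha hb hab
    refine ⟨a * t₁ + b * t₂, add_nonneg (mul_nonneg ha h1) (mul_nonneg hb h2), ?_⟩
    have : x = a • x + b • x := by rw [← add_smul, hab, one_smul]
    simp only [smul_add, add_smul, mul_smul]
    nth_rewrite 1 [this]
    abel
  have hdisj : Disjoint A T := by
    rw [Set.disjoint_left]
    rintro _ hA ⟨t, ht, rfl⟩
    exact hyB (h.mem_of_mem hA (h.isSub_add_normal hs (fun b hb => (hm b hb).le) ht))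
  obtain ⟨f, c, hf1, hf2⟩ := geometric_hahn_banach_open h.convex h.isOpen hT hdisj
  obtain ⟨N, hN⟩ : ∃ N : ℂ, ∀ z, f z = ⟪N, z⟫ :=
    ⟨(InnerProductSpace.toDual ℝ ℂ).symm f, fun z => by simp⟩
  have hx : ∀ t : ℝ, 0 ≤ t → c ≤ ⟪N, x⟫ + t * ⟪N, m⟫ := by
    intro t ht
    have := hf2 _ ⟨t, ht, rfl⟩
    rwa [hN, inner_add_right, inner_smul_right] at this
  refine ⟨N, m, fun a ha => ?_, hm, ?_⟩
  · have := hx 0 le_rfl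
    have h1 := hf1 a ha
    rw [hN] at h1
    linarith
  · by_contra hcon
    push Not at hcon
    have h1 : 0 ≤ (|⟪N, x⟫ - c| + 1) / -⟪N, m⟫ := by
      apply div_nonneg (by positivity); linarith
    have h2 := hx _ h1
    have h3 : (|⟪N, x⟫ - c| + 1) / -⟪N, m⟫ * ⟪N, m⟫ = -(|⟪N, x⟫ - c| + 1) := by
      have : ⟪N, m⟫ ≠ 0 := hcon.ne
      field_simp
    rw [h3] at h2
    linarith [le_abs_self (⟪N, x⟫ - c)]

end

section

variable {κ β ε : ℝ}

/-- A graph point in general position at a given scale lies in the open source. -/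
theorem DualPair.mem_of_scale {u v : ℂ → ℝ} {A B : Set ℂ} (h : DualPair u v A B)
    {x y x' y' g g' : ℂ} {L l σ C₀ D ν τ₁ φ : ℝ} (hx : x ∈ closure A) (hs : IsSub u x y)
    (hL : 1 ≤ L) (hl : 0 < l) (hσ : 0 < σ) (hC₀ : 0 < C₀) (hD : 0 < D) (hτ₁ : 0 < τ₁)
    (hx' : x' ∈ closure A) (hy' : y' ∈ closure B) (hg : g ∈ A) (hg' : g' ∈ B)
    (hg1 : ‖g‖ ≤ 1) (hg1' : ‖g'‖ ≤ 1) (hgβ : β ≤ g.im) (hgβ' : β ≤ g'.re)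
    (hs1 : σ * L ≤ x.re) (hs2 : x.re ≤ C₀ * L) (hq1 : σ * L ≤ y.im) (hq2 : y.im ≤ C₀ * L)
    (ht : |x.im| ≤ D * l) (hp : |y.re| ≤ D * l) (htν : -(ν * l) ≤ x.im) (hpν : -(ν * l) ≤ y.re)
    (hx'1 : 2 * C₀ * L ≤ x'.re) (hx'2 : |x'.im| ≤ D * l)
    (hy'1 : 2 * C₀ * L ≤ y'.im) (hy'2 : |y'.re| ≤ D * l)
    (hH1 : (C₀ + 1) * D < σ * (β / l - D)) (hH2 : (C₀ + 1) * (2 * D) < C₀ * (β / l - D))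
    (hν : ν ≤ τ₁ * σ) (hφ : φ * (L * l) ≤ ⟪x, y⟫) (hφτ : 2 * τ₁ * C₀ ^ 2 < φ) : x ∈ A := by
  by_contra hxA
  have hyB : y ∉ B := fun hy => hxA (h.symm.mem_of_mem hy (h.isSub_symm hx hs))
  obtain ⟨N, m, hN, hm, hNm⟩ := h.exists_normals hyB hs
  have hL0 : 0 < L := by linarith
  have eN : ∀ w : ℂ, L * N.re * (w.re / L) - -(l * N.im) * (w.im / l) = ⟪N, w⟫ := by
    intro w; rw [cinner]; field_simp; ring
  have em : ∀ w : ℂ, L * m.im * (w.im / L) - -(l * m.re) * (w.re / l) = ⟪m, w⟫ := by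
    intro w; rw [cinner]; field_simp; ring
  have cN : ∀ w ∈ closure A, ⟪N, w⟫ ≤ ⟪N, x⟫ := fun w hw =>
    inner_le_of_mem_closure (fun z hz => (hN z hz).le) hw
  have cm : ∀ w ∈ closure B, ⟪m, w⟫ ≤ ⟪m, y⟫ := fun w hw =>
    inner_le_of_mem_closure (fun z hz => (hm z hz).le) hw
  have ab : ∀ {k t : ℝ}, |t| ≤ k * l → |t / l| ≤ k := fun {k t} h => by
    rw [abs_div, abs_of_pos hl, div_le_iff₀ hl]; exact h
  have gb : ∀ t : ℝ, |t| ≤ 1 → |t / L| ≤ 1 := fun t h => by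
    rw [abs_div, abs_of_pos hL0, div_le_iff₀ hL0]; linarith
  obtain ⟨b1, b2⟩ := normal_mem_quadrant (a := L * N.re) (b := -(l * N.im)) (s := x.re / L)
    (t := x.im / l) (g := g.re / L) (h := g.im / l) (s' := x'.re / L) (t' := x'.im / l)
    (H := β / l) hσ hC₀ hD hτ₁
    (by
      by_contra hcon
      push Not at hcon
      have h1 : N.re = 0 := by simpa [hL0.ne'] using hcon.1
      have h2 : N.im = 0 := by simpa [hl.ne'] using hcon.2
      have := hN g hg
      rw [cinner, cinner, h1, h2] at this
      simp at this)
    (by rwa [le_div_iff₀ hL0]) (by rwa [div_le_iff₀ hL0])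
    (by rwa [le_div_iff₀ hl, neg_mul]) (ab ht) (gb _ ((Complex.abs_re_le_norm g).trans hg1))
    (by gcongr) (by rwa [le_div_iff₀ hL0]) (ab hx'2) hH1 hH2 hν
    (by rw [eN, eN]; exact (hN g hg).le)
    (by rw [eN]; simpa using cN 0 h.zero_mem) (by rw [eN, eN]; exact cN x' hx')
  obtain ⟨c1, c2⟩ := normal_mem_quadrant (a := L * m.im) (b := -(l * m.re)) (s := y.im / L)
    (t := y.re / l) (g := g'.im / L) (h := g'.re / l) (s' := y'.im / L) (t' := y'.re / l)
    (H := β / l) hσ hC₀ hD hτ₁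
    (by
      by_contra hcon
      push Not at hcon
      have h1 : m.im = 0 := by simpa [hL0.ne'] using hcon.1
      have h2 : m.re = 0 := by simpa [hl.ne'] using hcon.2
      have := hm g' hg'
      rw [cinner, cinner, h1, h2] at this
      simp at this)
    (by rwa [le_div_iff₀ hL0]) (by rwa [div_le_iff₀ hL0])
    (by rwa [le_div_iff₀ hl, neg_mul]) (ab hp) (gb _ ((Complex.abs_im_le_norm g').trans hg1'))
    (by gcongr) (by rwa [le_div_iff₀ hL0]) (ab hy'2) hH1 hH2 hν
    (by rw [em, em]; exact (hm g' hg').le)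
    (by rw [em]; simpa using cm 0 h.zero_mem') (by rw [em, em]; exact cm y' hy')
  have hσL : 0 < σ * L := by positivity
  have key := lt_of_normals (a := L * N.re) (b := -(l * N.im)) (c := -(l * m.re))
    (d := L * m.im) (s := x.re / L) (t := x.im / l) (p := y.re / l) (q := y.im / L) (C₀ := C₀)
    b1 b2 c1 c2 hτ₁ (by apply div_nonneg <;> linarith) (by rwa [div_le_iff₀ hL0])
    (by apply div_nonneg <;> linarith) (by rwa [div_le_iff₀ hL0])
    (by
      rw [cinner] at hNm
      have : 0 ≤ (L * l) * (N.re * m.re + N.im * m.im) := by positivity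
      linarith)
    (by rw [eN]; simpa using cN 0 h.zero_mem) (by rw [em]; simpa using cm 0 h.zero_mem')
  have e : x.re / L * (y.re / l) + x.im / l * (y.im / L) = ⟪x, y⟫ / (L * l) := by
    rw [cinner]; field_simp
  rw [e, div_le_iff₀ (by positivity)] at key
  have : 2 * τ₁ * C₀ ^ 2 * (L * l) < φ * (L * l) := by gcongr
  linarith

theorem exists_mem_of_sector (hκ : 0 < κ) (hκ1 : κ ≤ 1) (hβ : 0 < β) (hε : 0 < ε) {C s : ℝ}
    (hC : 0 < C) (hs : 0 < s) : ∃ r₀ : ℝ, 1 ≤ r₀ ∧ ∀ R, ∀ᶠ d in ctxFilter κ β ε,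
      d.Low C → d.swap.Low C → ∀ x y, d.Graph x y → r₀ ≤ ‖x + y‖ → ‖x + y‖ ≤ R →
      s * ‖x + y‖ ≤ (x + y).re → s * ‖x + y‖ ≤ (x + y).im → x ∈ d.A := by
  obtain ⟨C₀, hC₀, hnear⟩ := exists_near hκ hκ1 β ε
  obtain ⟨rp, c, Dp, hrp, hc, hDp, hpoles⟩ := exists_poles hκ hκ1 hβ hε hC
  obtain ⟨rs, Ds, hrs, hDs, hshort⟩ := exists_short_le_mul hκ hκ1 hβ hε hC hC₀
  obtain ⟨φ, hφ, hinner⟩ := Scale.exists_le_inner hκ hκ1 one_pos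
  have hC0 : 0 < C₀ := by linarith
  obtain ⟨c', hc'⟩ : ∃ c' : ℝ, c' = min (c / (2 * C₀)) 1 := ⟨_, rfl⟩
  have hc'0 : 0 < c' := by rw [hc']; positivity
  have hc'1 : c' ≤ 1 := by rw [hc']; exact min_le_right _ _
  have hc'2 : c' * (2 * C₀) ≤ c := by
    rw [← le_div_iff₀ (by positivity), hc']; exact min_le_left _ _
  obtain ⟨lam, hlam, hsmall⟩ := Scale.exists_scaleLE_small hκ hκ1 hc'0
  obtain ⟨D, hD⟩ : ∃ D : ℝ, D = Dp * lam + Ds := ⟨_, rfl⟩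
  have hD0 : 0 < D := by rw [hD]; positivity
  obtain ⟨σ, hσ⟩ : ∃ σ : ℝ, σ = s / 2 := ⟨_, rfl⟩
  have hσ0 : 0 < σ := by rw [hσ]; positivity
  obtain ⟨τ₁, hτ₁⟩ : ∃ τ₁ : ℝ, τ₁ = φ / (4 * C₀ ^ 2) := ⟨_, rfl⟩
  have hτ₁0 : 0 < τ₁ := by rw [hτ₁]; positivity
  have hτφ : 2 * τ₁ * C₀ ^ 2 < φ := by
    have : 2 * τ₁ * C₀ ^ 2 = φ / 2 := by rw [hτ₁]; field_simp; norm_num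
    linarith
  obtain ⟨m₁, hm₁⟩ := Filter.eventually_atTop.1
    ((tendsto_rpow_atTop hε).eventually_ge_atTop (2 * C * C₀ / (τ₁ * σ)))
  obtain ⟨r₁, hr₁⟩ : ∃ r : ℝ, r = |m₁| + rp + rs := ⟨_, rfl⟩
  have hr₁1 : 1 ≤ r₁ := by rw [hr₁]; linarith [abs_nonneg m₁]
  obtain ⟨H, hH⟩ : ∃ H : ℝ, H = D + (C₀ + 1) * D / σ + (C₀ + 1) * (2 * D) / C₀ := ⟨_, rfl⟩
  refine ⟨C₀ * r₁, one_le_mul_of_one_le_of_one_le hC₀ hr₁1, fun R => ?_⟩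
  obtain ⟨M, hM2, hnear⟩ := hnear R
  filter_upwards [eventually_ctx κ β ε 0, hnear, hpoles (lam * M) (lam * M), hshort R M,
    eventually_exists_fam (lam * M), eventually_close hκ hκ1 β ε R hσ0,
    eventually_mul_lt (H * M) hβ]
    with d hd hnear hpoles hshort hex hclose hHM hlow hlow' x y hxy hX1 hX2 hre him
  obtain ⟨m, L, l, J, hm, hmM, hXm, hfam, hXL, hLX⟩ := hnear ‖x + y‖
    ((le_mul_of_one_le_right hC0.le hr₁1).trans hX1) hX2
  have hτ := hd.1.pos
  have hl := hfam.scale.pos'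
  have hrL : r₁ ≤ L := le_of_mul_le_mul_left (hX1.trans hXL) hC0
  have hrm : r₁ ≤ m := le_of_mul_le_mul_left (hX1.trans hXm) hC0
  have hL1 : 1 ≤ L := hr₁1.trans hrL
  have hL0 : 0 < L := by linarith
  have hlm2 : 2 ≤ lam * m := hm.trans (le_mul_of_one_le_left (by linarith) hlam)
  have hlm : 1 ≤ lam * m := by linarith
  obtain ⟨L', l', J', hfam'⟩ := hex (lam * m) hlm2 (by gcongr)
  have hl' := hfam'.scale.pos'
  have hmul' : L' * l' = lam * (L * l) := by rw [hfam'.mul_eq, hfam.mul_eq, mul_assoc]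
  obtain ⟨hLL, -⟩ := Scale.le_of_scaleLE hfam.scale hfam'.scale
    (hsmall ℂ _ _ _ _ _ _ _ _ _ _ hfam.scale hfam'.scale hmul'.ge)
  have hL'0 := hfam'.scale.pos
  have hLL' : L ≤ L' := hLL.trans (mul_le_of_le_one_left hL'0.le hc'1)
  have hL'M : L' ≤ lam * M := by
    have h1 := hfam'.le_of_le hτ hε hlm
    have h2 : L' * L' * d.τ ≤ lam * m * d.τ := by
      rw [← hfam'.mul_eq, mul_assoc, mul_comm L' d.τ]
      gcongr
    have h3 := le_of_mul_le_mul_right h2 hτ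
    have h4 : lam * m ≤ lam * M := by gcongr
    have h5 : L' * 1 ≤ L' * L' := by gcongr; exact hL1.trans hLL'
    linarith
  have hll' : l' ≤ lam * l := by
    have : L * l' ≤ L * (lam * l) := by
      calc L * l' ≤ L' * l' := by gcongr
        _ = _ := by rw [hmul']; ring
    exact le_of_mul_le_mul_left this hL0
  obtain ⟨xf, yf, xe, ye, hp⟩ := hpoles hlow hlow' (lam * m) L' l' J' hlm (by gcongr)
    hfam' (by linarith [abs_nonneg m₁]) hL'M
  obtain ⟨ht, hpp⟩ := hshort hlow hlow' m L l J hm hmM hfam (by linarith [abs_nonneg m₁])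
    (hLX.trans hX2) x y hxy hXL
  obtain ⟨e1, e2, e3⟩ := hclose x y hxy hX2
  obtain ⟨⟨g, hg, hg1, hgβ⟩, g', hg', hg1', hgβ'⟩ := hd.2
  have hxre : |x.re| ≤ C₀ * L :=
    (Complex.abs_re_le_norm (⟨x.re, y.im⟩ : ℂ)).trans (e1.trans hXL)
  have hyim : |y.im| ≤ C₀ * L :=
    (Complex.abs_im_le_norm (⟨x.re, y.im⟩ : ℂ)).trans (e1.trans hXL)
  have hyre : |y.re| ≤ σ := (Complex.abs_re_le_norm (⟨y.re, x.im⟩ : ℂ)).trans e2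
  have hxim : |x.im| ≤ σ := (Complex.abs_im_le_norm (⟨y.re, x.im⟩ : ℂ)).trans e2
  have hσL : σ * L + σ ≤ s * ‖x + y‖ := by
    have h1 : s * L ≤ s * ‖x + y‖ := by gcongr
    have h2 : σ * 1 ≤ σ * L := by gcongr
    have h3 : s * L = 2 * (σ * L) := by rw [hσ]; ring
    linarith
  have hlν : ∀ t : ℝ, |t| ≤ C₀ * L → C * d.τ * (1 + |t|) ≤ τ₁ * σ * l := by
    intro t ht
    have h1 := hm₁ m ((le_abs_self m₁).trans (by linarith))
    rw [div_le_iff₀ (by positivity)] at h1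
    calc C * d.τ * (1 + |t|) ≤ C * d.τ * (C₀ * L + C₀ * L) := by
            gcongr
            exact one_le_mul_of_one_le_of_one_le hC₀ hL1
      _ = (2 * C * C₀) * (d.τ * L) := by ring
      _ ≤ (m ^ ε * (τ₁ * σ)) * (d.τ * L) := by gcongr
      _ = τ₁ * σ * (d.τ * m ^ ε * L) := by ring
      _ ≤ _ := by gcongr; exact hfam.decay
  have hDl : Ds * l ≤ D * l := by
    have : 0 < Dp * lam := by positivity
    gcongr
    linarith
  have hDl' : Dp * l' ≤ D * l := by
    calc Dp * l' ≤ Dp * (lam * l) := by gcongr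
      _ = Dp * lam * l := by ring
      _ ≤ D * l := by gcongr; linarith
  have h2C : 2 * C₀ * L ≤ c * L' := by
    calc 2 * C₀ * L ≤ 2 * C₀ * (c' * L') := by gcongr
      _ = c' * (2 * C₀) * L' := by ring
      _ ≤ _ := by gcongr
  have hHl : H < β / l := by
    rw [lt_div_iff₀ hl]
    have hH0 : 0 ≤ H := by rw [hH]; positivity
    have := hfam.le_mul hτ hL1 hmM
    calc H * l ≤ H * (M * d.τ) := by gcongr
      _ = H * M * d.τ := by ring
      _ < β := hHM
  have hH1 : 0 ≤ (C₀ + 1) * D / σ := by positivity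
  have hH2 : 0 ≤ (C₀ + 1) * (2 * D) / C₀ := by positivity
  rw [Complex.add_re] at hre
  rw [Complex.add_im] at him
  refine hd.1.dual.mem_of_scale (L := L) (l := l) (σ := σ) (C₀ := C₀) (D := D) (ν := τ₁ * σ)
    (τ₁ := τ₁) (φ := φ) (β := β) (x' := xe) (y' := yf) hxy.1 hxy.2 hL1 hl hσ0 hC0 hD0 hτ₁0
    (subset_closure hp.mem') (hd.1.dual.mem hp.isSub) hg hg' hg1 hg1' hgβ hgβ'
    (by linarith [(abs_le.1 hyre).2]) (le_of_abs_le hxre) (by linarith [(abs_le.1 hxim).2])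
    (le_of_abs_le hyim) (ht.trans hDl) (hpp.trans hDl)
    ((hlow.of_mem_closure hxy.1).trans' (neg_le_neg (hlν _ hxre)))
    ((hlow'.swap_of_mem_closure (hd.1.dual.mem hxy.2)).trans' (neg_le_neg (hlν _ hyim)))
    (h2C.trans hp.le_re) (hp.abs_im_le.trans hDl') (h2C.trans hp.le_im) (hp.abs_re_le.trans hDl')
    ?_ ?_ le_rfl ?_ hτφ
  · rw [mul_comm σ, ← div_lt_iff₀ hσ0]; linarith
  · rw [mul_comm C₀, ← div_lt_iff₀ hC0]; linarith
  · refine hinner d.u d.v d.A d.B L l J hd.1.dual hfam.scale x y hxy.1 hxy.2 ?_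
    rw [one_mul]
    exact hLX.trans (norm_add_le x y)

end

section

variable {κ β ε : ℝ}

theorem exists_mem_sector (hκ : 0 < κ) (hκ1 : κ ≤ 1) (hβ : 0 < β) (hε : 0 < ε) {C : ℝ}
    (hC : 0 < C) : ∃ s : ℝ, 0 < s ∧ ∀ r, ∃ R₀, ∀ᶠ d in ctxFilter κ β ε, d.Low C → d.swap.Low C →
      ∃ x ∈ d.A, ∃ y, IsSub d.u x y ∧ r ≤ ‖x + y‖ ∧ ‖x + y‖ ≤ R₀ ∧ s * ‖x + y‖ ≤ (x + y).re ∧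
        s * ‖x + y‖ ≤ (x + y).im := by
  obtain ⟨C₀, hC₀, hnear⟩ := exists_near hκ hκ1 β ε
  obtain ⟨rp, c, D, hrp, hc, hD, hpoles⟩ := exists_poles hκ hκ1 hβ hε hC
  obtain ⟨φ, hφ, hgrow⟩ := linear_growth hκ hκ1 (ρ := 1 / 16) (by norm_num)
  have hC0 : 0 < C₀ := by linarith
  obtain ⟨C₃, hC₃⟩ : ∃ C₃ : ℝ, C₃ = (4 / κ + 4 / κ * D) / c := ⟨_, rfl⟩
  have hC₃0 : 0 < C₃ := by rw [hC₃]; positivity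
  obtain ⟨C₄, hC₄⟩ : ∃ C₄ : ℝ, C₄ = 1 + 2 / κ := ⟨_, rfl⟩
  have hC₄0 : 0 < C₄ := by rw [hC₄]; positivity
  obtain ⟨θ, hθ⟩ : ∃ θ : ℝ, θ = min (κ / 32) (φ / (32 * (C₃ * C₄))) := ⟨_, rfl⟩
  have hθ0 : 0 < θ := by rw [hθ]; positivity
  have hθκ : θ ≤ κ / 32 := by rw [hθ]; exact min_le_left _ _
  have hθφ : θ * (C₃ * C₄) ≤ φ / 32 := by
    have : θ ≤ φ / (32 * (C₃ * C₄)) := by rw [hθ]; exact min_le_right _ _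
    rw [le_div_iff₀ (by positivity)] at this
    linarith
  obtain ⟨c₆, hc₆⟩ : ∃ c₆ : ℝ, c₆ = φ / (64 * D) := ⟨_, rfl⟩
  have hc₆0 : 0 < c₆ := by rw [hc₆]; positivity
  obtain ⟨K, hK⟩ : ∃ K : ℝ, K = 1 + 4 / κ := ⟨_, rfl⟩
  have hK0 : 0 < K := by rw [hK]; positivity
  obtain ⟨s, hs⟩ : ∃ s : ℝ, s = min (θ * c / 8) c₆ / K := ⟨_, rfl⟩
  have hs0 : 0 < s := by rw [hs]; positivity
  have hsK1 : s * K ≤ θ * c / 8 := by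
    rw [hs, div_mul_cancel₀ _ hK0.ne']; exact min_le_left _ _
  have hsK2 : s * K ≤ c₆ := by
    rw [hs, div_mul_cancel₀ _ hK0.ne']; exact min_le_right _ _
  obtain ⟨m₁, hm₁⟩ := Filter.eventually_atTop.1
    ((tendsto_rpow_atTop hε).eventually_gt_atTop (256 * C / (κ * φ)))
  refine ⟨s, hs0, fun r => ?_⟩
  obtain ⟨r₁, hr₁⟩ : ∃ r₁ : ℝ, r₁ = |m₁| + rp + |r| / c₆ := ⟨_, rfl⟩
  have hrc : 0 ≤ |r| / c₆ := by positivity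
  have hr₁1 : rp ≤ r₁ := by linarith [abs_nonneg m₁]
  obtain ⟨M, hM2, hnear⟩ := hnear (C₀ * r₁)
  refine ⟨C₀ * r₁ * K, ?_⟩
  filter_upwards [eventually_ctx κ β ε 0, hnear, hpoles (C₀ * r₁) M,
    eventually_mul_lt (D * M) (c := θ * min (c / 4) 1) (by positivity),
    eventually_mul_lt (C * K) (c := θ * c / 8) (by positivity)]
    with d hd hnear hpoles hDM hCK hlow hlow'
  obtain ⟨m, L, l, J, hm, hmM, hXm, hfam, hXL, hLX⟩ := hnear (C₀ * r₁)
    (le_mul_of_one_le_right hC0.le (by linarith)) le_rfl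
  have hτ := hd.1.pos
  have hl := hfam.scale.pos'
  have hrL : r₁ ≤ L := le_of_mul_le_mul_left hXL hC0
  have hrm : r₁ ≤ m := le_of_mul_le_mul_left hXm hC0
  have hL1 : 1 ≤ L := by linarith
  have hL0 : 0 < L := by linarith
  have hLl : 0 < L * l := by positivity
  obtain ⟨xf, yf, xe, ye, hp⟩ := hpoles hlow hlow' m L l J (by linarith) hmM hfam
    (hr₁1.trans hrL) hLX
  obtain ⟨a, ha⟩ : ∃ a : ℝ, a = 1 / (1 + θ) := ⟨_, rfl⟩
  obtain ⟨b, hb⟩ : ∃ b : ℝ, b = θ / (1 + θ) := ⟨_, rfl⟩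
  have ha0 : 0 < a := by rw [ha]; positivity
  have hb0 : 0 < b := by rw [hb]; positivity
  have hab : a + b = 1 := by rw [ha, hb]; field_simp
  have ha1 : a ≤ 1 := by linarith
  have hbθ : b ≤ θ := by
    rw [hb, div_le_iff₀ (by positivity)]
    have : 0 < θ * θ := by positivity
    linarith
  have hbθ' : θ / 2 ≤ b := by
    rw [hb]
    gcongr
    linarith
  have hDl : D * l ≤ θ * min (c / 4) 1 := by
    calc D * l ≤ D * (M * d.τ) := by gcongr; exact hfam.le_mul hτ hL1 hmM
      _ = D * M * d.τ := by ring
      _ ≤ _ := hDM.le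
  have hDl1 : D * l ≤ θ * (c / 4) * L := by
    calc D * l ≤ θ * min (c / 4) 1 := hDl
      _ ≤ θ * (c / 4) * 1 := by rw [mul_one]; gcongr; exact min_le_left _ _
      _ ≤ _ := by gcongr
  have hDl2 : D * l ≤ θ * L := by
    calc D * l ≤ θ * min (c / 4) 1 := hDl
      _ ≤ θ * 1 := by gcongr; exact min_le_right _ _
      _ ≤ _ := by gcongr
  obtain ⟨x, hx⟩ : ∃ x : ℂ, x = a • xf + b • xe := ⟨_, rfl⟩
  have hxA : x ∈ d.A := by rw [hx]; exact hd.1.dual.convex hp.mem hp.mem' ha0.le hb0.le hab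
  obtain ⟨y, hy⟩ := exists_isSub hd.1.dual.convexOn x
  have hbe : ‖b • usc L l J xe‖ ≤ 1 / 16 := by
    rw [norm_smul, Real.norm_eq_abs, abs_of_pos hb0]
    calc b * ‖usc L l J xe‖ ≤ κ / 32 * (2 / κ) := by
          gcongr
          · linarith
          · exact hp.usc_le'
      _ = 1 / 16 := by field_simp; norm_num
  have hnf : ‖a • usc L l J xf‖ = a * ‖usc L l J xf‖ := by
    rw [norm_smul, Real.norm_eq_abs, abs_of_pos ha0]
  have husc : usc L l J x = a • usc L l J xf + b • usc L l J xe := by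
    rw [hx, usc_add, usc_smul, usc_smul]
  have hu1 : ‖usc L l J x‖ ≤ 3 / 4 := by
    rw [husc]
    refine (norm_add_le _ _).trans ?_
    have : a * ‖usc L l J xf‖ ≤ 1 * (1 / 2) := by gcongr; exact hp.usc_le
    linarith
  have hu2 : 1 / 16 ≤ ‖usc L l J x‖ := by
    rw [husc]
    have h1 := norm_sub_le_norm_add (a • usc L l J xf) (b • usc L l J xe)
    have h2 : (7 / 8) * (1 / 4) ≤ a * ‖usc L l J xf‖ := by
      gcongr
      · linarith
      · exact hp.le_usc
    linarith
  have hgx : φ / 16 * (L * l) ≤ d.u x := by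
    refine le_trans ?_ (hfam.scale.fst.growth hgrow (subset_closure hxA) hu2)
    calc φ / 16 * (L * l) = φ * (1 / 16) * (L * l) := by ring
      _ ≤ _ := by gcongr
  have hyu : ‖usc l L J y‖ ≤ 4 / κ := by
    refine (hfam.scale.fst.norm_usc_sub_le hy (r := 1 / 4) (by norm_num) (by linarith)).trans ?_
    rw [div_div, div_le_div_iff₀ (by positivity) hκ]
    linarith
  have hxy3 : ⟪x, y⟫ ≤ 3 / κ * (L * l) := by
    calc ⟪x, y⟫ ≤ L * l * (‖usc L l J x‖ * ‖usc l L J y‖) := inner_le_usc hL0 hl J x y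
      _ ≤ L * l * (3 / 4 * (4 / κ)) := by gcongr
      _ = _ := by ring
  obtain ⟨hux, hvy⟩ := hd.1.dual.le_inner hy
  have hxn : ‖x‖ ≤ L := by
    refine (norm_le_mul_norm_usc (J := J) hL0 hl hfam.scale.le x).trans ?_
    exact mul_le_of_le_one_right hL0.le (by linarith)
  have hyn : ‖y‖ ≤ 4 / κ * L := by
    refine (norm_le_mul_norm_usc_swap (J := J) hL0 hl hfam.scale.le y).trans ?_
    rw [mul_comm]
    gcongr
  have hyim := (Complex.abs_im_le_norm y).trans hyn
  have hxre := (Complex.abs_re_le_norm x).trans hxn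
  have hxs : x.re = a * xf.re + b * xe.re := by rw [hx]; simp
  have hxt : x.im = a * xf.im + b * xe.im := by rw [hx]; simp
  have hfre := (Complex.abs_re_le_norm xf).trans hp.norm_le
  have hfim := (Complex.abs_im_le_norm xf).trans hp.norm_le
  have hafre : |a * xf.re| ≤ D * l := by
    rw [abs_mul, abs_of_pos ha0]
    exact (mul_le_of_le_one_left (abs_nonneg _) ha1).trans hfre
  have hafim : |a * xf.im| ≤ D * l := by
    rw [abs_mul, abs_of_pos ha0]
    exact (mul_le_of_le_one_left (abs_nonneg _) ha1).trans hfim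
  have hbeim : |b * xe.im| ≤ D * l := by
    rw [abs_mul, abs_of_pos hb0]
    exact (mul_le_of_le_one_left (abs_nonneg _) (by linarith)).trans hp.abs_im_le
  have hs1 : θ * c / 4 * L ≤ x.re := by
    have : θ / 2 * (c * L) ≤ b * xe.re := by
      gcongr
      exact hp.le_re
    rw [hxs]
    linarith [(abs_le.1 hafre).1]
  have hs2 : x.re ≤ θ * C₄ * L := by
    have : b * xe.re ≤ θ * (2 / κ * L) := by
      have := le_trans (by positivity) hp.le_re
      gcongr
      exact hp.re_le
    rw [hxs, hC₄]
    linarith [(abs_le.1 hafre).2]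
  have ht2 : x.im ≤ 2 * D * l := by
    rw [hxt]; linarith [(abs_le.1 hafim).2, (abs_le.1 hbeim).2]
  have hpl : y.re ≤ C₃ * l := by
    have hyoung := hd.1.dual.young xe (hd.1.dual.mem hy)
    rw [cinner] at hyoung
    have h1 := hp.val_le'
    have h2 : |xe.im * y.im| ≤ D * l * (4 / κ * L) := by
      rw [abs_mul]
      gcongr
      exact hp.abs_im_le
    have h3 : xe.re * y.re ≤ (4 / κ + 4 / κ * D) * (L * l) := by
      have e1 : L * l / κ = 1 / κ * (L * l) := by ring
      have e2 : 1 / κ * (L * l) + 3 / κ * (L * l) = 4 / κ * (L * l) := by ring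
      linarith [(abs_le.1 h2).1]
    by_contra hcon
    push Not at hcon
    have h4 : (4 / κ + 4 / κ * D) * (L * l) < xe.re * y.re := by
      calc (4 / κ + 4 / κ * D) * (L * l) = c * L * (C₃ * l) := by rw [hC₃]; field_simp
        _ < c * L * y.re := by gcongr
        _ ≤ _ := by
            have : 0 ≤ y.re := le_trans (by positivity) hcon.le
            gcongr
            exact hp.le_re
    linarith
  have hsp : x.re * y.re ≤ φ / 32 * (L * l) := by
    have hx0 : 0 ≤ x.re := le_trans (by positivity) hs1
    calc x.re * y.re ≤ x.re * (C₃ * l) := by gcongr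
      _ ≤ θ * C₄ * L * (C₃ * l) := by gcongr
      _ = θ * (C₃ * C₄) * (L * l) := by ring
      _ ≤ _ := by gcongr
  have htq : φ / 32 * (L * l) ≤ x.im * y.im := by
    rw [cinner] at hux
    linarith
  have ht0 : 0 < x.im := by
    by_contra hcon
    push Not at hcon
    have h1 := hlow x hxA
    have h2 := hm₁ m ((le_abs_self m₁).trans (by linarith))
    rw [div_lt_iff₀ (by positivity)] at h2
    have h3 : C * d.τ * (1 + |x.re|) ≤ 2 * C * (d.τ * L) := by
      calc C * d.τ * (1 + |x.re|) ≤ C * d.τ * (L + L) := by gcongr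
        _ = _ := by ring
    have h4 : x.im * y.im ≤ 2 * C * (d.τ * L) * (4 / κ * L) := by
      refine (le_abs_self _).trans ?_
      rw [abs_mul, abs_of_nonpos hcon]
      gcongr
      linarith
    have h5 : 2 * C * (d.τ * L) * (4 / κ * L) < φ / 32 * (L * l) := by
      calc 2 * C * (d.τ * L) * (4 / κ * L) = (256 * C) * (d.τ * L * L / (32 * κ)) := by
            field_simp; norm_num
        _ < (m ^ ε * (κ * φ)) * (d.τ * L * L / (32 * κ)) := by gcongr
        _ = φ / 32 * (L * (d.τ * m ^ ε * L)) := by field_simp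
        _ ≤ _ := by gcongr; exact hfam.decay
    linarith
  have hq : c₆ * L ≤ y.im := by
    by_contra hcon
    push Not at hcon
    have h1 : x.im * y.im < x.im * (c₆ * L) := by gcongr
    have h2 : x.im * (c₆ * L) ≤ 2 * D * l * (c₆ * L) := by gcongr
    have h3 : 2 * D * l * (c₆ * L) = φ / 32 * (L * l) := by rw [hc₆]; field_simp; norm_num
    linarith
  have hpp : -(θ * c / 8 * L) ≤ y.re := by
    refine (hlow'.swap_of_mem_closure (hd.1.dual.mem hy)).trans' (neg_le_neg ?_)
    calc C * d.τ * (1 + |y.im|) ≤ C * d.τ * (L + 4 / κ * L) := by gcongr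
      _ = C * K * d.τ * L := by rw [hK]; ring
      _ ≤ _ := by gcongr
  have hXn : ‖x + y‖ ≤ K * L := by
    refine (norm_add_le _ _).trans ?_
    rw [hK]; linarith
  have him : c₆ * L ≤ (x + y).im := by rw [Complex.add_im]; linarith
  have hre : θ * c / 8 * L ≤ (x + y).re := by
    rw [Complex.add_re]
    linarith
  refine ⟨x, hxA, y, hy, ?_, ?_, ?_, ?_⟩
  · refine le_trans ?_ ((le_abs_self _).trans (Complex.abs_im_le_norm (x + y)))
    refine le_trans ?_ him
    have : |r| / c₆ ≤ L := by linarith [abs_nonneg m₁]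
    rw [div_le_iff₀ hc₆0] at this
    linarith [le_abs_self r]
  · refine hXn.trans ?_
    rw [mul_comm]
    gcongr
  · calc s * ‖x + y‖ ≤ s * (K * L) := by gcongr
      _ = s * K * L := by ring
      _ ≤ θ * c / 8 * L := by gcongr
      _ ≤ _ := hre
  · calc s * ‖x + y‖ ≤ s * (K * L) := by gcongr
      _ = s * K * L := by ring
      _ ≤ c₆ * L := by gcongr
      _ ≤ _ := him

end

section

variable {κ β ε : ℝ}

theorem re_ge_of_mem_annSector {a b e r R : ℝ} {X : ℂ} (he : 0 < e) (ha : -(Real.pi / 2) + e ≤ a)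
    (hb : b ≤ Real.pi / 2 - e) (hX : X ∈ annSector a b r R) : Real.sin e * ‖X‖ ≤ X.re := by
  obtain ⟨ω, -, h2, rfl⟩ := hX
  rw [Complex.norm_exp, Complex.exp_re, mul_comm, ← Real.cos_abs]
  have : Real.sin e ≤ Real.cos |ω.im| := by
    rw [← Real.cos_pi_div_two_sub e]
    refine Real.cos_le_cos_of_nonneg_of_le_pi (abs_nonneg _) (by linarith [Real.pi_pos])
      (abs_le.2 ⟨by linarith [h2.1], by linarith [h2.2]⟩)
  gcongr

theorem Complex.arg_mem_of_re_im {X : ℂ} {e : ℝ} (he : 0 < e) (he' : e ≤ Real.pi / 2) (hX : X ≠ 0)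
    (h : Real.sin e * ‖X‖ ≤ X.re) (h' : Real.sin e * ‖X‖ ≤ X.im) :
    e ≤ X.arg ∧ X.arg ≤ Real.pi / 2 - e := by
  obtain ⟨h1, -⟩ := Complex.arg_mem_of_im he he' hX h'
  have hn : 0 < ‖X‖ := norm_pos_iff.2 hX
  refine ⟨h1, ?_⟩
  by_contra hcon
  push Not at hcon
  have h2 := Real.cos_lt_cos_of_nonneg_of_le_pi (by linarith) (Complex.arg_le_pi X) hcon
  rw [Real.cos_pi_div_two_sub, Complex.cos_arg hX, div_lt_iff₀ hn] at h2
  linarith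

/-- The source and the rotated target cannot both lie almost above the horizontal axis. -/
theorem eventually_not_low_low (hκ : 0 < κ) (hκ1 : κ ≤ 1) (hβ : 0 < β) (hε : 0 < ε) {C : ℝ}
    (hC : 0 < C) : ∀ᶠ d in ctxFilter κ β ε, ¬ (d.Low C ∧ d.swap.Low C) := by
  have hπ := Real.pi_pos
  obtain ⟨s₀, hs₀, hmem⟩ := exists_mem_sector hκ hκ1 hβ hε hC
  obtain ⟨e₁, he₁⟩ : ∃ e : ℝ, e = ε * Real.pi / (16 * (1 + ε)) := ⟨_, rfl⟩
  have heq : e₁ * (16 * (1 + ε)) = ε * Real.pi := by rw [he₁]; field_simp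
  have he₁0 : 0 < e₁ := by rw [he₁]; positivity
  have he₁π : e₁ ≤ Real.pi / 16 := by
    rw [he₁, div_le_div_iff₀ (by positivity) (by positivity)]
    nlinarith
  obtain ⟨e, he⟩ : ∃ e : ℝ, e = min e₁ s₀ := ⟨_, rfl⟩
  have he0 : 0 < e := by rw [he]; exact lt_min he₁0 hs₀
  have hee : e ≤ e₁ := by rw [he]; exact min_le_left _ _
  have hes : e ≤ s₀ := by rw [he]; exact min_le_right _ _
  have hsin : 0 < Real.sin e := Real.sin_pos_of_pos_of_lt_pi he0 (by linarith)
  have hsin' : Real.sin e ≤ s₀ := (Real.sin_le he0.le).trans hes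
  have hnc : ‖Complex.exp (-(Real.pi / 4 : ℝ) * Complex.I)‖ = 1 := by
    have := Complex.norm_exp_ofReal_mul_I (-(Real.pi / 4))
    push_cast at this ⊢
    exact this
  have hgr : e * (1 + ε) ≤ e₁ * (1 + ε) := by gcongr
  have hεπ : 0 < ε * Real.pi := by positivity
  have heε : 0 < e * ε := by positivity
  obtain ⟨ra, hra, hns⟩ := exists_not_sector hκ hκ1 hε β (a := e) (b := Real.pi / 2 - e)
    (w := Real.pi / 2 + 2 * e) (by linarith) (by linarith) hnc (by linarith)
  obtain ⟨rb, hrb, hlowim⟩ := exists_le_im_of_low hκ hκ1 hε β hC hsin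
  obtain ⟨c₁, rc, hc₁, hrc, hshort⟩ := exists_le_short hκ hκ1 hε β
  obtain ⟨rd, hrd, hsec⟩ := exists_mem_of_sector hκ hκ1 hβ hε hC hsin
  obtain ⟨r, hr⟩ : ∃ r : ℝ, r = ra + rb + rc + rd + 1 := ⟨_, rfl⟩
  obtain ⟨R₀, hmem⟩ := hmem r
  obtain ⟨R, hR, hR1⟩ := ((hns r (by linarith)).and
    (Filter.eventually_ge_atTop (max R₀ 1))).exists
  have hR0 : R₀ ≤ R := (le_max_left _ _).trans hR1
  have hR1 : 1 ≤ R := (le_max_right _ _).trans hR1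
  filter_upwards [eventually_ctx κ β ε 0, hR, hlowim R, eventually_swap (hlowim R), hshort R,
    hsec R, hmem, eventually_close hκ hκ1 β ε R one_pos]
    with d hd hR hlowim hlowim' hshort hsec hmem hclose
  rintro ⟨hlow, hlow'⟩
  refine hR ?_ ?_
  · intro x y hxy hX
    obtain ⟨hX1, hX2⟩ := norm_mem_of_mem_annSector (by linarith) (by linarith) hX
    have hXim := im_ge_of_mem_annSector he0 (by linarith) le_rfl (by linarith) hX
    have hXre := re_ge_of_mem_annSector he0 (by linarith) le_rfl hX
    obtain ⟨e1, -, e3⟩ := hclose x y hxy hX2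
    have hz : 0 < ‖(⟨y.re, x.im⟩ : ℂ)‖ := by
      refine lt_of_lt_of_le ?_ (hshort x y hxy (by linarith) (e1.trans hX2))
      have := hd.1.pos
      have : 0 < ‖(⟨x.re, y.im⟩ : ℂ)‖ := by linarith
      positivity
    refine ⟨hsec hlow hlow' x y hxy (by linarith) hX2 hXre hXim, ?_⟩
    have h1 := hlowim hlow x y hxy (by linarith) (e1.trans hX2)
    have n1 : (⟨(diagRefl y).re, (diagRefl x).im⟩ : ℂ) = diagRefl ⟨x.re, y.im⟩ := by
      apply Complex.ext <;> simp
    have n2 : (⟨(diagRefl x).re, (diagRefl y).im⟩ : ℂ) = diagRefl ⟨y.re, x.im⟩ := by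
      apply Complex.ext <;> simp
    have h2 := hlowim' hlow' _ _ (Config.graph_swap hd.1.dual hxy)
    rw [n1, n2, LinearIsometryEquiv.norm_map, LinearIsometryEquiv.norm_map] at h2
    have h2 := h2 (by linarith) (e1.trans hX2)
    rw [diagRefl_im] at h2
    have := Complex.abs_arg_le_of_re_im (norm_pos_iff.1 hz) he0.le (by linarith) h2 h1
    linarith
  · obtain ⟨x, hx, y, hy, h1, h2, h3, h4⟩ := hmem hlow hlow'
    have hne : x + y ≠ 0 := by rw [← norm_pos_iff]; linarith
    have hle : Real.sin e * ‖x + y‖ ≤ s₀ * ‖x + y‖ := by gcongr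
    obtain ⟨h5, h6⟩ := Complex.arg_mem_of_re_im he0 (by linarith) hne (hle.trans h3) (hle.trans h4)
    exact ⟨x, hx, y, hy, mem_annSector (by linarith) h1 (h2.trans hR0) h5 h6⟩

theorem Config.Low.mono {C C' : ℝ} {d : Config} (h : d.Low C) (hτ : 0 ≤ d.τ) (hC : C ≤ C') :
    d.Low C' := by
  intro x hx
  refine le_trans ?_ (h x hx)
  gcongr

theorem eventually_false (hκ : 0 < κ) (hκ1 : κ ≤ 1) (hβ : 0 < β) (hε : 0 < ε) :
    ∀ᶠ _d in ctxFilter κ β ε, False := by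
  obtain ⟨K, hK, hnd⟩ := eventually_not_dip (κ := κ) hκ hκ1 hβ ε
  obtain ⟨C, hC, hld⟩ := eventually_low_or_dip (κ := κ) (β := β) (ε := ε) hκ hK
  obtain ⟨K', hK', hnld⟩ := exists_not_low_dip hκ hκ1 hβ hε hC
  obtain ⟨C', hC', hld'⟩ := eventually_low_or_dip (κ := κ) (β := β) (ε := ε) hκ hK'
  have hmax : 0 < max C C' := lt_max_of_lt_left hC
  have hnll := eventually_not_low_low hκ hκ1 hβ hε hmax
  have key : ∀ᶠ d in ctxFilter κ β ε, ¬ d.Low C := by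
    filter_upwards [eventually_ctx κ β ε 0, hnld, eventually_swap hld', hnll]
      with d hd hnld hld' hnll hlow
    refine hnll ⟨hlow.mono hd.1.pos.le (le_max_left _ _), ?_⟩
    exact (hld'.resolve_right (hnld hlow)).mono (d := d.swap) hd.1.pos.le (le_max_right _ _)
  filter_upwards [hnd, hld, eventually_swap hld, key, eventually_swap key] with d h1 h2 h3 h4 h5
  exact h1 ⟨h2.resolve_left h4, h3.resolve_left h5⟩

end

section

variable {κ β ε : ℝ}

theorem exists_not_ctx (hκ : 0 < κ) (hκ1 : κ ≤ 1) (hβ : 0 < β) (hε : 0 < ε) :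
    ∃ Λ τ₀ : ℝ, 0 < τ₀ ∧ ∀ τ u v A B, τ < τ₀ → ¬ Ctx κ β ε Λ τ u v A B := by
  obtain ⟨Λ, τ₀, h0, h⟩ := eventually_ctxFilter.1 (eventually_false hκ hκ1 hβ hε)
  refine ⟨Λ, τ₀, h0, fun τ u v A B hτ hctx => ?_⟩
  have sign : ∀ t : ℝ, ∃ a : ℝ, a * a = 1 ∧ a * t = |t| := fun t => by
    rcases le_total 0 t with ht | ht
    · exact ⟨1, by norm_num, by rw [abs_of_nonneg ht, one_mul]⟩
    · exact ⟨-1, by norm_num, by rw [abs_of_nonpos ht]; ring⟩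
  obtain ⟨g, hg, hg1, hgβ⟩ := hctx.fat Complex.I (by simp)
  obtain ⟨k, hk, hk1, hkβ⟩ := hctx.fat' 1 (by simp)
  rw [cinner] at hgβ hkβ
  simp only [Complex.I_re, Complex.I_im, Complex.one_re, Complex.one_im, mul_zero, mul_one,
    zero_add, add_zero] at hgβ hkβ
  obtain ⟨b, hb, hbg⟩ := sign g.im
  obtain ⟨a, ha, hak⟩ := sign k.re
  have inv : ∀ z, axisRefl a b ha hb (axisRefl a b ha hb z) = z :=
    fun z => (axisRefl a b ha hb).symm_apply_apply z
  refine h ⟨τ, _, _, _, _⟩ (hctx.axisRefl a b ha hb) ⟨⟨axisRefl a b ha hb g, ?_, ?_, ?_⟩,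
    axisRefl a b ha hb k, ?_, ?_, ?_⟩ hτ
  · change axisRefl a b ha hb (axisRefl a b ha hb g) ∈ A
    rwa [inv]
  · simpa only [LinearIsometryEquiv.norm_map] using hg1
  · change β ≤ b * g.im
    rwa [hbg]
  · change axisRefl a b ha hb (axisRefl a b ha hb k) ∈ B
    rwa [inv]
  · simpa only [LinearIsometryEquiv.norm_map] using hk1
  · change β ≤ a * k.re
    rwa [hak]

theorem sc_self_eq_smul {F : Type*} [NormedAddCommGroup F] [InnerProductSpace ℝ F] (r : ℝ)
    (J : ℂ ≃ₗᵢ[ℝ] F) (a : ℂ) : sc r r J a = r • J a := by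
  rw [← map_smul, sc]
  congr 1
  apply Complex.ext <;> simp

/-- Along a family of scales the eccentricity grows more slowly than any negative power. -/
theorem exists_div_le (hκ : 0 < κ) (hκ1 : κ ≤ 1) (hβ : 0 < β) (hε : 0 < ε) {c : ℝ} (hc : 0 < c)
    (hc1 : c ≤ 1) : ∃ C : ℝ, 0 < C ∧ ∀ (F : Type) [NormedAddCommGroup F] [InnerProductSpace ℝ F]
      [FiniteDimensional ℝ F] [MeasurableSpace F] [BorelSpace F] (u v : F → ℝ) (A B : Set F)
      (L l : ℝ → ℝ) (J : ℝ → ℂ ≃ₗᵢ[ℝ] F), DualPair u v A B →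
      (∀ w : F, ‖w‖ = 1 → ∃ g ∈ A, ‖g‖ ≤ 1 ∧ β ≤ |⟪g, w⟫|) →
      (∀ w : F, ‖w‖ = 1 → ∃ g ∈ B, ‖g‖ ≤ 1 ∧ β ≤ |⟪g, w⟫|) → L 1 = 1 → l 1 = 1 →
      (∀ h ∈ Ioc (0 : ℝ) 1, L h * l h = h ∧ Scale κ u v A B (c * L h) (c * l h) (J h)) →
      ∀ h ∈ Ioc (0 : ℝ) 1, L h / l h * h ^ ε ≤ C := by
  obtain ⟨C₁, hC₁, hcmp⟩ := Scale.exists_scaleLE hκ hκ1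
  have hC₁0 : 0 < C₁ := by linarith
  obtain ⟨Λ, τ₀, hτ₀, hno⟩ := exists_not_ctx (κ := κ) (β := β / C₁) (ε := ε) hκ hκ1
    (by positivity) hε
  refine ⟨max (1 / τ₀) (C₁ ^ 2 * |Λ|), lt_max_of_lt_left (by positivity), ?_⟩
  intro F _ _ _ _ _ u v A B L l J hdual hfat hfat' hL1 hl1 hS
  have hpos : ∀ h ∈ Ioc (0 : ℝ) 1, 0 < L h ∧ 0 < l h := fun h hh =>
    ⟨pos_of_mul_pos_right (hS h hh).2.pos hc.le, pos_of_mul_pos_right (hS h hh).2.pos' hc.le⟩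
  have hLC : ∀ h ∈ Ioc (0 : ℝ) 1, L h ≤ C₁ := by
    intro h hh
    have h1 := (hS h hh).2.le_of_scaleLE (hS 1 ⟨one_pos, le_rfl⟩).2
      (hcmp F _ _ _ _ _ _ _ _ _ _ (hS h hh).2 (hS 1 ⟨one_pos, le_rfl⟩).2 (by
        have h2 := (hS h hh).1
        calc c * L h * (c * l h) = c * c * (L h * l h) := by ring
          _ ≤ c * c * 1 := by rw [h2]; gcongr; exact hh.2
          _ = _ := by rw [hL1, hl1]; ring))
    rw [hL1] at h1
    exact le_of_mul_le_mul_left (by linarith [h1.1]) hc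
  have step : ∀ h ∈ Ioc (0 : ℝ) 1, Λ * h ≤ 1 → l h / L h < τ₀ →
      ∃ m, 2 ≤ m ∧ m ≤ Λ ∧ l (m * h) < l h / L h * m ^ ε * L (m * h) := by
    intro h hh hΛ hτ
    by_contra hcon
    push Not at hcon
    obtain ⟨hLh, hlh⟩ := hpos h hh
    have hr : 0 < c * L h := by positivity
    have hrC : c * L h / C₁ ≤ 1 := by
      rw [div_le_one hC₁0]
      nlinarith [hLC h hh]
    have fat : ∀ D : Set F, Convex ℝ D → IsOpen D → 0 ∈ closure D →
        (∀ w : F, ‖w‖ = 1 → ∃ g ∈ D, ‖g‖ ≤ 1 ∧ β ≤ |⟪g, w⟫|) → ∀ w : ℂ, ‖w‖ = 1 →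
        ∃ g ∈ sc (c * L h) (c * L h) (J h) ⁻¹' D, ‖g‖ ≤ 1 ∧ β / C₁ ≤ |⟪g, w⟫| := by
      intro D hD hDo h0 hfat w hw
      obtain ⟨g, hg, hg1, hgβ⟩ := hfat (J h w) (by simpa using hw)
      refine ⟨(1 / C₁) • (J h).symm g, ?_, ?_, ?_⟩
      · rw [mem_preimage, sc_self_eq_smul, map_smul, LinearIsometryEquiv.apply_symm_apply, smul_smul,
          mul_one_div]
        exact hD.smul_mem_of_zero_mem_closure hDo h0 hg (by positivity) hrC
      · rw [norm_smul, LinearIsometryEquiv.norm_map, Real.norm_of_nonneg (by positivity)]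
        have : 1 / C₁ ≤ 1 := by rw [div_le_one hC₁0]; exact hC₁
        calc 1 / C₁ * ‖g‖ ≤ 1 * 1 := by gcongr
          _ = 1 := one_mul 1
      · rw [real_inner_smul_left, abs_mul, abs_of_nonneg (by positivity), ← (J h).inner_map_map,
          LinearIsometryEquiv.apply_symm_apply, div_eq_mul_one_div, mul_comm]
        gcongr
    refine hno (l h / L h) _ _ _ _ hτ ⟨hdual.comp_sc hr hr (J h), ?_, ?_,
      fat A hdual.convex hdual.isOpen hdual.zero_mem hfat,
      fat B hdual.convex' hdual.isOpen' hdual.zero_mem' hfat'⟩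
    · have := (hS h hh).2.comp_sc hr (J h)
      rwa [div_self hr.ne', mul_div_mul_left _ _ hc.ne', LinearIsometryEquiv.self_trans_symm] at this
    · intro m hm1 hmΛ
      have hmh : m * h ∈ Ioc (0 : ℝ) 1 :=
        ⟨mul_pos (by linarith) hh.1, le_trans (by gcongr; exact hh.1.le) hΛ⟩
      obtain ⟨hmul, hSm⟩ := hS _ hmh
      have hSm := hSm.comp_sc hr (J h)
      rw [mul_div_mul_left _ _ hc.ne', mul_div_mul_left _ _ hc.ne'] at hSm
      refine ⟨_, _, _, hSm, ?_, fun hm2 => ?_⟩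
      · rw [div_mul_div_comm, hmul]
        nth_rw 1 [← (hS h hh).1]
        field_simp
      · rw [← mul_div_assoc]
        gcongr
        exact hcon m hm2 hmΛ
  have main : ∀ n : ℕ, ∀ h ∈ Ioc (0 : ℝ) 1, 1 < h * 2 ^ n →
      L h / l h * h ^ ε ≤ max (1 / τ₀) (C₁ ^ 2 * |Λ|) := by
    intro n
    induction n with
    | zero => intro h hh hn; rw [pow_zero, mul_one] at hn; exact absurd hh.2 (not_le.2 hn)
    | succ n ih =>
      intro h hh hn
      obtain ⟨hLh, hlh⟩ := hpos h hh
      have hhε : h ^ ε ≤ 1 := Real.rpow_le_one hh.1.le hh.2 hε.le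
      have hhε0 : 0 < h ^ ε := Real.rpow_pos_of_pos hh.1 ε
      by_cases hΛ : Λ * h ≤ 1
      · by_cases hτ : l h / L h < τ₀
        · obtain ⟨m, hm2, hmΛ, hlt⟩ := step h hh hΛ hτ
          have hm0 : 0 < m := by linarith
          have hmh : m * h ∈ Ioc (0 : ℝ) 1 :=
            ⟨mul_pos hm0 hh.1, le_trans (by gcongr; exact hh.1.le) hΛ⟩
          obtain ⟨hLm, hlm⟩ := hpos _ hmh
          refine le_trans ?_ (ih (m * h) hmh ?_)
          · rw [Real.mul_rpow hm0.le hh.1.le, ← mul_assoc]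
            gcongr
            rw [div_le_iff₀ hlh, div_mul_eq_mul_div, div_mul_eq_mul_div, le_div_iff₀ hlm]
            rw [div_mul_eq_mul_div, div_mul_eq_mul_div, lt_div_iff₀ hLh] at hlt
            linarith
          · refine hn.trans_le ?_
            rw [pow_succ]
            have : 0 < h * 2 ^ n := mul_pos hh.1 (by positivity)
            nlinarith
        · refine le_trans ?_ (le_max_left _ _)
          push Not at hτ
          have h1 : L h / l h ≤ 1 / τ₀ := by
            rw [div_le_div_iff₀ hlh hτ₀]
            rw [le_div_iff₀ hLh] at hτ
            linarith
          calc L h / l h * h ^ ε ≤ 1 / τ₀ * 1 := by gcongr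
            _ = _ := mul_one _
      · refine le_trans ?_ (le_max_right _ _)
        push Not at hΛ
        have h1 : L h / l h ≤ C₁ ^ 2 * |Λ| := by
          have h2 : 1 ≤ |Λ| * (L h * l h) := by
            rw [(hS h hh).1]
            exact hΛ.le.trans (mul_le_mul_of_nonneg_right (le_abs_self Λ) hh.1.le)
          rw [div_le_iff₀ hlh]
          calc L h ≤ L h * (|Λ| * (L h * l h)) := le_mul_of_one_le_right hLh.le h2
            _ = L h ^ 2 * |Λ| * l h := by ring
            _ ≤ C₁ ^ 2 * |Λ| * l h := by gcongr; exact hLC h hh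
        calc L h / l h * h ^ ε ≤ C₁ ^ 2 * |Λ| * 1 := by gcongr
          _ = _ := mul_one _
  intro h hh
  obtain ⟨n, hn⟩ := pow_unbounded_of_one_lt (1 / h) (one_lt_two)
  refine main n h hh ?_
  rw [div_lt_iff₀ hh.1] at hn
  linarith

end

section

variable {F : Type*} [NormedAddCommGroup F] [InnerProductSpace ℝ F] [FiniteDimensional ℝ F]
  [MeasurableSpace F] [BorelSpace F] {L l δ : ℝ} {J : ℂ ≃ₗᵢ[ℝ] F}

open scoped Pointwise in
theorem volume_norm_usc_sub_le (J : ℂ ≃ₗᵢ[ℝ] F) (x : F) {r : ℝ} (hr : 0 < r) :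
    volume {y | ‖usc L l J (y - x)‖ ≤ r} =
      ENNReal.ofReal (r ^ 2) * volume {y | ‖usc L l J y‖ ≤ 1} := by
  have hF : Module.finrank ℝ F = 2 := by
    rw [← J.toLinearEquiv.finrank_eq, Complex.finrank_real_complex]
  have h1 : {y | ‖usc L l J (y - x)‖ ≤ r} = (fun y => y - x) ⁻¹' (r • {y | ‖usc L l J y‖ ≤ 1}) := by
    ext y
    rw [mem_preimage, mem_smul_set_iff_inv_smul_mem₀ hr.ne', mem_ofPred_eq, mem_ofPred_eq, usc_smul,
      norm_smul, norm_inv, Real.norm_of_nonneg hr.le, inv_mul_le_one₀ hr]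
  simp only [sub_eq_add_neg] at h1 ⊢
  rw [h1, measure_preimage_add_right, Measure.addHaar_smul, hF, abs_of_nonneg (by positivity)]

/-- A convex set whose centre of mass is the origin contains a multiple of every ellipse to which it
is comparable. -/
theorem le_inner_of_centroid (hL : 0 < L) (hl : 0 < l) (hδ : 0 < δ) {S : Set F}
    (hSm : MeasurableSet S) (hcm : ∫ x in S, x = 0) {x₀ : F}
    (hS : ∀ x, ‖usc L l J (x - x₀)‖ < δ → x ∈ S) (hS' : ∀ x ∈ S, ‖usc L l J x‖ ≤ δ⁻¹) {w : F}
    (hw : w ≠ 0) {t : ℝ} (ht : ∀ x ∈ S, ⟪w, x⟫ < t) :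
    δ ^ 5 / 16 * (L * l * ‖usc l L J w‖) ≤ t := by
  obtain ⟨E, hE⟩ : ∃ E : Set F, E = {y | ‖usc L l J y‖ ≤ 1} := ⟨_, rfl⟩
  have hu : 0 < ‖usc l L J w‖ := by
    rw [norm_pos_iff]
    intro h
    apply hw
    rw [← sc_usc (J := J) hl hL w, h, sc_zero]
  have hEc : IsCompact E := by
    have : E = scHomeo hL hl J '' closedBall 0 1 := by
      rw [Homeomorph.image_eq_preimage_symm, hE]
      ext y
      simp [scHomeo]
    rw [this]
    exact (isCompact_closedBall 0 1).image (scHomeo hL hl J).continuous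
  have hE0 : 0 < volume E := by
    refine lt_of_lt_of_le ?_ (measure_mono (s := {y | ‖usc L l J y‖ < 1}) ?_)
    · refine IsOpen.measure_pos volume (isOpen_lt continuous_usc.norm continuous_const)
        ⟨0, by simp [usc_zero]⟩
    · rw [hE]; intro y hy; rw [mem_ofPred_eq] at hy ⊢; exact hy.le
  have hV : 0 < volume.real E := ENNReal.toReal_pos hE0.ne' hEc.measure_lt_top.ne
  obtain ⟨Q, hQ⟩ : ∃ Q : Set F, Q = {y | ‖usc L l J (y - x₀)‖ ≤ δ / 2} := ⟨_, rfl⟩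
  have hQS : Q ⊆ S := by
    intro y hy
    rw [hQ, mem_ofPred_eq] at hy
    exact hS y (by linarith)
  have hQm : MeasurableSet Q := by
    rw [hQ]
    exact (isClosed_le ((continuous_usc.comp (continuous_id.sub continuous_const)).norm)
      continuous_const).measurableSet
  have hQv : volume.real Q = (δ / 2) ^ 2 * volume.real E := by
    rw [Measure.real, hQ, volume_norm_usc_sub_le J x₀ (by positivity), ENNReal.toReal_mul,
      ENNReal.toReal_ofReal (by positivity), hE]
    rfl
  have hbig : volume {y | ‖usc L l J (y - 0)‖ ≤ δ⁻¹} = ENNReal.ofReal (δ⁻¹ ^ 2) * volume E := by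
    rw [volume_norm_usc_sub_le J 0 (by positivity), hE]
  have hsub : S ⊆ {y | ‖usc L l J (y - 0)‖ ≤ δ⁻¹} := fun y hy => by
    rw [mem_ofPred_eq, sub_zero]; exact hS' y hy
  have hbig' : volume {y | ‖usc L l J (y - 0)‖ ≤ δ⁻¹} ≠ ⊤ := by
    rw [hbig]
    exact ENNReal.mul_ne_top ENNReal.ofReal_ne_top hEc.measure_lt_top.ne
  have hSfin : volume S ≠ ⊤ := ne_top_of_le_ne_top hbig' (measure_mono hsub)
  have hSv : volume.real S ≤ δ⁻¹ ^ 2 * volume.real E := by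
    refine (measureReal_mono hsub hbig').trans_eq ?_
    rw [Measure.real, hbig, ENNReal.toReal_mul, ENNReal.toReal_ofReal (by positivity)]
    rfl
  have hbdd : Bornology.IsBounded S := by
    refine (isCompact_closedBall (0 : ℂ) δ⁻¹ |>.image (scHomeo hL hl J).continuous).isBounded.subset
      fun y hy => ⟨usc L l J y, by simpa using hS' y hy, sc_usc hL hl y⟩
  obtain ⟨R, hR⟩ := hbdd.exists_norm_le
  have hint : IntegrableOn (fun x : F => x) S := by
    refine Measure.integrableOn_of_bounded (M := R) hSfin (by fun_prop) ?_
    filter_upwards [ae_restrict_mem hSm] with x hx using hR x hx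
  have hintw : IntegrableOn (fun x : F => ⟪w, x⟫) S := hint.const_inner w
  have hint0 : ∫ x in S, ⟪w, x⟫ = 0 := by
    rw [integral_inner hint, hcm, inner_zero_right]
  have hintt : IntegrableOn (fun x : F => t - ⟪w, x⟫) S :=
    (integrableOn_const (C := t) hSfin).sub hintw
  have htot : ∫ x in S, (t - ⟪w, x⟫) = volume.real S * t := by
    rw [integral_sub (integrableOn_const (C := t) hSfin) hintw, hint0, sub_zero, setIntegral_const,
      smul_eq_mul]
  obtain ⟨N, hN⟩ : ∃ N : ℝ, N = L * l * ‖usc l L J w‖ := ⟨_, rfl⟩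
  have hN0 : 0 < N := by rw [hN]; positivity
  have hlow : ∀ x ∈ Q, δ / 4 * N ≤ t - ⟪w, x⟫ := by
    intro x hx
    rw [hQ, mem_ofPred_eq] at hx
    obtain ⟨z, hz⟩ : ∃ z : F, z = sc L l J ((‖usc l L J w‖)⁻¹ • usc l L J w) := ⟨_, rfl⟩
    have huz : usc L l J z = (‖usc l L J w‖)⁻¹ • usc l L J w := by rw [hz, usc_sc hL hl]
    have hzn : ‖usc L l J z‖ = 1 := by
      rw [huz, norm_smul, norm_inv, norm_norm, inv_mul_cancel₀ hu.ne']
    have hwz : ⟪w, z⟫ = N := by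
      rw [real_inner_comm, inner_eq_usc hL hl J, huz, real_inner_smul_left,
        real_inner_self_eq_norm_sq, hN]
      field_simp
    have h1 := ht (x + (δ / 4) • z) (hS _ (by
      rw [add_sub_right_comm, usc_add, usc_smul]
      refine (norm_add_le _ _).trans_lt ?_
      rw [norm_smul, hzn, Real.norm_of_nonneg (by positivity)]
      linarith))
    rw [inner_add_right, real_inner_smul_right, hwz] at h1
    linarith
  have hge : volume.real Q * (δ / 4 * N) ≤ volume.real S * t := by
    rw [← htot]
    calc volume.real Q * (δ / 4 * N) = ∫ _ in Q, δ / 4 * N := by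
          rw [setIntegral_const, smul_eq_mul]
      _ ≤ ∫ x in Q, (t - ⟪w, x⟫) :=
          setIntegral_mono_on (integrableOn_const (ne_top_of_le_ne_top hSfin (measure_mono hQS)))
            (hintt.mono_set hQS) hQm hlow
      _ ≤ ∫ x in S, (t - ⟪w, x⟫) := by
          refine setIntegral_mono_set hintt ?_ (Filter.Eventually.of_forall hQS)
          filter_upwards [ae_restrict_mem hSm] with x hx
          exact sub_nonneg.2 (ht x hx).le
  rw [hQv] at hge
  have ht0 : 0 < t := by
    have h1 : 0 < volume.real S * t := lt_of_lt_of_le (by positivity) hge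
    exact pos_of_mul_pos_right h1 measureReal_nonneg
  have h2 : (δ / 2) ^ 2 * volume.real E * (δ / 4 * N) ≤ δ⁻¹ ^ 2 * volume.real E * t :=
    hge.trans (by gcongr)
  rw [← hN]
  have h3 : volume.real E * δ⁻¹ ^ 2 * (δ ^ 5 / 16 * N) ≤ volume.real E * δ⁻¹ ^ 2 * t := by
    calc volume.real E * δ⁻¹ ^ 2 * (δ ^ 5 / 16 * N)
        = (δ / 2) ^ 2 * volume.real E * (δ / 4 * N) := by field_simp; ring
      _ ≤ _ := h2
      _ = _ := by ring
  exact le_of_mul_le_mul_left h3 (by positivity)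

/-- A centred section comparable to an ellipse normalizes the potential. -/
theorem DualPair.normalizedAt_of_section {u v : F → ℝ} {A B : Set F} (h : DualPair u v A B)
    (hL : 0 < L) (hl : 0 < l) (hδ : 0 < δ) (hδ1 : δ ≤ 1) {p x₀ : F}
    (hcm : ∫ x in {x | u x < ⟪p, x⟫ + L * l}, x = 0)
    (hA : ∀ x, ‖usc L l J (x - x₀)‖ < δ → x ∈ A)
    (hS : ∀ x, ‖usc L l J (x - x₀)‖ < δ → u x < ⟪p, x⟫ + L * l)
    (hS' : ∀ x, u x < ⟪p, x⟫ + L * l → ‖usc L l J x‖ ≤ δ⁻¹) :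
    NormalizedAt (δ ^ 10 / 2048) u A (δ ^ 5 / 32 * L) (δ ^ 5 / 32 * l) J := by
  have hcont := h.convexOn.continuous_of_univ
  have hLl : 0 < L * l := by positivity
  have hSm : MeasurableSet {x | u x < ⟪p, x⟫ + L * l} :=
    (isOpen_lt hcont (by fun_prop)).measurableSet
  have hmem : ∀ z, ‖usc L l J z‖ ≤ δ ^ 5 / 32 → u z < ⟪p, z⟫ + L * l := by
    intro z hz
    by_contra hcon
    push Not at hcon
    obtain ⟨q, hq⟩ := exists_isSub h.convexOn z
    have hsep : ∀ x ∈ {x | u x < ⟪p, x⟫ + L * l}, ⟪q - p, x⟫ < ⟪q - p, z⟫ := by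
      intro x hx
      rw [mem_ofPred_eq] at hx
      have := hq x
      rw [inner_sub_right] at this
      rw [inner_sub_left, inner_sub_left]
      linarith
    have hx₀ := hS x₀ (by rw [sub_self, usc_zero, norm_zero]; exact hδ)
    have hne : q - p ≠ 0 := by
      intro h0
      have := hsep x₀ hx₀
      rw [h0, inner_zero_left, inner_zero_left] at this
      exact lt_irrefl _ this
    have h1 := le_inner_of_centroid hL hl hδ hSm hcm hS hS' hne hsep
    have hu : 0 < ‖usc l L J (q - p)‖ := by
      rw [norm_pos_iff]
      intro h0
      apply hne
      rw [← sc_usc (J := J) hl hL (q - p), h0, sc_zero]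
    have h2 := inner_le_usc hL hl J z (q - p)
    rw [real_inner_comm] at h2
    have h3 : L * l * (‖usc L l J z‖ * ‖usc l L J (q - p)‖) ≤
        L * l * (δ ^ 5 / 32 * ‖usc l L J (q - p)‖) := by gcongr
    have h4 : 0 < δ ^ 5 * (L * l * ‖usc l L J (q - p)‖) := by positivity
    linarith
  have hc : 0 < δ ^ 5 / 32 := by positivity
  have hD := h.comp_sc (L := δ ^ 5 / 32 * L) (l := δ ^ 5 / 32 * l) (by positivity) (by positivity) J
  have hsc : ∀ a, usc L l J (sc (δ ^ 5 / 32 * L) (δ ^ 5 / 32 * l) J a) = (δ ^ 5 / 32) • a := by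
    generalize δ ^ 5 / 32 = c
    intro a
    apply Complex.ext <;> simp [usc, sc] <;> field_simp
  refine ⟨by positivity, by positivity, hD.convexOn, hD.isOpen, hD.convex, hD.alex, hD.nonneg,
    hD.map_zero, ?_, hD.zero_mem, ?_⟩
  · intro w hw
    obtain ⟨z, hz⟩ : ∃ z : F, z = sc (δ ^ 5 / 32 * L) (δ ^ 5 / 32 * l) J w := ⟨_, rfl⟩
    have hzn : ‖usc L l J z‖ ≤ δ ^ 5 / 32 := by
      rw [hz, hsc, norm_smul, Real.norm_of_nonneg hc.le]
      exact mul_le_of_le_one_right hc.le hw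
    have h1 := hmem z hzn
    have h2 := hmem (-z) (by rw [← zero_sub, usc_sub, usc_zero, zero_sub, norm_neg]; exact hzn)
    rw [inner_neg_right] at h2
    have h3 := h.nonneg (-z)
    change u (sc _ _ J w) / _ ≤ _
    rw [← hz, div_le_div_iff₀ (by positivity) (by positivity)]
    have h4 : u z ≤ 2 * (L * l) := by linarith
    calc u z * (δ ^ 10 / 2048) ≤ 2 * (L * l) * (δ ^ 10 / 2048) := by gcongr
      _ = _ := by ring
  · obtain ⟨θ, hθ⟩ : ∃ θ : ℝ, θ = δ ^ 6 / 64 := ⟨_, rfl⟩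
    have hθ0 : 0 < θ := by rw [hθ]; positivity
    have hδ6 : δ ^ 6 ≤ 1 := pow_le_one₀ hδ.le hδ1
    have hu0 := hS' x₀ (hS x₀ (by rw [sub_self, usc_zero, norm_zero]; exact hδ))
    refine ⟨(θ / (δ ^ 5 / 32)) • usc L l J x₀, ?_, ?_⟩
    · rw [norm_smul, Real.norm_of_nonneg (by positivity)]
      calc θ / (δ ^ 5 / 32) * ‖usc L l J x₀‖ ≤ θ / (δ ^ 5 / 32) * δ⁻¹ := by gcongr
        _ = 1 / 2 := by rw [hθ]; field_simp; norm_num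
    · intro b hb
      rw [mem_ball, dist_eq_norm] at hb
      obtain ⟨z, hz⟩ : ∃ z : F, z = sc (δ ^ 5 / 32 * L) (δ ^ 5 / 32 * l) J b := ⟨_, rfl⟩
      rw [mem_preimage, ← hz]
      have hzA : θ⁻¹ • z ∈ A := by
        apply hA
        have h1 : usc L l J (θ⁻¹ • z - x₀) =
            (θ⁻¹ * (δ ^ 5 / 32)) • (b - (θ / (δ ^ 5 / 32)) • usc L l J x₀) := by
          rw [usc_sub, usc_smul, hz, hsc, smul_smul, smul_sub, smul_smul]
          congr 1
          rw [show θ⁻¹ * (δ ^ 5 / 32) * (θ / (δ ^ 5 / 32)) = 1 by field_simp, one_smul]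
        rw [h1, norm_smul, Real.norm_of_nonneg (by positivity)]
        calc θ⁻¹ * (δ ^ 5 / 32) * ‖b - (θ / (δ ^ 5 / 32)) • usc L l J x₀‖
            < θ⁻¹ * (δ ^ 5 / 32) * (δ ^ 10 / 2048) := by gcongr
          _ = δ ^ 9 / 1024 := by rw [hθ]; field_simp; norm_num
          _ < δ ^ 9 := by linarith [pow_pos hδ 9]
          _ ≤ δ := pow_le_of_le_one hδ.le hδ1 (by norm_num)
      have := h.convex.smul_mem_of_zero_mem_closure h.isOpen h.zero_mem hzA hθ0 (by linarith)
      rwa [smul_smul, mul_inv_cancel₀ hθ0.ne', one_smul] at this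

end

section

variable {L l δ : ℝ} {J : ℂ ≃ₗᵢ[ℝ] R2} {e f : R2}

theorem mem_ellipse_iff (he : ‖e‖ = 1) (hf : ‖f‖ = 1) (hef : ⟪e, f⟫ = 0)
    (hJ : ∀ a b : ℝ, J ⟨a, b⟩ = a • e + b • f) (x : R2) :
    (x ∈ ellipse e f L l ↔ ‖usc L l J x‖ ≤ 1) ∧ (x ∈ ellipse f e L l ↔ ‖usc l L J x‖ ≤ 1) := by
  have hx : x = (J.symm x).re • e + (J.symm x).im • f := by
    rw [← hJ]; exact (J.apply_symm_apply x).symm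
  have h1 : ⟪x, e⟫ = (J.symm x).re := by
    nth_rw 1 [hx]
    rw [inner_add_left, real_inner_smul_left, real_inner_smul_left, real_inner_self_eq_norm_sq, he,
      real_inner_comm, hef]
    ring
  have h2 : ⟪x, f⟫ = (J.symm x).im := by
    nth_rw 1 [hx]
    rw [inner_add_left, real_inner_smul_left, real_inner_smul_left, real_inner_self_eq_norm_sq, hf,
      hef]
    ring
  have key : ∀ a b : ℝ, ‖(⟨a, b⟩ : ℂ)‖ ≤ 1 ↔ a ^ 2 + b ^ 2 ≤ 1 := fun a b => by
    rw [Complex.norm_eq_sqrt_sq_add_sq, Real.sqrt_le_one]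
  constructor
  · rw [usc, key, ellipse, mem_ofPred_eq, h1, h2]
  · rw [usc, key, ellipse, mem_ofPred_eq, h1, h2, add_comm]

theorem exists_of_section {w : R2 → ℝ} {Ω E : Set R2} {δb h : ℝ} (hδb : 0 < δb) (hδ : 0 < δ)
    (hδδ : δ ≤ δb) (hw0 : w 0 = 0) (hE : ∀ x, x ∈ E ↔ ‖usc L l J x‖ ≤ 1)
    (hS : ∃ S : Set R2, IsCentredSection w 0 h S ∧
      (∃ xh : R2, (fun z => xh + δb • z) '' E ⊆ Ω ∩ S) ∧ S ⊆ (fun z => δb⁻¹ • z) '' E) :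
    ∃ p x₀ : R2, ∫ x in {x | w x < ⟪p, x⟫ + h}, x = 0 ∧
      (∀ x, ‖usc L l J (x - x₀)‖ < δ → x ∈ interior Ω) ∧
      (∀ x, ‖usc L l J (x - x₀)‖ < δ → w x < ⟪p, x⟫ + h) ∧
      ∀ x, w x < ⟪p, x⟫ + h → ‖usc L l J x‖ ≤ δ⁻¹ := by
  obtain ⟨S, ⟨p, rfl, hcm⟩, ⟨x₀, hx₀⟩, hsub⟩ := hS
  simp only [hw0, sub_zero, zero_add] at hcm hx₀ hsub
  have hin : ∀ x, ‖usc L l J (x - x₀)‖ < δ → x ∈ Ω ∩ {x | w x < ⟪p, x⟫ + h} := by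
    intro x hx
    refine hx₀ ⟨δb⁻¹ • (x - x₀), (hE _).2 ?_, ?_⟩
    · rw [usc_smul, norm_smul, norm_inv, Real.norm_of_nonneg hδb.le, inv_mul_le_one₀ hδb]
      linarith
    · simp only
      rw [smul_smul, mul_inv_cancel₀ hδb.ne', one_smul, add_sub_cancel]
  have hopen : IsOpen {x | ‖usc L l J (x - x₀)‖ < δ} :=
    isOpen_lt (continuous_usc.comp (continuous_id.sub continuous_const)).norm continuous_const
  refine ⟨p, x₀, hcm, fun x hx => ?_, fun x hx => (hin x hx).2, fun x hx => ?_⟩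
  · exact interior_maximal (fun y hy => (hin y hy).1) hopen hx
  · obtain ⟨z, hz, rfl⟩ := hsub hx
    rw [hE] at hz
    simp only
    rw [usc_smul, norm_smul, norm_inv, Real.norm_of_nonneg hδb.le]
    calc δb⁻¹ * ‖usc L l J z‖ ≤ δ⁻¹ * 1 := by gcongr
      _ = δ⁻¹ := mul_one _

theorem exists_mem_le_abs_inner {F : Type*} [NormedAddCommGroup F] [InnerProductSpace ℝ F]
    {A : Set F} (hA : Convex ℝ A) (hAo : IsOpen A) (h0 : 0 ∈ closure A) (hδ : 0 < δ) (hδ1 : δ ≤ 1)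
    {x₀ : F} (hx₀ : ‖x₀‖ ≤ δ⁻¹) (hball : ball x₀ δ ⊆ A) {w : F} (hw : ‖w‖ = 1) :
    ∃ g ∈ A, ‖g‖ ≤ 1 ∧ δ ^ 2 / 4 ≤ |⟪g, w⟫| := by
  have hδi : 1 ≤ δ⁻¹ := (one_le_inv₀ hδ).2 hδ1
  have key : ∀ s : ℝ, |s| = δ / 2 → δ / 2 ≤ |⟪x₀ + s • w, w⟫| →
      ∃ g ∈ A, ‖g‖ ≤ 1 ∧ δ ^ 2 / 4 ≤ |⟪g, w⟫| := by
    intro s hs hle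
    have hsw : ‖s • w‖ = δ / 2 := by rw [norm_smul, hw, mul_one, Real.norm_eq_abs, hs]
    refine ⟨(δ / 2) • (x₀ + s • w), ?_, ?_, ?_⟩
    · refine hA.smul_mem_of_zero_mem_closure hAo h0 (hball ?_) (by positivity) (by linarith)
      rw [mem_ball, dist_eq_norm, add_sub_cancel_left, hsw]
      linarith
    · rw [norm_smul, Real.norm_of_nonneg (by positivity)]
      have h1 := norm_add_le x₀ (s • w)
      have h2 : ‖x₀ + s • w‖ ≤ 2 * δ⁻¹ := by linarith
      calc δ / 2 * ‖x₀ + s • w‖ ≤ δ / 2 * (2 * δ⁻¹) := by gcongr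
        _ = 1 := by field_simp
    · rw [real_inner_smul_left, abs_mul, abs_of_nonneg (by positivity)]
      calc δ ^ 2 / 4 = δ / 2 * (δ / 2) := by ring
        _ ≤ _ := by gcongr
  have hin : ∀ s : ℝ, ⟪x₀ + s • w, w⟫ = ⟪x₀, w⟫ + s := fun s => by
    rw [inner_add_left, real_inner_smul_left, real_inner_self_eq_norm_sq, hw]; ring
  rcases le_total 0 ⟪x₀, w⟫ with h | h
  · refine key (δ / 2) (abs_of_pos (by positivity)) ?_
    rw [hin]
    exact le_trans (by linarith) (le_abs_self _)
  · refine key (-(δ / 2)) (by rw [abs_neg, abs_of_pos (by positivity)]) ?_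
    rw [hin]
    exact le_trans (by linarith) (neg_le_abs _)

end

theorem stmt_17 :
    ∀ δb : ℝ, 0 < δb → ∀ ε : ℝ, 0 < ε →
      ∃ C : ℝ, 0 < C ∧
        ∀ (u v : R2 → ℝ) (Ω₁ Ω₂ : Set R2) (L l : ℝ → ℝ) (e f : ℝ → R2),
          InSFamily δb u v Ω₁ Ω₂ L l e f →
          ∀ h : ℝ, 0 < h → h ≤ 1 → L h / l h ≤ C * h ^ (-ε) := by
  intro δb hδb ε hε
  obtain ⟨δ, hδ⟩ : ∃ δ, δ = min δb 1 := ⟨_, rfl⟩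
  have hδ0 : 0 < δ := by rw [hδ]; exact lt_min hδb one_pos
  have hδδ : δ ≤ δb := by rw [hδ]; exact min_le_left _ _
  have hδ1 : δ ≤ 1 := by rw [hδ]; exact min_le_right _ _
  have h10 : δ ^ 10 ≤ 1 := pow_le_one₀ hδ0.le hδ1
  have h5 : δ ^ 5 ≤ 1 := pow_le_one₀ hδ0.le hδ1
  obtain ⟨C, hC, hmain⟩ := exists_div_le (κ := δ ^ 10 / 2048) (β := δ ^ 2 / 4) (c := δ ^ 5 / 32)
    (by positivity) (by linarith) (by positivity) hε (by positivity) (by linarith)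
  refine ⟨C, hC, ?_⟩
  rintro u v Ω₁ Ω₂ L l e f ⟨hu, hv, h₁, h₂, hi₁, hi₂, h0₁, h0₂, hg₁, hg₂, hA₁, hu0, hus, hA₂, hv0,
    hvs, hLeg, hL1, hl1, hfam⟩ h hh0 hh1
  have hdual : DualPair u v (interior Ω₁) (interior Ω₂) := DualPair.of_transport hu hv h₁ h₂ hi₁ hi₂
    h0₁ h0₂ hg₁ hg₂ hA₁ hu0 hus hA₂ hv0 hvs hLeg
  have hframe : ∀ h : ℝ, ∃ J : ℂ ≃ₗᵢ[ℝ] R2, h ∈ Ioc (0 : ℝ) 1 →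
      ∀ a b : ℝ, J ⟨a, b⟩ = a • e h + b • f h := by
    intro h
    by_cases hh : h ∈ Ioc (0 : ℝ) 1
    · obtain ⟨he, hf, hef, -⟩ := hfam h hh
      obtain ⟨J, hJ⟩ := exists_isometry_of_frame (F := R2) (by simp) he hf hef
      exact ⟨J, fun _ => hJ⟩
    · obtain ⟨he, hf, hef, -⟩ := hfam 1 ⟨one_pos, le_rfl⟩
      obtain ⟨J, -⟩ := exists_isometry_of_frame (F := R2) (by simp) he hf hef
      exact ⟨J, fun h => absurd h hh⟩
  choose J hJ using hframe
  have hsec : ∀ h ∈ Ioc (0 : ℝ) 1, ∃ p x₀ : R2, ∫ x in {x | u x < ⟪p, x⟫ + h}, x = 0 ∧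
      (∀ x, ‖usc (L h) (l h) (J h) (x - x₀)‖ < δ → x ∈ interior Ω₁) ∧
      (∀ x, ‖usc (L h) (l h) (J h) (x - x₀)‖ < δ → u x < ⟪p, x⟫ + h) ∧
      ∀ x, u x < ⟪p, x⟫ + h → ‖usc (L h) (l h) (J h) x‖ ≤ δ⁻¹ := fun h hh => by
    obtain ⟨he, hf, hef, -, -, -, hS, -⟩ := hfam h hh
    exact exists_of_section hδb hδ0 hδδ hu0 (fun x => (mem_ellipse_iff he hf hef (hJ h hh) x).1) hS
  have hsec' : ∀ h ∈ Ioc (0 : ℝ) 1, ∃ p x₀ : R2, ∫ x in {x | v x < ⟪p, x⟫ + h}, x = 0 ∧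
      (∀ x, ‖usc (l h) (L h) (J h) (x - x₀)‖ < δ → x ∈ interior Ω₂) ∧
      (∀ x, ‖usc (l h) (L h) (J h) (x - x₀)‖ < δ → v x < ⟪p, x⟫ + h) ∧
      ∀ x, v x < ⟪p, x⟫ + h → ‖usc (l h) (L h) (J h) x‖ ≤ δ⁻¹ := fun h hh => by
    obtain ⟨he, hf, hef, -, -, -, -, hS⟩ := hfam h hh
    exact exists_of_section hδb hδ0 hδδ hv0 (fun x => (mem_ellipse_iff he hf hef (hJ h hh) x).2) hS
  have hscale : ∀ h ∈ Ioc (0 : ℝ) 1, L h * l h = h ∧ Scale (δ ^ 10 / 2048) u v (interior Ω₁)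
      (interior Ω₂) (δ ^ 5 / 32 * L h) (δ ^ 5 / 32 * l h) (J h) := by
    intro h hh
    obtain ⟨-, -, -, hl, hlL, hmul, -⟩ := hfam h hh
    have hL : 0 < L h := hl.trans_le hlL
    refine ⟨hmul, by gcongr, ?_, ?_⟩
    · obtain ⟨p, x₀, k1, k2, k3, k4⟩ := hsec h hh
      exact hdual.normalizedAt_of_section hL hl hδ0 hδ1 (by rwa [hmul]) k2 (by rwa [hmul])
        (by rwa [hmul])
    · obtain ⟨p, x₀, k1, k2, k3, k4⟩ := hsec' h hh
      rw [mul_comm] at hmul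
      exact hdual.symm.normalizedAt_of_section hl hL hδ0 hδ1 (by rwa [hmul]) k2 (by rwa [hmul])
        (by rwa [hmul])
  have hone : ∀ x, ‖usc 1 1 (J 1) x‖ = ‖x‖ := fun x => by
    rw [← (J 1).symm.norm_map x]
    simp [usc]
  have h1mem : (1 : ℝ) ∈ Ioc (0 : ℝ) 1 := ⟨one_pos, le_rfl⟩
  have hfat : ∀ w : R2, ‖w‖ = 1 → ∃ g ∈ interior Ω₁, ‖g‖ ≤ 1 ∧ δ ^ 2 / 4 ≤ |⟪g, w⟫| := by
    intro w hw
    obtain ⟨p, x₀, -, k2, k3, k4⟩ := hsec 1 h1mem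
    simp only [hL1, hl1, hone] at k2 k3 k4
    exact exists_mem_le_abs_inner hdual.convex hdual.isOpen hdual.zero_mem hδ0 hδ1
      (k4 x₀ (k3 x₀ (by simpa using hδ0))) (fun x hx => k2 x (by rwa [← dist_eq_norm])) hw
  have hfat' : ∀ w : R2, ‖w‖ = 1 → ∃ g ∈ interior Ω₂, ‖g‖ ≤ 1 ∧ δ ^ 2 / 4 ≤ |⟪g, w⟫| := by
    intro w hw
    obtain ⟨p, x₀, -, k2, k3, k4⟩ := hsec' 1 h1mem
    simp only [hL1, hl1, hone] at k2 k3 k4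
    exact exists_mem_le_abs_inner hdual.convex' hdual.isOpen' hdual.zero_mem' hδ0 hδ1
      (k4 x₀ (k3 x₀ (by simpa using hδ0))) (fun x hx => k2 x (by rwa [← dist_eq_norm])) hw
  have := hmain R2 u v (interior Ω₁) (interior Ω₂) L l J hdual hfat hfat' hL1 hl1 hscale h
    ⟨hh0, hh1⟩
  rw [Real.rpow_neg hh0.le, ← div_eq_mul_inv, le_div_iff₀ (Real.rpow_pos_of_pos hh0 ε)]
  exact this
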